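/- Fix an integer r ≥ 1 and real numbers σ ∈ (0,1), ν > 0. For a time-dependent vector field w on 𝕋³ define recursively Q^w_0(t) := 1 and, for 1 ≤ j ≤ r, Q^w_j(t) := 1 + Σ_{m=0}^{j−1} Q^w_m(t) ∫₀^t ‖∇^{j−m} w(·,τ)‖²_{L^∞(𝕋³)} dτ. Then there exists a constant C > 0, depending only on r, σ, ν (but not on w), with the following property. Let (w,P_w) be a smooth global solution of the Navier–Stokes equations with viscosity ν on 𝕋³ × [0,∞) whose initial datum w₀ := w(·,0) has zero mean and which satisfies ∫₀^∞ ‖∇^m w(·,t)‖²_{L^∞} dt < ∞ for every 0 ≤ m ≤ r. If u₀ is a smooth divergence-free vector field on 𝕋³ with zero mean satisfying ‖u₀ − w₀‖_{H^r} < C^{-1} · Q^w_r(∞)^{−1/2} · exp(−C ∫₀^∞ ‖w(·,t)‖²_{L^∞} dt), then there exists a global smooth solution u of the Navier–Stokes equations with viscosity ν and initial datum u₀, and it satisfies, for every integer 0 ≤ m ≤ r and every t > 0, ‖u(·,t) − w(·,t)‖_{H^m} ≤ C · Q^w_m(t)^{1/2} · exp(C ∫₀^∞ ‖w(·,τ)‖²_{L^∞}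 dτ) · ‖u₀ − w₀‖_{H^m} · e^{−νσt}. -/

import Mathlib

open MeasureTheory Real Set

noncomputable section

abbrev E3 := Fin 3 → ℝ

def T3 : Set E3 := Set.Icc 0 (fun _ => 2 * Real.pi)

def SpacePeriodic {ι : Type*} (f : E3 → ι) : Prop :=
  ∀ (x : E3) (j : Fin 3), f (x + (2 * Real.pi) • (Pi.single j 1 : E3)) = f x

def pd (j : Fin 3) (f : E3 → ℝ) : E3 → ℝ := fun x => fderiv ℝ f x (Pi.single j 1 : E3)

def pdM (β : Fin 3 → ℕ) (f : E3 → ℝ) : E3 → ℝ :=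
  (pd 0)^[β 0] ((pd 1)^[β 1] ((pd 2)^[β 2] f))

def midx (m : ℕ) : Finset (Fin 3 → ℕ) := Finset.Nat.antidiagonalTuple 3 m

def gradSq {ι : Type*} [Fintype ι] (m : ℕ) (f : E3 → ι → ℝ) (x : E3) : ℝ :=
  ∑ i : ι, ∑ β ∈ midx m, (pdM β (fun y => f y i) x) ^ 2

def HnormSq {ι : Type*} [Fintype ι] (r : ℕ) (f : E3 → ι → ℝ) : ℝ :=
  ∑ m ∈ Finset.range (r + 1), ∫ x in T3, gradSq m f x

def Hnorm {ι : Type*} [Fintype ι] (r : ℕ) (f : E3 → ι → ℝ) : ℝ :=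
  Real.sqrt (HnormSq r f)

def L2norm {ι : Type*} [Fintype ι] (f : E3 → ι → ℝ) : ℝ := Hnorm 0 f

def LinfGrad {ι : Type*} [Fintype ι] (m : ℕ) (f : E3 → ι → ℝ) : ℝ :=
  ⨆ x : E3, Real.sqrt (gradSq m f x)

def Linf {ι : Type*} [Fintype ι] (f : E3 → ι → ℝ) : ℝ := LinfGrad 0 f

def ZeroMean {ι : Type*} [Fintype ι] (f : E3 → ι → ℝ) : Prop :=
  ∀ i, (∫ x in T3, f x i) = 0

def vdiv (u : E3 → E3) : E3 → ℝ := fun x => ∑ j, pd j (fun y => u y j) x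

def vcurl (u : E3 → E3) : E3 → E3 := fun x =>
  ![pd 1 (fun y => u y 2) x - pd 2 (fun y => u y 1) x,
    pd 2 (fun y => u y 0) x - pd 0 (fun y => u y 2) x,
    pd 0 (fun y => u y 1) x - pd 1 (fun y => u y 0) x]

def lap (f : E3 → ℝ) : E3 → ℝ := fun x => ∑ j, pd j (pd j f) x

def IsNS (ν : ℝ) (I : Set ℝ) (u : E3 → ℝ → E3) (P : E3 → ℝ → ℝ) : Prop :=
  (∀ t ∈ I, ∀ (x : E3) (i : Fin 3),
      derivWithin (fun τ => u x τ i) I t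
        + (∑ j, u x t j * pd j (fun y => u y t i) x)
        - ν * lap (fun y => u y t i) x
        = - pd i (fun y => P y t) x) ∧
  (∀ t ∈ I, ∀ x : E3, vdiv (fun y => u y t) x = 0)

def SmoothOnTime (u : E3 → ℝ → E3) (I : Set ℝ) : Prop :=
  ContDiffOn ℝ (⊤ : ℕ∞) (fun p : E3 × ℝ => u p.1 p.2) (Set.univ ×ˢ I)

def wNormInf (m : ℕ) (w : E3 → ℝ → E3) (t : ℝ) : ℝ := LinfGrad m (fun x => w x t)

def Q (w : E3 → ℝ → E3) : ℕ → ℝ → ℝ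
  | 0, _ => 1
  | (j + 1), t => 1 + ∑ m ∈ (Finset.range (j + 1)).attach,
      Q w m.1 t * ∫ τ in (0:ℝ)..t, (wNormInf (j + 1 - m.1) w τ) ^ 2
  decreasing_by exact Finset.mem_range.mp m.2

def Qinf (w : E3 → ℝ → E3) (r : ℕ) : ℝ := ⨆ t : Set.Ici (0:ℝ), Q w r t

/-- Smoothness of a time-dependent scalar function (e.g. the pressure) on `𝕋³ × I`. -/
def SmoothOnTimeS (P : E3 → ℝ → ℝ) (I : Set ℝ) : Prop :=
  ContDiffOn ℝ (⊤ : ℕ∞) (fun p : E3 × ℝ => P p.1 p.2) (Set.univ ×ˢ I)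

namespace NSE

/-- Frequencies of Fourier modes on the torus. -/
abbrev K3 := Fin 3 → ℤ

/-- The squared Euclidean length of a frequency. -/
def q (k : K3) : ℝ := ∑ j, (k j : ℝ) ^ 2

/-- The inhomogeneous weight `1 + |k|²`. -/
def J (k : K3) : ℝ := 1 + q k

lemma q_nonneg (k : K3) : 0 ≤ q k := Finset.sum_nonneg fun _ _ => sq_nonneg _

lemma one_le_J (k : K3) : 1 ≤ J k := by
  have := q_nonneg k
  unfold J
  linarith

lemma J_pos (k : K3) : 0 < J k := lt_of_lt_of_le one_pos (one_le_J k)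

lemma q_neg (k : K3) : q (-k) = q k := by simp [q]

lemma sq_le_q (k : K3) (j : Fin 3) : (k j : ℝ) ^ 2 ≤ q k :=
  Finset.single_le_sum (f := fun j => (k j : ℝ) ^ 2) (fun _ _ => sq_nonneg _) (Finset.mem_univ j)

lemma one_le_q {k : K3} (hk : k ≠ 0) : 1 ≤ q k := by
  obtain ⟨j, hj⟩ : ∃ j, k j ≠ 0 := by
    by_contra! h
    exact hk (funext h)
  refine le_trans ?_ (sq_le_q k j)
  have : 1 ≤ (k j) ^ 2 := Int.one_le_abs hj |> fun h => by nlinarith [sq_abs (k j)]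
  exact_mod_cast this

lemma J_le_two_q {k : K3} (hk : k ≠ 0) : J k ≤ 2 * q k := by
  have := one_le_q hk
  unfold J
  linarith

lemma abs_le_J (k : K3) (j : Fin 3) : |(k j : ℝ)| ≤ J k := by
  have h := sq_le_q k j
  unfold J
  nlinarith [sq_abs (k j : ℝ), sq_nonneg (|(k j : ℝ)| - 1)]

lemma q_add_le (l n : K3) : q (l + n) ≤ 2 * (q l + q n) := by
  simp only [q, Finset.mul_sum, ← Finset.sum_add_distrib]
  refine Finset.sum_le_sum fun j _ => ?_
  push_cast [Pi.add_apply]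
  nlinarith [sq_nonneg ((l j : ℝ) - n j)]

lemma J_le_mul (k l : K3) : J k ≤ 2 * J l * J (k - l) := by
  have h := q_add_le l (k - l)
  rw [add_sub_cancel] at h
  have h1 := q_nonneg l
  have h2 := q_nonneg (k - l)
  unfold J
  nlinarith [mul_nonneg h1 h2]

lemma q_pow_add_le (m : ℕ) (l n : K3) : q (l + n) ^ m ≤ 4 ^ m * (q l ^ m + q n ^ m) := by
  have h1 := q_nonneg l
  have h2 := q_nonneg n
  have h : q (l + n) ^ m ≤ (2 * (q l + q n)) ^ m := pow_le_pow_left₀ (q_nonneg _) (q_add_le l n) m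
  have h3 : q l + q n ≤ 2 * max (q l) (q n) := by
    linarith [le_max_left (q l) (q n), le_max_right (q l) (q n)]
  have h4 : (2 * (q l + q n)) ^ m ≤ (4 * max (q l) (q n)) ^ m :=
    pow_le_pow_left₀ (by positivity) (by linarith) m
  refine h.trans (h4.trans ?_)
  rw [mul_pow]
  gcongr
  rcases le_total (q l) (q n) with h | h
  · rw [max_eq_right h]
    linarith [pow_nonneg h1 m]
  · rw [max_eq_left h]
    linarith [pow_nonneg h2 m]

lemma summable_J : Summable fun k : K3 => (J k ^ 2)⁻¹ := by
  have h1 : Summable fun n : ℤ => (1 + (n : ℝ) ^ 2) ^ (-(2 / 3 : ℝ)) := by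
    have h0 : Summable fun n : ℤ => |(n : ℝ)| ^ (-(4 / 3 : ℝ)) :=
      summable_abs_int_rpow (by norm_num)
    refine Summable.of_norm_bounded_eventually h0 ?_
    have : ∀ᶠ n : ℤ in Filter.cofinite, n ≠ 0 := by
      simpa using (Set.finite_singleton (0 : ℤ)).compl_mem_cofinite
    filter_upwards [this] with n hn
    have hn' : 0 < |(n : ℝ)| := by positivity
    rw [Real.norm_of_nonneg (by positivity)]
    have : |(n : ℝ)| ^ (-(4 / 3 : ℝ)) = ((n : ℝ) ^ 2) ^ (-(2 / 3 : ℝ)) := by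
      rw [← sq_abs, ← Real.rpow_natCast, ← Real.rpow_mul hn'.le]
      norm_num
    rw [this]
    exact Real.rpow_le_rpow_of_nonpos (by positivity) (by linarith) (by norm_num)
  have h3 : Summable fun k : K3 => ∏ j, (1 + (k j : ℝ) ^ 2) ^ (-(2 / 3 : ℝ)) := by
    have hA := h1.mul_of_nonneg h1 (fun _ => by positivity) (fun _ => by positivity)
    have hB := h1.mul_of_nonneg hA (fun _ => by positivity) (fun _ => by positivity)
    let e' : K3 ≃ ℤ × ℤ × ℤ :=
      { toFun := fun k => (k 0, k 1, k 2)
        invFun := fun p => ![p.1, p.2.1, p.2.2]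
        left_inv := fun k => by ext j; fin_cases j <;> rfl
        right_inv := fun p => rfl }
    have := (e'.summable_iff (f := fun p : ℤ × ℤ × ℤ => (1 + (p.1 : ℝ) ^ 2) ^ (-(2 / 3 : ℝ)) *
      ((1 + (p.2.1 : ℝ) ^ 2) ^ (-(2 / 3 : ℝ)) * (1 + (p.2.2 : ℝ) ^ 2) ^ (-(2 / 3 : ℝ))))).2 hB
    refine this.congr fun k => ?_
    simp only [Fin.prod_univ_three, mul_assoc]
    rfl
  refine Summable.of_nonneg_of_le (fun k => by have := J_pos k; positivity) (fun k => ?_) h3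
  have hJ := J_pos k
  have hle : ∀ j, (J k) ^ (-(2 / 3 : ℝ)) ≤ (1 + (k j : ℝ) ^ 2) ^ (-(2 / 3 : ℝ)) := fun j =>
    Real.rpow_le_rpow_of_nonpos (by positivity)
      (by have := sq_le_q k j; unfold J; linarith) (by norm_num)
  calc (J k ^ 2)⁻¹ = ∏ _j : Fin 3, (J k) ^ (-(2 / 3 : ℝ)) := by
        rw [Finset.prod_const, Finset.card_univ, Fintype.card_fin, ← Real.rpow_natCast,
          ← Real.rpow_natCast, ← Real.rpow_mul hJ.le, ← Real.rpow_neg hJ.le]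
        norm_num
    _ ≤ _ := Finset.prod_le_prod (fun _ _ => by positivity) fun j _ => hle j

/-- The value of the convergent lattice sum `∑ (1 + |k|²)⁻²`. -/
def SJ : ℝ := ∑' k : K3, (J k ^ 2)⁻¹

lemma SJ_nonneg : 0 ≤ SJ := tsum_nonneg fun k => by have := J_pos k; positivity

/-- Decay of order `p` of a family of Fourier coefficients. -/
def Dec (p : ℕ) (A : ℝ) (f : K3 → ℂ) : Prop := ∀ k, ‖f k‖ * J k ^ p ≤ A

lemma Dec.nonneg {p : ℕ} {A : ℝ} {f : K3 → ℂ} (h : Dec p A f) : 0 ≤ A :=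
  le_trans (mul_nonneg (norm_nonneg _) (pow_nonneg (J_pos 0).le p)) (h 0)

lemma Dec.le {p : ℕ} {A : ℝ} {f : K3 → ℂ} (h : Dec p A f) (k : K3) :
    ‖f k‖ ≤ A * (J k ^ p)⁻¹ := by
  rw [← div_eq_mul_inv, le_div_iff₀ (pow_pos (J_pos k) p)]
  exact h k

lemma Dec.mono {p p' : ℕ} {A A' : ℝ} {f : K3 → ℂ} (h : Dec p A f) (hp : p' ≤ p) (hA : A ≤ A') :
    Dec p' A' f := fun k =>
  le_trans (mul_le_mul_of_nonneg_left (pow_le_pow_right₀ (one_le_J k) hp) (norm_nonneg _))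
    ((h k).trans hA)

lemma Dec.norm_le {p : ℕ} {A : ℝ} {f : K3 → ℂ} (h : Dec p A f) (k : K3) : ‖f k‖ ≤ A := by
  simpa using h.mono (Nat.zero_le p) le_rfl k

lemma Dec.add {p : ℕ} {A B : ℝ} {f g : K3 → ℂ} (hf : Dec p A f) (hg : Dec p B g) :
    Dec p (A + B) (fun k => f k + g k) := fun k => by
  have h := norm_add_le (f k) (g k)
  have hJ := pow_pos (J_pos k) p
  nlinarith [hf k, hg k]

lemma Dec.smul {p s : ℕ} {A M : ℝ} {f : K3 → ℂ} (hf : Dec (p + s) A f) {c : K3 → ℂ}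
    (hc : ∀ k, ‖c k‖ ≤ M * J k ^ s) (hM : 0 ≤ M) : Dec p (M * A) (fun k => c k * f k) := fun k => by
  have hJ := pow_pos (J_pos k) p
  rw [norm_mul]
  calc ‖c k‖ * ‖f k‖ * J k ^ p ≤ (M * J k ^ s) * ‖f k‖ * J k ^ p := by
        gcongr
        exact hc k
    _ = M * (‖f k‖ * J k ^ (p + s)) := by ring
    _ ≤ M * A := by
        gcongr
        exact hf k

lemma Dec.summable {A : ℝ} {f : K3 → ℂ} (h : Dec 2 A f) : Summable fun k => ‖f k‖ :=
  Summable.of_nonneg_of_le (fun _ => norm_nonneg _) (fun k => h.le k) (summable_J.mul_left A)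

/-- Convolution of families of Fourier coefficients. -/
def cv (f g : K3 → ℂ) (k : K3) : ℂ := ∑' l, f l * g (k - l)

lemma cv_term_le {p : ℕ} {A B : ℝ} {f g : K3 → ℂ} (hf : Dec (p + 2) A f) (hg : Dec p B g)
    (k l : K3) : ‖f l * g (k - l)‖ * J k ^ p ≤ 2 ^ p * A * B * (J l ^ 2)⁻¹ := by
  have hA := hf.nonneg
  have hB := hg.nonneg
  have hJ := pow_le_pow_left₀ (J_pos k).le (J_le_mul k l) p
  have hl := J_pos l
  have hn := J_pos (k - l)
  calc ‖f l * g (k - l)‖ * J k ^ p ≤ ‖f l * g (k - l)‖ * (2 * J l * J (k - l)) ^ p := by gcongr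
    _ = 2 ^ p * (‖f l‖ * J l ^ (p + 2)) * (‖g (k - l)‖ * J (k - l) ^ p) * (J l ^ 2)⁻¹ := by
        rw [norm_mul]
        field_simp
        ring
    _ ≤ 2 ^ p * A * B * (J l ^ 2)⁻¹ := by
        gcongr
        · exact hf l
        · exact hg (k - l)

lemma cv_summable {A B : ℝ} {f g : K3 → ℂ} (hf : Dec 2 A f) (hg : Dec 0 B g) (k : K3) :
    Summable fun l => ‖f l * g (k - l)‖ := by
  refine Summable.of_nonneg_of_le (fun _ => norm_nonneg _) (fun l => ?_)
    (summable_J.mul_left (2 ^ 0 * A * B))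
  simpa using cv_term_le (p := 0) hf hg k l

lemma cv_dec {p : ℕ} {A B : ℝ} {f g : K3 → ℂ} (hf : Dec (p + 2) A f) (hg : Dec p B g) :
    Dec p (2 ^ p * A * B * SJ) (cv f g) := fun k => by
  have hJ := pow_pos (J_pos k) p
  have hs : Summable fun l => ‖f l * g (k - l)‖ :=
    cv_summable (hf.mono (by omega) le_rfl) (hg.mono (Nat.zero_le p) le_rfl) k
  calc ‖cv f g k‖ * J k ^ p ≤ (∑' l, ‖f l * g (k - l)‖) * J k ^ p := by
        gcongr
        exact norm_tsum_le_tsum_norm hs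
    _ = ∑' l, ‖f l * g (k - l)‖ * J k ^ p := by rw [tsum_mul_right]
    _ ≤ ∑' l, 2 ^ p * A * B * (J l ^ 2)⁻¹ :=
        (hs.mul_right _).tsum_le_tsum (fun l => cv_term_le hf hg k l) (summable_J.mul_left _)
    _ = _ := by rw [tsum_mul_left, SJ]

lemma cv_comm (f g : K3 → ℂ) (k : K3) : cv f g k = cv g f k := by
  unfold cv
  rw [← (Equiv.subLeft k).tsum_eq]
  refine tsum_congr fun l => ?_
  simp [mul_comm]

/-! ### Product estimates for finitely supported families -/

section finite
variable (Λ : Finset K3)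

lemma sum_shift_le {X : K3 → K3 → ℝ} (hX : ∀ l n, 0 ≤ X l n) :
    ∑ k ∈ Λ, ∑ l ∈ Λ, (if k - l ∈ Λ then X l (k - l) else 0) ≤ ∑ l ∈ Λ, ∑ n ∈ Λ, X l n := by
  rw [Finset.sum_comm]
  refine Finset.sum_le_sum fun l _ => ?_
  rw [← Finset.sum_filter]
  rw [← Finset.sum_image (f := fun n => X l n) (s := Λ.filter fun k => k - l ∈ Λ)
    (g := fun k => k - l) (by intro a _ b _ h; simpa using h)]
  refine Finset.sum_le_sum_of_subset_of_nonneg ?_ fun n _ _ => hX l n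
  intro n hn
  simp only [Finset.mem_image, Finset.mem_filter] at hn
  obtain ⟨k, hk, rfl⟩ := hn
  exact hk.2

lemma conv_weight (f g : K3 → ℂ) (hg : ∀ k ∉ Λ, g k = 0) (m : ℕ) (ω : K3 → K3 → ℝ)
    (hω : ∀ l ∈ Λ, ∀ n ∈ Λ, 0 < ω l n) (hω0 : ∀ l n, 0 ≤ ω l n) (C : ℝ)
    (hC : ∀ k, ∑ l ∈ Λ, (if k - l ∈ Λ then q k ^ m / ω l (k - l) else 0) ≤ C) :
    ∑ k ∈ Λ, q k ^ m * ‖∑ l ∈ Λ, f l * g (k - l)‖ ^ 2 ≤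
      C * ∑ l ∈ Λ, ∑ n ∈ Λ, ω l n * ‖f l‖ ^ 2 * ‖g n‖ ^ 2 := by
  have hX : ∀ l n, 0 ≤ ω l n * ‖f l‖ ^ 2 * ‖g n‖ ^ 2 := fun l n => by
    have := hω0 l n
    positivity
  have key : ∀ k ∈ Λ, q k ^ m * ‖∑ l ∈ Λ, f l * g (k - l)‖ ^ 2 ≤
      C * ∑ l ∈ Λ, (if k - l ∈ Λ then ω l (k - l) * ‖f l‖ ^ 2 * ‖g (k - l)‖ ^ 2 else 0) := by
    intro k _
    have hq := pow_nonneg (q_nonneg k) m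
    have h1 : ‖∑ l ∈ Λ, f l * g (k - l)‖ ≤ ∑ l ∈ Λ, ‖f l‖ * ‖g (k - l)‖ :=
      (norm_sum_le _ _).trans_eq (Finset.sum_congr rfl fun l _ => norm_mul _ _)
    have h2 : (∑ l ∈ Λ, √(q k ^ m) * (‖f l‖ * ‖g (k - l)‖)) ^ 2 ≤
        (∑ l ∈ Λ, (if k - l ∈ Λ then q k ^ m / ω l (k - l) else 0)) *
        ∑ l ∈ Λ, (if k - l ∈ Λ then ω l (k - l) * ‖f l‖ ^ 2 * ‖g (k - l)‖ ^ 2 else 0) := by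
      refine Finset.sum_sq_le_sum_mul_sum_of_sq_le_mul Λ (fun l hl => ?_) (fun l hl => ?_)
        (fun l hl => le_of_eq ?_)
      · split_ifs
        · exact div_nonneg hq (hω0 _ _)
        · exact le_rfl
      · split_ifs
        · exact hX _ _
        · exact le_rfl
      · split_ifs with h
        · have := (hω l hl _ h).ne'
          rw [mul_pow, Real.sq_sqrt hq]
          field_simp
        · simp [hg _ h]
    have h0 : 0 ≤ ∑ l ∈ Λ, (if k - l ∈ Λ then ω l (k - l) * ‖f l‖ ^ 2 * ‖g (k - l)‖ ^ 2 else 0) :=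
      Finset.sum_nonneg fun l _ => by
        split_ifs
        · exact hX _ _
        · exact le_rfl
    calc q k ^ m * ‖∑ l ∈ Λ, f l * g (k - l)‖ ^ 2
        ≤ q k ^ m * (∑ l ∈ Λ, ‖f l‖ * ‖g (k - l)‖) ^ 2 := by gcongr
      _ = (∑ l ∈ Λ, √(q k ^ m) * (‖f l‖ * ‖g (k - l)‖)) ^ 2 := by
          rw [← Finset.mul_sum, mul_pow, Real.sq_sqrt hq]
      _ ≤ _ := h2.trans (mul_le_mul_of_nonneg_right (hC k) h0)
  by_cases hC0 : Λ.Nonempty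
  · obtain ⟨k0, hk0⟩ := hC0
    have hCn : 0 ≤ C := le_trans (Finset.sum_nonneg fun l hl => by
      split_ifs with h
      · exact div_nonneg (pow_nonneg (q_nonneg _) _) (hω0 _ _)
      · exact le_rfl) (hC k0)
    refine (Finset.sum_le_sum key).trans ?_
    rw [← Finset.mul_sum]
    exact mul_le_mul_of_nonneg_left
      (sum_shift_le Λ (X := fun l n => ω l n * ‖f l‖ ^ 2 * ‖g n‖ ^ 2) hX) hCn
  · rw [Finset.not_nonempty_iff_eq_empty] at hC0
    simp [hC0]

lemma inv_q_sq_le {k : K3} (hk : k ≠ 0) : (q k ^ 2)⁻¹ ≤ 4 * (J k ^ 2)⁻¹ := by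
  have h1 := one_le_q hk
  have h2 := J_le_two_q hk
  have h3 := J_pos k
  rw [← div_eq_mul_inv, le_div_iff₀ (by positivity), inv_mul_le_iff₀ (by positivity)]
  nlinarith

lemma sum_inv_q (h0 : (0 : K3) ∉ Λ) : ∑ l ∈ Λ, (q l ^ 2)⁻¹ ≤ 4 * SJ := by
  calc ∑ l ∈ Λ, (q l ^ 2)⁻¹ ≤ ∑ l ∈ Λ, 4 * (J l ^ 2)⁻¹ :=
        Finset.sum_le_sum fun l hl => inv_q_sq_le fun h => h0 (h ▸ hl)
    _ = 4 * ∑ l ∈ Λ, (J l ^ 2)⁻¹ := by rw [Finset.mul_sum]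
    _ ≤ 4 * SJ := by
        gcongr
        exact summable_J.sum_le_tsum _ fun k _ => by have := J_pos k; positivity

lemma sum_inv_q_shift (h0 : (0 : K3) ∉ Λ) (k : K3) :
    ∑ l ∈ Λ, (if k - l ∈ Λ then (q (k - l) ^ 2)⁻¹ else 0) ≤ 4 * SJ := by
  refine le_trans ?_ (sum_inv_q Λ h0)
  rw [← Finset.sum_filter, ← Finset.sum_image (f := fun n => (q n ^ 2)⁻¹)
    (s := Λ.filter fun l => k - l ∈ Λ) (g := fun l => k - l)
    (by intro a _ b _ h; simpa using h)]
  refine Finset.sum_le_sum_of_subset_of_nonneg ?_ fun n _ _ => by positivity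
  intro n hn
  simp only [Finset.mem_image, Finset.mem_filter] at hn
  obtain ⟨l, hl, rfl⟩ := hn
  exact hl.2

/-- Homogeneous Sobolev energy of a scalar family over a finite set of modes. -/
def SE (m : ℕ) (f : K3 → ℂ) : ℝ := ∑ k ∈ Λ, q k ^ m * ‖f k‖ ^ 2

lemma SE_nonneg (m : ℕ) (f : K3 → ℂ) : 0 ≤ SE Λ m f :=
  Finset.sum_nonneg fun k _ => mul_nonneg (pow_nonneg (q_nonneg k) m) (sq_nonneg _)

lemma sum_weight_le (h0 : (0 : K3) ∉ Λ) (m : ℕ) (ω : K3 → K3 → ℝ)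
    (hω : ∀ l ∈ Λ, ∀ n ∈ Λ, (q l ^ m + q n ^ m) / ω l n ≤ (q l ^ 2)⁻¹ + (q n ^ 2)⁻¹)
    (hω0 : ∀ l n, 0 ≤ ω l n) (k : K3) :
    ∑ l ∈ Λ, (if k - l ∈ Λ then q k ^ m / ω l (k - l) else 0) ≤ 4 ^ m * (8 * SJ) := by
  have : ∀ l ∈ Λ, (if k - l ∈ Λ then q k ^ m / ω l (k - l) else 0) ≤
      4 ^ m * ((q l ^ 2)⁻¹ + if k - l ∈ Λ then (q (k - l) ^ 2)⁻¹ else 0) := by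
    intro l hl
    split_ifs with h
    · have h1 := q_pow_add_le m l (k - l)
      rw [add_sub_cancel] at h1
      calc q k ^ m / ω l (k - l) ≤ 4 ^ m * (q l ^ m + q (k - l) ^ m) / ω l (k - l) :=
            div_le_div_of_nonneg_right h1 (hω0 _ _)
        _ = 4 ^ m * ((q l ^ m + q (k - l) ^ m) / ω l (k - l)) := by ring
        _ ≤ _ := by
            gcongr
            exact hω l hl _ h
    · positivity
  refine (Finset.sum_le_sum this).trans ?_
  rw [← Finset.mul_sum, Finset.sum_add_distrib]
  gcongr
  linarith [sum_inv_q Λ h0, sum_inv_q_shift Λ h0 k]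

lemma conv_low (h0 : (0 : K3) ∉ Λ) (f g : K3 → ℂ) (hg : ∀ k ∉ Λ, g k = 0) (m : ℕ) :
    SE Λ m (fun k => ∑ l ∈ Λ, f l * g (k - l)) ≤
      4 ^ m * (8 * SJ) * (SE Λ (m + 1) f * SE Λ 1 g + SE Λ 1 f * SE Λ (m + 1) g) := by
  have hpos : ∀ l ∈ Λ, 0 < q l := fun l hl =>
    lt_of_lt_of_le one_pos (one_le_q fun h => h0 (h ▸ hl))
  set ω : K3 → K3 → ℝ := fun l n => q l ^ (m + 1) * q n ^ 1 + q l ^ 1 * q n ^ (m + 1) with hωdef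
  have hω0 : ∀ l n, 0 ≤ ω l n := fun l n => by
    have := q_nonneg l
    have := q_nonneg n
    positivity
  have := conv_weight Λ f g hg m ω
    (fun l hl n hn => by
      have := hpos l hl
      have := hpos n hn
      positivity) hω0 _ (sum_weight_le Λ h0 m ω (fun l hl n hn => ?_) hω0)
  · refine this.trans (le_of_eq ?_)
    congr 1
    simp only [SE, Finset.sum_mul_sum, ← Finset.sum_add_distrib]
    refine Finset.sum_congr rfl fun l _ => Finset.sum_congr rfl fun n _ => ?_
    simp only [hωdef]
    ring
  · have h1 := hpos l hl
    have h2 := hpos n hn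
    have : (q l ^ m + q n ^ m) / ω l n = (q l)⁻¹ * (q n)⁻¹ := by
      simp only [hωdef]
      have : 0 < q l ^ m + q n ^ m := by positivity
      rw [show q l ^ (m + 1) * q n ^ 1 + q l ^ 1 * q n ^ (m + 1) =
        (q l ^ m + q n ^ m) * (q l * q n) by ring]
      field_simp
    rw [this, ← inv_pow, ← inv_pow]
    nlinarith [sq_nonneg ((q l)⁻¹ - (q n)⁻¹), sq_nonneg ((q l)⁻¹ + (q n)⁻¹)]

lemma conv_high (h0 : (0 : K3) ∉ Λ) (f g : K3 → ℂ) (hg : ∀ k ∉ Λ, g k = 0) (m : ℕ) :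
    SE Λ m (fun k => ∑ l ∈ Λ, f l * g (k - l)) ≤
      4 ^ m * (8 * SJ) * (SE Λ m f * SE Λ 2 g + SE Λ 2 f * SE Λ m g) := by
  have hpos : ∀ l ∈ Λ, 0 < q l := fun l hl =>
    lt_of_lt_of_le one_pos (one_le_q fun h => h0 (h ▸ hl))
  set ω : K3 → K3 → ℝ := fun l n => q l ^ m * q n ^ 2 + q l ^ 2 * q n ^ m with hωdef
  have hω0 : ∀ l n, 0 ≤ ω l n := fun l n => by
    have := q_nonneg l
    have := q_nonneg n
    positivity
  have := conv_weight Λ f g hg m ω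
    (fun l hl n hn => by
      have := hpos l hl
      have := hpos n hn
      positivity) hω0 _ (sum_weight_le Λ h0 m ω (fun l hl n hn => ?_) hω0)
  · refine this.trans (le_of_eq ?_)
    congr 1
    simp only [SE, Finset.sum_mul_sum, ← Finset.sum_add_distrib]
    refine Finset.sum_congr rfl fun l _ => Finset.sum_congr rfl fun n _ => ?_
    simp only [hωdef]
    ring
  · have h1 := hpos l hl
    have h2 := hpos n hn
    have hw : 0 < ω l n := by
      simp only [hωdef]
      positivity
    rw [div_le_iff₀ hw]
    simp only [hωdef]
    have : ((q l ^ 2)⁻¹ + (q n ^ 2)⁻¹) * (q l ^ m * q n ^ 2 + q l ^ 2 * q n ^ m) =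
      (q l ^ m + q n ^ m) + ((q l ^ 2)⁻¹ * (q l ^ m * q n ^ 2) +
        (q n ^ 2)⁻¹ * (q l ^ 2 * q n ^ m)) := by
      field_simp
      ring
    rw [this]
    have : 0 ≤ (q l ^ 2)⁻¹ * (q l ^ m * q n ^ 2) + (q n ^ 2)⁻¹ * (q l ^ 2 * q n ^ m) := by
      positivity
    linarith

end finite

/-! ### Fourier analysis on the torus -/

/-- The phase `k · x` as a real-linear map into `ℂ`, times the imaginary unit. -/
def phase (k : K3) : E3 →L[ℝ] ℂ :=
  ∑ j, (ContinuousLinearMap.proj (R := ℝ) (φ := fun _ : Fin 3 => ℝ) j).smulRight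
    (Complex.I * (k j : ℂ))

/-- The character `exp (i k · x)`. -/
def ee (k : K3) (x : E3) : ℂ := Complex.exp (phase k x)

lemma phase_apply (k : K3) (x : E3) : phase k x = Complex.I * ((∑ j, (k j : ℝ) * x j : ℝ) : ℂ) := by
  simp only [phase, _root_.sum_apply, ContinuousLinearMap.smulRight_apply,
    ContinuousLinearMap.proj_apply, Complex.real_smul]
  push_cast
  rw [Finset.mul_sum]
  exact Finset.sum_congr rfl fun j _ => by ring

lemma phase_single (k : K3) (j : Fin 3) : phase k (Pi.single j 1) = Complex.I * (k j : ℂ) := by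
  rw [phase_apply]
  congr 1
  rw [Finset.sum_eq_single j]
  · simp
  · intro b _ hb
    simp [hb]
  · simp

lemma norm_ee (k : K3) (x : E3) : ‖ee k x‖ = 1 := by
  rw [ee, phase_apply, mul_comm, Complex.norm_exp_ofReal_mul_I]

lemma ee_zero (x : E3) : ee 0 x = 1 := by simp [ee, phase_apply]

lemma ee_add (k l : K3) (x : E3) : ee (k + l) x = ee k x * ee l x := by
  rw [ee, ee, ee, ← Complex.exp_add]
  congr 1
  simp only [phase_apply, ← mul_add, ← Complex.ofReal_add, ← Finset.sum_add_distrib]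
  congr 2
  exact Finset.sum_congr rfl fun j _ => by push_cast [Pi.add_apply]; ring

lemma ee_neg (k : K3) (x : E3) : ee (-k) x = (starRingEnd ℂ) (ee k x) := by
  rw [ee, ee, ← Complex.exp_conj]
  congr 1
  simp [phase_apply]

lemma contDiff_ee (k : K3) {n : WithTop ℕ∞} : ContDiff ℝ n (ee k) :=
  ((phase k).contDiff).cexp

lemma continuous_ee (k : K3) : Continuous (ee k) := (contDiff_ee k (n := 0)).continuous

lemma hasFDerivAt_ee (k : K3) (x : E3) : HasFDerivAt (ee k) (ee k x • phase k) x :=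
  ((phase k).hasFDerivAt).cexp

lemma ee_periodic (k : K3) : SpacePeriodic (ee k) := fun x j => by
  rw [ee, map_add, Complex.exp_add, map_smul, phase_single]
  have : (2 * π) • (Complex.I * (k j : ℂ)) = (k j : ℂ) * (2 * π * Complex.I) := by
    rw [Complex.real_smul]
    push_cast
    ring
  rw [this, Complex.exp_int_mul_two_pi_mul_I, mul_one, ee]

lemma ee_two_pi (k : K3) (y : E3) :
    ee k ((2 * π) • y) = UnitAddTorus.mFourier k (fun i => (y i : UnitAddCircle)) := by
  simp only [UnitAddTorus.mFourier, ContinuousMap.coe_mk, fourier_coe_apply]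
  rw [← Complex.exp_sum, ee, phase_apply]
  congr 1
  push_cast
  rw [Finset.mul_sum]
  refine Finset.sum_congr rfl fun j _ => ?_
  simp
  ring

/-- The normalising factor of the mean over the torus. -/
def cT : ℝ := ((2 * π) ^ 3)⁻¹

lemma cT_pos : 0 < cT := by
  have := Real.pi_pos
  unfold cT
  positivity

lemma isCompact_T3 : IsCompact T3 := isCompact_Icc

lemma integrableOn_T3 {E : Type*} [NormedAddCommGroup E] {F : E3 → E} (hF : Continuous F) :
    IntegrableOn F T3 := hF.continuousOn.integrableOn_compact isCompact_T3

lemma volume_T3 : (volume.restrict T3).real univ = (2 * π) ^ 3 := by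
  have := Real.pi_pos
  rw [measureReal_restrict_apply_univ, T3, measureReal_def, Real.volume_Icc_pi]
  simp [Finset.prod_const, ENNReal.toReal_ofReal, this.le]

lemma exists_torus_lift {E : Type*} [TopologicalSpace E] {F : E3 → E} (hF : Continuous F)
    (hp : SpacePeriodic F) : ∃ G : C(UnitAddTorus (Fin 3), E),
      ∀ y : E3, G (fun i => (y i : UnitAddCircle)) = F ((2 * π) • y) := by
  have hquot : IsOpenQuotientMap (fun y : E3 => (fun i => (y i : UnitAddCircle))) :=
    IsOpenQuotientMap.piMap (f := fun _ : Fin 3 => ((↑) : ℝ → UnitAddCircle))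
      fun _ => QuotientAddGroup.isOpenQuotientMap_mk
  have hstep : ∀ (n : ℤ) (j : Fin 3) (x : E3),
      F (x + (n : ℝ) • ((2 * π) • (Pi.single j 1 : E3))) = F x := by
    intro n j
    induction n using Int.induction_on with
    | zero => simp
    | succ n ih =>
      intro x
      have := hp (x + ((n : ℤ) : ℝ) • ((2 * π) • (Pi.single j 1 : E3))) j
      rw [ih] at this
      rw [← this]
      congr 1
      push_cast
      rw [add_smul, one_smul, add_assoc]
    | pred n ih =>
      intro x
      have := hp (x + ((-(n : ℤ) - 1 : ℤ) : ℝ) • ((2 * π) • (Pi.single j 1 : E3))) j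
      rw [← this, ← ih x]
      congr 1
      push_cast
      rw [sub_smul, one_smul]
      abel
  have hall : ∀ (n : K3) (y : E3), F ((2 * π) • (y + fun i => (n i : ℝ))) = F ((2 * π) • y) := by
    intro n y
    have : (2 * π) • (y + fun i => (n i : ℝ)) = (2 * π) • y +
        ((n 0 : ℝ) • ((2 * π) • (Pi.single 0 1 : E3))) + ((n 1 : ℝ) • ((2 * π) • (Pi.single 1 1 : E3)))
        + ((n 2 : ℝ) • ((2 * π) • (Pi.single 2 1 : E3))) := by
      ext i
      fin_cases i <;> simp [mul_add, mul_comm]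
    rw [this, hstep, hstep, hstep]
  have hfib : ∀ a b : E3, (fun i => (a i : UnitAddCircle)) = (fun i => (b i : UnitAddCircle)) →
      F ((2 * π) • a) = F ((2 * π) • b) := by
    intro a b hab
    have : ∀ i, ∃ n : ℤ, a i = b i + n := fun i => by
      have h : ((a i - b i : ℝ) : UnitAddCircle) = 0 := by
        rw [AddCircle.coe_sub, sub_eq_zero]
        exact congrFun hab i
      obtain ⟨n, hn⟩ := (AddCircle.coe_eq_zero_iff 1).1 h
      refine ⟨n, ?_⟩
      rw [zsmul_one] at hn
      linarith
    choose n hn using this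
    rw [← hall n b]
    congr 2
    ext i
    exact hn i
  let c : C(E3, UnitAddTorus (Fin 3)) := ⟨fun y i => (y i : UnitAddCircle), hquot.continuous⟩
  have hc : Topology.IsQuotientMap c := hquot.isQuotientMap
  refine ⟨hc.lift ⟨fun y => F ((2 * π) • y), by fun_prop⟩ hfib, fun y => ?_⟩
  exact DFunLike.congr_fun (hc.lift_comp ⟨fun y => F ((2 * π) • y), by fun_prop⟩ hfib) y

section torus

attribute [local instance] instMeasureSpaceUnitAddCircle

lemma isProbabilityMeasure_circle : IsProbabilityMeasure (volume : Measure UnitAddCircle) :=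
  inferInstanceAs (IsProbabilityMeasure AddCircle.haarAddCircle)

lemma integral_torus {E : Type*} [NormedAddCommGroup E] [NormedSpace ℝ E]
    {G : UnitAddTorus (Fin 3) → E} {F : E3 → E}
    (h : ∀ y : E3, G (fun i => (y i : UnitAddCircle)) = F ((2 * π) • y)) :
    ∫ z, G z = cT • ∫ x in T3, F x := by
  have hpi := Real.pi_pos
  rw [UnitAddTorus.integral_preimage G 0]
  simp only [h]
  have hset : {x : E3 | ∀ i, x i ∈ Ioc ((0 : E3) i) ((0 : E3) i + 1)}
      = Set.pi univ fun i : Fin 3 => Ioc ((0 : E3) i) ((1 : E3) i) := by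
    ext x
    simp
  rw [hset, volume_pi, setIntegral_congr_set Measure.univ_pi_Ioc_ae_eq_Icc, ← volume_pi,
    Measure.setIntegral_comp_smul_of_pos volume F _ (by positivity : (0 : ℝ) < 2 * π)]
  open scoped Pointwise in
  have : (2 * π) • Icc (0 : E3) 1 = T3 := by
    ext x
    rw [Set.mem_smul_set_iff_inv_smul_mem₀ (by positivity), T3]
    simp only [mem_Icc, Pi.le_def, Pi.zero_apply, Pi.one_apply, Pi.smul_apply, smul_eq_mul]
    refine and_congr (forall_congr' fun i => ?_) (forall_congr' fun i => ?_)
    · rw [mul_nonneg_iff_of_pos_left (by positivity)]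
    · rw [inv_mul_le_iff₀ (by positivity), mul_one]
  rw [this, cT]
  simp

/-- Fourier coefficients of a function on the torus. -/
def FC (F : E3 → ℂ) (k : K3) : ℂ := cT * ∫ x in T3, ee (-k) x * F x

lemma mFourierCoeff_eq_FC {G : UnitAddTorus (Fin 3) → ℂ} {F : E3 → ℂ}
    (h : ∀ y : E3, G (fun i => (y i : UnitAddCircle)) = F ((2 * π) • y)) (k : K3) :
    UnitAddTorus.mFourierCoeff G k = FC F k := by
  rw [UnitAddTorus.mFourierCoeff, integral_torus (F := fun x => ee (-k) x * F x), FC,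
    Complex.real_smul]
  intro y
  rw [h, ee_two_pi, smul_eq_mul]

lemma hasSum_sq_FC {F : E3 → ℂ} (hF : Continuous F) (hp : SpacePeriodic F) :
    HasSum (fun k => ‖FC F k‖ ^ 2) (cT * ∫ x in T3, ‖F x‖ ^ 2) := by
  have := isProbabilityMeasure_circle
  obtain ⟨G, hG⟩ := exists_torus_lift hF hp
  have h := UnitAddTorus.hasSum_sq_mFourierCoeff (G.toLp 2 volume ℂ)
  simp only [UnitAddTorus.mFourierCoeff_toLp, mFourierCoeff_eq_FC hG] at h
  have h2 : ∫ t, ‖(G.toLp 2 volume ℂ) t‖ ^ 2 = ∫ t, ‖G t‖ ^ 2 :=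
    integral_congr_ae ((G.coeFn_toAEEqFun volume).fun_comp fun z => ‖z‖ ^ 2)
  rw [h2, integral_torus (F := fun x => ‖F x‖ ^ 2) fun y => by rw [hG]] at h
  exact h

lemma hasSum_FC {F : E3 → ℂ} (hF : Continuous F) (hp : SpacePeriodic F)
    (hs : Summable fun k => ‖FC F k‖) (x : E3) : HasSum (fun k => FC F k * ee k x) (F x) := by
  have hpi := Real.pi_pos
  obtain ⟨G, hG⟩ := exists_torus_lift hF hp
  have h := UnitAddTorus.hasSum_mFourier_series_apply_of_summable (f := G)
    (by simpa only [funext (mFourierCoeff_eq_FC hG)] using hs.of_norm)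
    (fun i => (((2 * π)⁻¹ • x) i : UnitAddCircle))
  simp only [mFourierCoeff_eq_FC hG, ← ee_two_pi, hG, smul_smul, smul_eq_mul] at h
  rwa [mul_inv_cancel₀ (by positivity), one_smul] at h

end torus

lemma integral_T3_eq_zero {F : E3 → ℂ} (hF : ContDiff ℝ 1 F) (hp : SpacePeriodic F) (j : Fin 3) :
    ∫ x in T3, fderiv ℝ F x (Pi.single j 1) = 0 := by
  have hpi := Real.pi_pos
  have h := integral_divergence_of_hasFDerivAt_off_countable' (E := ℂ) (n := 2)
    (0 : E3) (fun _ => 2 * π) (fun _ => by positivity)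
    (fun i x => if i = j then F x else 0) (fun i x => if i = j then fderiv ℝ F x else 0) ∅
    countable_empty ?_ ?_ ?_
  · have h2 : ∀ x : E3, ∑ i, (if i = j then fderiv ℝ F x else 0) (Pi.single i 1)
        = fderiv ℝ F x (Pi.single j 1) := fun x => by
      rw [Finset.sum_eq_single j] <;> simp +contextual
    simp only [h2] at h
    rw [T3, h]
    refine Finset.sum_eq_zero fun i _ => ?_
    by_cases hij : i = j
    · subst hij
      rw [sub_eq_zero]
      refine integral_congr_ae (Filter.Eventually.of_forall fun x => ?_)
      simp only [if_true]
      rw [← hp (Fin.insertNth i ((0 : E3) i) x) i]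
      congr 1
      ext l
      refine Fin.succAboveCases i ?_ (fun l => ?_) l <;> simp
    · simp [hij]
  · intro i
    by_cases hij : i = j
    · simpa [hij] using hF.continuous.continuousOn
    · simpa [hij] using continuousOn_const
  · intro x _ i
    by_cases hij : i = j
    · simpa [hij] using (hF.differentiable one_ne_zero x).hasFDerivAt
    · simpa [hij] using hasFDerivAt_const _ _
  · refine integrableOn_T3 ?_
    refine continuous_finsetSum _ fun i _ => ?_
    by_cases hij : i = j
    · simpa [hij] using (hF.continuous_fderiv one_ne_zero).clm_apply continuous_const
    · simpa [hij] using continuous_const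

lemma FC_deriv {F : E3 → ℂ} (hF : ContDiff ℝ 1 F) (hp : SpacePeriodic F) (j : Fin 3) (k : K3) :
    FC (fun x => fderiv ℝ F x (Pi.single j 1)) k = Complex.I * k j * FC F k := by
  have h := integral_T3_eq_zero (F := fun x => ee (-k) x * F x) ((contDiff_ee _).mul hF)
    (fun x j => by simp only [ee_periodic (-k) x j, hp x j]) j
  have h2 : ∀ x, fderiv ℝ (fun x => ee (-k) x * F x) x (Pi.single j 1) =
      ee (-k) x * fderiv ℝ F x (Pi.single j 1) - Complex.I * k j * (ee (-k) x * F x) := by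
    intro x
    have := (hasFDerivAt_ee (-k) x).mul (hF.differentiable one_ne_zero x).hasFDerivAt
    rw [show (fun x => ee (-k) x * F x) = ee (-k) * F from rfl, HasFDerivAt.fderiv this]
    simp only [_root_.add_apply, _root_.smul_apply, phase_single,
      smul_eq_mul, Pi.neg_apply, Int.cast_neg]
    ring
  simp only [h2] at h
  have hc1 : Continuous fun x => ee (-k) x * fderiv ℝ F x (Pi.single j 1) :=
    (continuous_ee _).mul ((hF.continuous_fderiv one_ne_zero).clm_apply continuous_const)
  have hc2 : Continuous fun x => Complex.I * k j * (ee (-k) x * F x) :=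
    continuous_const.mul ((continuous_ee _).mul hF.continuous)
  rw [integral_sub (integrableOn_T3 hc1) (integrableOn_T3 hc2), integral_const_mul,
    sub_eq_zero] at h
  rw [FC, h, FC]
  ring

lemma FC_norm_le {F : E3 → ℂ} {M : ℝ} (h : ∀ x ∈ T3, ‖F x‖ ≤ M) (k : K3) : ‖FC F k‖ ≤ M := by
  have hpi := Real.pi_pos
  have h1 : ‖∫ x in T3, ee (-k) x * F x‖ ≤ M * volume.real T3 := by
    refine norm_setIntegral_le_of_norm_le_const isCompact_T3.measure_lt_top fun x hx => ?_
    rw [norm_mul, norm_ee, one_mul]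
    exact h x hx
  have h2 : volume.real T3 = (2 * π) ^ 3 := by
    rw [← volume_T3, measureReal_restrict_apply_univ]
  rw [FC, norm_mul, Complex.norm_real, Real.norm_of_nonneg cT_pos.le]
  calc cT * _ ≤ cT * (M * (2 * π) ^ 3) := by
        rw [← h2]; exact mul_le_mul_of_nonneg_left h1 cT_pos.le
    _ = M := by rw [cT]; field_simp

lemma FC_one (k : K3) : FC (fun _ => 1) k = if k = 0 then 1 else 0 := by
  have hpi := Real.pi_pos
  split_ifs with hk
  · subst hk
    have := volume_T3
    rw [measureReal_restrict_apply_univ] at this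
    simp only [FC, neg_zero, ee_zero, mul_one, setIntegral_const, this, cT]
    rw [Complex.real_smul, mul_one, ← Complex.ofReal_mul, inv_mul_cancel₀ (by positivity),
      Complex.ofReal_one]
  · obtain ⟨j, hj⟩ := Function.ne_iff.1 hk
    have h := FC_deriv (F := fun _ => 1) contDiff_const (fun _ _ => rfl) j k
    have h0 : FC (fun x => fderiv ℝ (fun _ : E3 => (1 : ℂ)) x (Pi.single j 1)) k = 0 := by
      simp [FC]
    rw [h0] at h
    have : Complex.I * (k j : ℂ) ≠ 0 :=
      mul_ne_zero Complex.I_ne_zero (by exact_mod_cast hj)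
    exact (mul_eq_zero.1 h.symm).resolve_left this

lemma FC_shift (l k : K3) (G : E3 → ℂ) : FC (fun x => ee l x * G x) k = FC G (k - l) := by
  simp only [FC, ← mul_assoc, ← ee_add]
  rw [show -k + l = -(k - l) by abel]

lemma FC_tsum_mul {c : K3 → ℂ} (hc : Summable fun k => ‖c k‖) {G : E3 → ℂ} (hG : Continuous G)
    (k : K3) : FC (fun x => (∑' l, c l * ee l x) * G x) k = ∑' l, c l * FC G (k - l) := by
  obtain ⟨M, hM⟩ := isCompact_T3.exists_bound_of_continuousOn hG.continuousOn
  have h := hasSum_integral_of_summable_integral_norm (μ := volume.restrict T3)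
    (F := fun l x => ee (-k) x * (c l * ee l x * G x))
    (fun l => integrableOn_T3 (by have := continuous_ee; fun_prop)) ?_
  · rw [FC]
    have h2 : ∀ x, ee (-k) x * ((∑' l, c l * ee l x) * G x)
        = ∑' l, ee (-k) x * (c l * ee l x * G x) := fun x => by
      rw [tsum_mul_left, tsum_mul_right]
    simp only [h2]
    rw [← h.tsum_eq, ← tsum_mul_left]
    refine tsum_congr fun l => ?_
    rw [← FC_shift, FC, mul_left_comm, ← integral_const_mul (c l)]
    congr 2
    funext x
    ring
  · refine Summable.of_nonneg_of_le (fun l => integral_nonneg fun _ => norm_nonneg _) (fun l => ?_)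
      (hc.mul_right (M * volume.real T3))
    have : ∀ x ∈ T3, ‖ee (-k) x * (c l * ee l x * G x)‖ ≤ ‖c l‖ * M := fun x hx => by
      rw [norm_mul, norm_mul, norm_mul, norm_ee, norm_ee, one_mul, mul_one]
      exact mul_le_mul_of_nonneg_left (hM x hx) (norm_nonneg _)
    calc _ ≤ ∫ x in T3, ‖c l‖ * M := by
          refine setIntegral_mono_on (integrableOn_T3 (by have := continuous_ee; fun_prop))
            (integrableOn_T3 continuous_const) isCompact_T3.measurableSet this
      _ = _ := by
          rw [setIntegral_const, smul_eq_mul]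
          ring

lemma FC_tsum {c : K3 → ℂ} (hc : Summable fun k => ‖c k‖) (k : K3) :
    FC (fun x => ∑' l, c l * ee l x) k = c k := by
  have h := FC_tsum_mul hc (G := fun _ => 1) continuous_const k
  simp only [mul_one] at h
  rw [h, tsum_eq_single k]
  · simp [FC_one]
  · intro l hl
    rw [FC_one, if_neg (sub_ne_zero.2 hl.symm), mul_zero]

lemma FC_mul {F G : E3 → ℂ} (hF : Continuous F) (hp : SpacePeriodic F)
    (hs : Summable fun k => ‖FC F k‖) (hG : Continuous G) (k : K3) :
    FC (fun x => F x * G x) k = cv (FC F) (FC G) k := by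
  rw [cv, ← FC_tsum_mul hs hG]
  congr 1
  funext x
  rw [(hasSum_FC hF hp hs x).tsum_eq]

lemma FC_add {F G : E3 → ℂ} (hF : Continuous F) (hG : Continuous G) (k : K3) :
    FC (fun x => F x + G x) k = FC F k + FC G k := by
  have h := integral_add (integrableOn_T3 ((continuous_ee (-k)).mul hF))
    (integrableOn_T3 ((continuous_ee (-k)).mul hG))
  simp only [Pi.mul_apply] at h
  simp only [FC, mul_add]
  rw [h, mul_add]

lemma FC_const_mul (c : ℂ) (F : E3 → ℂ) (k : K3) : FC (fun x => c * F x) k = c * FC F k := by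
  simp only [FC, mul_left_comm _ c]
  rw [integral_const_mul]
  ring

/-! ### Spatial derivatives of smooth periodic functions -/

/-- Fourier coefficients of a real function. -/
def fc (f : E3 → ℝ) (k : K3) : ℂ := FC (fun x => (f x : ℂ)) k

lemma contDiff_pd {f : E3 → ℝ} (hf : ContDiff ℝ (⊤ : ℕ∞) f) (j : Fin 3) :
    ContDiff ℝ (⊤ : ℕ∞) (pd j f) := by
  have : ContDiff ℝ (⊤ : ℕ∞) (fderiv ℝ f) := hf.fderiv_right le_rfl
  exact this.clm_apply contDiff_const

lemma periodic_pd {f : E3 → ℝ} (hp : SpacePeriodic f) (j : Fin 3) : SpacePeriodic (pd j f) := by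
  intro x i
  have : f = fun y => f (y + (2 * π) • (Pi.single i 1 : E3)) := by
    funext y
    rw [hp y i]
  rw [pd, pd]
  conv_rhs => rw [this, fderiv_comp_add_right]

lemma iterate_pd {f : E3 → ℝ} (hf : ContDiff ℝ (⊤ : ℕ∞) f) (hp : SpacePeriodic f) (j : Fin 3)
    (n : ℕ) : ContDiff ℝ (⊤ : ℕ∞) ((pd j)^[n] f) ∧ SpacePeriodic ((pd j)^[n] f) := by
  induction n with
  | zero => exact ⟨hf, hp⟩
  | succ n ih =>
    rw [Function.iterate_succ_apply']
    exact ⟨contDiff_pd ih.1 j, periodic_pd ih.2 j⟩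

lemma pdM_smooth {f : E3 → ℝ} (hf : ContDiff ℝ (⊤ : ℕ∞) f) (hp : SpacePeriodic f)
    (β : Fin 3 → ℕ) : ContDiff ℝ (⊤ : ℕ∞) (pdM β f) ∧ SpacePeriodic (pdM β f) := by
  have h2 := iterate_pd hf hp 2 (β 2)
  have h1 := iterate_pd h2.1 h2.2 1 (β 1)
  exact iterate_pd h1.1 h1.2 0 (β 0)

lemma fc_pd {f : E3 → ℝ} (hf : ContDiff ℝ (⊤ : ℕ∞) f) (hp : SpacePeriodic f) (j : Fin 3)
    (k : K3) : fc (pd j f) k = Complex.I * k j * fc f k := by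
  have hc : ContDiff ℝ 1 fun x => (f x : ℂ) :=
    Complex.ofRealCLM.contDiff.comp (hf.of_le (by exact_mod_cast le_top))
  rw [fc, fc, ← FC_deriv hc (fun x j => by simp only [hp x j]) j]
  congr 1
  funext x
  have hd : DifferentiableAt ℝ f x := hf.differentiable (by simp) x
  have := (Complex.ofRealCLM.hasFDerivAt (x := f x)).comp x hd.hasFDerivAt
  have h2 : fderiv ℝ (fun x => (f x : ℂ)) x = Complex.ofRealCLM.comp (fderiv ℝ f x) := this.fderiv
  rw [h2]
  rfl

lemma fc_iterate_pd {f : E3 → ℝ} (hf : ContDiff ℝ (⊤ : ℕ∞) f) (hp : SpacePeriodic f) (j : Fin 3)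
    (n : ℕ) (k : K3) : fc ((pd j)^[n] f) k = (Complex.I * k j) ^ n * fc f k := by
  induction n with
  | zero => simp
  | succ n ih =>
    have h := iterate_pd hf hp j n
    rw [Function.iterate_succ_apply', fc_pd h.1 h.2, ih]
    ring

lemma fc_pdM {f : E3 → ℝ} (hf : ContDiff ℝ (⊤ : ℕ∞) f) (hp : SpacePeriodic f) (β : Fin 3 → ℕ)
    (k : K3) : fc (pdM β f) k = (∏ j, (Complex.I * k j) ^ β j) * fc f k := by
  have h2 := iterate_pd hf hp 2 (β 2)
  have h1 := iterate_pd h2.1 h2.2 1 (β 1)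
  rw [pdM, fc_iterate_pd h1.1 h1.2, fc_iterate_pd h2.1 h2.2, fc_iterate_pd hf hp,
    Fin.prod_univ_three]
  ring

lemma fc_neg (f : E3 → ℝ) (k : K3) : fc f (-k) = (starRingEnd ℂ) (fc f k) := by
  simp only [fc, FC]
  rw [map_mul, Complex.conj_ofReal, ← integral_conj]
  congr 2
  funext x
  rw [map_mul, Complex.conj_ofReal, ← ee_neg]

lemma hasSum_sq_fc {f : E3 → ℝ} (hf : Continuous f) (hp : SpacePeriodic f) :
    HasSum (fun k => ‖fc f k‖ ^ 2) (cT * ∫ x in T3, f x ^ 2) := by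
  have h := hasSum_sq_FC (F := fun x => (f x : ℂ)) (by fun_prop) (fun x j => by simp only [hp x j])
  simp only [Complex.norm_real, norm_eq_abs, sq_abs] at h
  exact h

lemma fc_norm_le {f : E3 → ℝ} {M : ℝ} (h : ∀ x ∈ T3, |f x| ≤ M) (k : K3) : ‖fc f k‖ ≤ M :=
  FC_norm_le (fun x hx => by simpa using h x hx) k

lemma fc_add {f g : E3 → ℝ} (hf : Continuous f) (hg : Continuous g) (k : K3) :
    fc (fun x => f x + g x) k = fc f k + fc g k := by
  rw [fc, fc, fc, ← FC_add (by fun_prop) (by fun_prop)]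
  simp

lemma fc_const_mul (c : ℝ) (f : E3 → ℝ) (k : K3) : fc (fun x => c * f x) k = c * fc f k := by
  rw [fc, fc, ← FC_const_mul]
  simp

lemma fc_sub {f g : E3 → ℝ} (hf : Continuous f) (hg : Continuous g) (k : K3) :
    fc (fun x => f x - g x) k = fc f k - fc g k := by
  have h := fc_add hf (g := fun x => (-1) * g x) (by fun_prop) k
  rw [fc_const_mul] at h
  simp only [neg_mul, one_mul, ← sub_eq_add_neg] at h
  rw [h]
  push_cast
  ring

lemma fc_sum {ι : Type*} (s : Finset ι) {f : ι → E3 → ℝ} (hf : ∀ i ∈ s, Continuous (f i)) (k : K3) :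
    fc (fun x => ∑ i ∈ s, f i x) k = ∑ i ∈ s, fc (f i) k := by
  classical
  induction s using Finset.induction_on with
  | empty => simp [fc, FC]
  | insert a s ha ih =>
    simp only [Finset.sum_insert ha]
    rw [fc_add (hf a (Finset.mem_insert_self _ _))
      (continuous_finsetSum _ fun i hi => hf i (Finset.mem_insert_of_mem hi)),
      ih fun i hi => hf i (Finset.mem_insert_of_mem hi)]

/-- The Bessel operator `1 - Δ`. -/
def bes (f : E3 → ℝ) : E3 → ℝ := fun x => f x - lap f x

lemma lap_smooth {f : E3 → ℝ} (hf : ContDiff ℝ (⊤ : ℕ∞) f) (hp : SpacePeriodic f) :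
    ContDiff ℝ (⊤ : ℕ∞) (lap f) ∧ SpacePeriodic (lap f) := by
  refine ⟨ContDiff.sum fun j _ => contDiff_pd (contDiff_pd hf j) j, fun x i => ?_⟩
  exact Finset.sum_congr rfl fun j _ => periodic_pd (periodic_pd hp j) j x i

lemma fc_lap {f : E3 → ℝ} (hf : ContDiff ℝ (⊤ : ℕ∞) f) (hp : SpacePeriodic f) (k : K3) :
    fc (lap f) k = -(q k : ℂ) * fc f k := by
  have h := fc_sum Finset.univ (f := fun j => pd j (pd j f))
    (fun j _ => (contDiff_pd (contDiff_pd hf j) j).continuous) k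
  rw [show lap f = fun x => ∑ j, pd j (pd j f) x from rfl, h, q]
  push_cast
  rw [← Finset.sum_neg_distrib, Finset.sum_mul]
  refine Finset.sum_congr rfl fun j _ => ?_
  rw [fc_pd (contDiff_pd hf j) (periodic_pd hp j), fc_pd hf hp]
  linear_combination ((k j : ℂ)) ^ 2 * fc f k * Complex.I_sq

lemma bes_smooth {f : E3 → ℝ} (hf : ContDiff ℝ (⊤ : ℕ∞) f) (hp : SpacePeriodic f) (n : ℕ) :
    ContDiff ℝ (⊤ : ℕ∞) (bes^[n] f) ∧ SpacePeriodic (bes^[n] f) := by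
  induction n with
  | zero => exact ⟨hf, hp⟩
  | succ n ih =>
    rw [Function.iterate_succ_apply']
    have h := lap_smooth ih.1 ih.2
    exact ⟨ih.1.sub h.1, fun x i => by simp only [bes, ih.2 x i, h.2 x i]⟩

lemma fc_bes {f : E3 → ℝ} (hf : ContDiff ℝ (⊤ : ℕ∞) f) (hp : SpacePeriodic f) (n : ℕ) (k : K3) :
    fc (bes^[n] f) k = (J k : ℂ) ^ n * fc f k := by
  induction n with
  | zero => simp
  | succ n ih =>
    have h := bes_smooth hf hp n
    have h2 := lap_smooth h.1 h.2
    rw [Function.iterate_succ_apply', show bes (bes^[n] f) = fun x => bes^[n] f x - lap (bes^[n] f) x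
      from rfl, fc_sub h.1.continuous h2.1.continuous,
      fc_lap h.1 h.2, ih, J]
    push_cast
    ring

/-- Fourier coefficients decay as fast as the iterated Bessel operator is bounded. -/
lemma fc_dec {f : E3 → ℝ} (hf : ContDiff ℝ (⊤ : ℕ∞) f) (hp : SpacePeriodic f) {n : ℕ} {M : ℝ}
    (h : ∀ x ∈ T3, |bes^[n] f x| ≤ M) : Dec n M (fc f) := by
  intro k
  have h1 := fc_norm_le h k
  rw [fc_bes hf hp, norm_mul, norm_pow, Complex.norm_real, Real.norm_of_nonneg (J_pos k).le] at h1
  linarith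

lemma exists_fc_dec {f : E3 → ℝ} (hf : ContDiff ℝ (⊤ : ℕ∞) f) (hp : SpacePeriodic f) (n : ℕ) :
    ∃ M, Dec n M (fc f) := by
  obtain ⟨M, hM⟩ := isCompact_T3.exists_bound_of_continuousOn
    (bes_smooth hf hp n).1.continuous.continuousOn
  exact ⟨M, fc_dec hf hp fun x hx => hM x hx⟩

lemma hasSum_fc {f : E3 → ℝ} (hf : ContDiff ℝ (⊤ : ℕ∞) f) (hp : SpacePeriodic f) (x : E3) :
    HasSum (fun k => fc f k * ee k x) (f x) := by
  obtain ⟨M, hM⟩ := exists_fc_dec hf hp 2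
  exact hasSum_FC (F := fun x => (f x : ℂ)) (by have := hf.continuous; fun_prop)
    (fun x j => by simp only [hp x j]) hM.summable x

lemma fc_mul {f g : E3 → ℝ} (hf : ContDiff ℝ (⊤ : ℕ∞) f) (hp : SpacePeriodic f)
    (hg : Continuous g) (k : K3) : fc (fun x => f x * g x) k = cv (fc f) (fc g) k := by
  obtain ⟨M, hM⟩ := exists_fc_dec hf hp 2
  have h := FC_mul (F := fun x => (f x : ℂ)) (G := fun x => (g x : ℂ))
    (by have := hf.continuous; fun_prop) (fun x j => by simp only [hp x j]) hM.summable
    (by fun_prop) k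
  rw [fc]
  simp only [Complex.ofReal_mul]
  exact h

lemma fc_zero_of_mean {f : E3 → ℝ} (h : ∫ x in T3, f x = 0) : fc f 0 = 0 := by
  have : ∫ x in T3, ((f x : ℝ) : ℂ) = 0 := by rw [integral_complex_ofReal, h, Complex.ofReal_zero]
  simp [fc, FC, ee_zero, this]

/-- A multi-index monomial in the frequency. -/
def mon (β : Fin 3 → ℕ) (k : K3) : ℝ := ∏ j, ((k j : ℝ) ^ 2) ^ β j

lemma mon_nonneg (β : Fin 3 → ℕ) (k : K3) : 0 ≤ mon β k :=
  Finset.prod_nonneg fun _ _ => by positivity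

lemma norm_sq_fc_pdM {f : E3 → ℝ} (hf : ContDiff ℝ (⊤ : ℕ∞) f) (hp : SpacePeriodic f)
    (β : Fin 3 → ℕ) (k : K3) : ‖fc (pdM β f) k‖ ^ 2 = mon β k * ‖fc f k‖ ^ 2 := by
  rw [fc_pdM hf hp, norm_mul, mul_pow, norm_prod, mon, ← Finset.prod_pow]
  congr 1
  refine Finset.prod_congr rfl fun j _ => ?_
  rw [norm_pow, norm_mul, Complex.norm_I, one_mul, ← pow_mul, mul_comm, pow_mul]
  congr 1
  rw [Complex.norm_intCast, sq_abs]

lemma mem_midx {m : ℕ} {β : Fin 3 → ℕ} : β ∈ midx m ↔ ∑ j, β j = m :=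
  Finset.Nat.mem_antidiagonalTuple

lemma mon_le {m : ℕ} {β : Fin 3 → ℕ} (hβ : β ∈ midx m) (k : K3) : mon β k ≤ q k ^ m := by
  rw [← mem_midx.1 hβ, ← Finset.prod_pow_eq_pow_sum]
  exact Finset.prod_le_prod (fun _ _ => by positivity)
    fun j _ => pow_le_pow_left₀ (sq_nonneg _) (sq_le_q k j) _

lemma q_pow_le_sum_mon (m : ℕ) (k : K3) : q k ^ m ≤ 3 ^ m * ∑ β ∈ midx m, mon β k := by
  obtain ⟨j, -, hj⟩ := Finset.exists_max_image Finset.univ (fun j => (k j : ℝ) ^ 2) ⟨0, by simp⟩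
  have h1 : q k ≤ 3 * (k j : ℝ) ^ 2 := by
    have := Finset.sum_le_card_nsmul Finset.univ (fun i => (k i : ℝ) ^ 2) _ hj
    simpa [q] using this
  have hmem : (Pi.single j m : Fin 3 → ℕ) ∈ midx m := by
    rw [mem_midx]
    simp
  have h2 : mon (Pi.single j m) k = ((k j : ℝ) ^ 2) ^ m := by
    rw [mon, Finset.prod_eq_single j]
    · simp
    · intro b _ hb
      simp [hb]
    · simp
  calc q k ^ m ≤ (3 * (k j : ℝ) ^ 2) ^ m := pow_le_pow_left₀ (q_nonneg k) h1 m
    _ = 3 ^ m * mon (Pi.single j m) k := by rw [mul_pow, h2]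
    _ ≤ _ := by
      gcongr
      exact Finset.single_le_sum (f := fun β => mon β k) (fun β _ => mon_nonneg β k) hmem

lemma integral_gradSq {f : E3 → E3} (hf : ∀ i, ContDiff ℝ (⊤ : ℕ∞) fun x => f x i)
    (hp : ∀ i, SpacePeriodic fun x => f x i) (m : ℕ) :
    cT * ∫ x in T3, gradSq m f x =
      ∑ i, ∑ β ∈ midx m, cT * ∫ x in T3, pdM β (fun y => f y i) x ^ 2 := by
  have hc : ∀ i β, Continuous fun x => pdM β (fun y => f y i) x ^ 2 := fun i β =>
    (pdM_smooth (hf i) (hp i) β).1.continuous.pow 2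
  simp only [gradSq]
  rw [integral_finsetSum _ fun i _ => integrableOn_T3 (continuous_finsetSum _ fun β _ => hc i β),
    Finset.mul_sum]
  refine Finset.sum_congr rfl fun i _ => ?_
  rw [integral_finsetSum _ fun β _ => integrableOn_T3 (hc i β), Finset.mul_sum]

lemma hasSum_gradSq {f : E3 → E3} (hf : ∀ i, ContDiff ℝ (⊤ : ℕ∞) fun x => f x i)
    (hp : ∀ i, SpacePeriodic fun x => f x i) (m : ℕ) :
    HasSum (fun k => (∑ β ∈ midx m, mon β k) * ∑ i, ‖fc (fun x => f x i) k‖ ^ 2)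
      (cT * ∫ x in T3, gradSq m f x) := by
  rw [integral_gradSq hf hp]
  have : ∀ k, (∑ β ∈ midx m, mon β k) * ∑ i, ‖fc (fun x => f x i) k‖ ^ 2 =
      ∑ i, ∑ β ∈ midx m, ‖fc (pdM β fun x => f x i) k‖ ^ 2 := fun k => by
    rw [Finset.mul_sum]
    refine Finset.sum_congr rfl fun i _ => ?_
    rw [Finset.sum_mul]
    exact Finset.sum_congr rfl fun β _ => (norm_sq_fc_pdM (hf i) (hp i) β k).symm
  simp only [this]
  exact hasSum_sum fun i _ => hasSum_sum fun β _ =>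
    hasSum_sq_fc (pdM_smooth (hf i) (hp i) β).1.continuous (pdM_smooth (hf i) (hp i) β).2

/-! ### Products with a smooth field -/

lemma bessel_mul (Λ : Finset K3) (b : K3 → ℂ) {g : E3 → ℝ} (hg : Continuous g)
    (hp : SpacePeriodic g) {M : ℝ} (hM : ∀ x, |g x| ≤ M) :
    ∑ k ∈ Λ, ‖∑ l ∈ Λ, b l * fc g (k - l)‖ ^ 2 ≤ M ^ 2 * ∑ l ∈ Λ, ‖b l‖ ^ 2 := by
  classical
  set c : K3 → ℂ := fun k => if k ∈ Λ then b k else 0 with hc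
  have hfin : ∀ (φ : K3 → ℂ), ∑' l, c l * φ l = ∑ l ∈ Λ, b l * φ l := fun φ => by
    rw [tsum_eq_sum (s := Λ) fun l hl => by simp [hc, hl]]
    exact Finset.sum_congr rfl fun l hl => by simp [hc, hl]
  have hcs : Summable fun k => ‖c k‖ :=
    summable_of_ne_finset_zero (s := Λ) fun l hl => by simp [hc, hl]
  set B : E3 → ℂ := fun x => ∑' l, c l * ee l x with hB
  have hBf : B = fun x => ∑ l ∈ Λ, b l * ee l x := by
    funext x
    exact hfin fun l => ee l x
  have hBc : Continuous B := by
    rw [hBf]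
    exact continuous_finsetSum _ fun l _ => continuous_const.mul (continuous_ee l)
  have hBp : SpacePeriodic B := fun x j => by simp only [hB, ee_periodic _ x j]
  have h1 := hasSum_sq_FC hBc hBp
  simp only [hB, FC_tsum hcs] at h1
  have h2 := hasSum_sq_FC (F := fun x => B x * (g x : ℂ)) (by fun_prop)
    (fun x j => by simp only [hBp x j, hp x j])
  have hk : ∀ k, FC (fun x => B x * (g x : ℂ)) k = ∑ l ∈ Λ, b l * fc g (k - l) := fun k => by
    rw [← hfin fun l => fc g (k - l)]
    exact FC_tsum_mul hcs (G := fun x => (g x : ℂ)) (by fun_prop) k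
  simp only [hk] at h2
  have h3 := sum_le_hasSum Λ (fun k _ => by positivity) h2
  have h4 : cT * ∫ x in T3, ‖B x‖ ^ 2 = ∑ l ∈ Λ, ‖b l‖ ^ 2 := by
    rw [← h1.tsum_eq, tsum_eq_sum (s := Λ) fun l hl => by simp [hc, hl]]
    exact Finset.sum_congr rfl fun l hl => by simp [hc, hl]
  rw [← h4]
  refine h3.trans ?_
  have h5 : ∫ x in T3, ‖B x * (g x : ℂ)‖ ^ 2 ≤ ∫ x in T3, M ^ 2 * ‖B x‖ ^ 2 := by
    refine integral_mono (integrableOn_T3 (by fun_prop)) (integrableOn_T3 (by fun_prop)) fun x => ?_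
    simp only [norm_mul, Complex.norm_real, norm_eq_abs, mul_pow]
    rw [mul_comm]
    gcongr
    exact hM x
  rw [integral_const_mul] at h5
  calc _ ≤ cT * (M ^ 2 * ∫ x in T3, ‖B x‖ ^ 2) := mul_le_mul_of_nonneg_left h5 cT_pos.le
    _ = _ := by ring

lemma q_pow_eq_sum (m : ℕ) (k : K3) :
    q k ^ m = ∑ L : Fin m → Fin 3, (∏ s, (k (L s) : ℝ)) ^ 2 := by
  rw [q, Fintype.sum_pow]
  exact Finset.sum_congr rfl fun L _ => (Finset.prod_pow _ _ _)

lemma prod_sq_le_q_pow {m : ℕ} (L : Fin m → Fin 3) (S : Finset (Fin m)) (k : K3) :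
    (∏ s ∈ S, (k (L s) : ℝ)) ^ 2 ≤ q k ^ S.card := by
  rw [← Finset.prod_pow, ← Finset.prod_const]
  exact Finset.prod_le_prod (fun s _ => sq_nonneg _) fun s _ => sq_le_q k (L s)

lemma fc_pdM_count {f : E3 → ℝ} (hf : ContDiff ℝ (⊤ : ℕ∞) f) (hp : SpacePeriodic f) {m : ℕ}
    (L : Fin m → Fin 3) (S : Finset (Fin m)) (k : K3) :
    fc (pdM (fun j => (S.filter fun s => L s = j).card) f) k =
      Complex.I ^ S.card * (∏ s ∈ S, (k (L s) : ℂ)) * fc f k := by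
  rw [fc_pdM hf hp]
  congr 1
  have h : ∀ j, (Complex.I * (k j : ℂ)) ^ (S.filter fun s => L s = j).card =
      ∏ s ∈ S.filter fun s => L s = j, Complex.I * (k (L s) : ℂ) := fun j => by
    rw [Finset.prod_congr rfl (g := fun _ => Complex.I * (k j : ℂ)), Finset.prod_const]
    intro s hs
    rw [(Finset.mem_filter.1 hs).2]
  simp only [h]
  rw [Finset.prod_fiberwise, Finset.prod_mul_distrib, Finset.prod_const]

lemma conv_field (Λ : Finset K3) {f : E3 → ℝ} (hf : ContDiff ℝ (⊤ : ℕ∞) f) (hp : SpacePeriodic f)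
    {W : ℕ → ℝ} (hW : ∀ β x, |pdM β f x| ≤ W (∑ j, β j)) (a : K3 → ℂ) (m : ℕ) :
    SE Λ m (fun k => ∑ l ∈ Λ, a l * fc f (k - l)) ≤
      12 ^ m * ∑ j ∈ Finset.range (m + 1), W (m - j) ^ 2 * SE Λ j a := by
  classical
  set c : K3 → ℂ := fun k => ∑ l ∈ Λ, a l * fc f (k - l) with hc
  set R := ∑ j ∈ Finset.range (m + 1), W (m - j) ^ 2 * SE Λ j a with hR
  set T : (Fin m → Fin 3) → Finset (Fin m) → K3 → ℂ := fun L S k =>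
    ∑ l ∈ Λ, ((∏ s ∈ S, (l (L s) : ℂ)) * a l) *
      fc (pdM (fun j => (Sᶜ.filter fun s => L s = j).card) f) (k - l) with hT
  have hsplit : ∀ L k, ‖(∏ s, (k (L s) : ℂ)) * c k‖ ≤ ∑ S : Finset (Fin m), ‖T L S k‖ := by
    intro L k
    have h1 : (∏ s, (k (L s) : ℂ)) * c k = ∑ S : Finset (Fin m),
        ∑ l ∈ Λ, (∏ s ∈ S, (l (L s) : ℂ)) * (∏ s ∈ Sᶜ, ((k - l) (L s) : ℂ)) *
          (a l * fc f (k - l)) := by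
      rw [Finset.sum_comm, hc, Finset.mul_sum]
      refine Finset.sum_congr rfl fun l _ => ?_
      rw [← Finset.sum_mul]
      congr 1
      have := Fintype.prod_add (fun s => (l (L s) : ℂ)) (fun s => ((k - l) (L s) : ℂ))
      rw [← this]
      exact Finset.prod_congr rfl fun s _ => by push_cast [Pi.sub_apply]; ring
    rw [h1]
    refine (norm_sum_le _ _).trans (Finset.sum_le_sum fun S _ => le_of_eq ?_)
    have h2 : T L S k = Complex.I ^ Sᶜ.card * ∑ l ∈ Λ, (∏ s ∈ S, (l (L s) : ℂ)) *
        (∏ s ∈ Sᶜ, ((k - l) (L s) : ℂ)) * (a l * fc f (k - l)) := by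
      rw [hT, Finset.mul_sum]
      refine Finset.sum_congr rfl fun l _ => ?_
      rw [fc_pdM_count hf hp]
      ring
    rw [h2, norm_mul, norm_pow, Complex.norm_I, one_pow, one_mul]
  have hTb : ∀ L S, ∑ k ∈ Λ, ‖T L S k‖ ^ 2 ≤ R := by
    intro L S
    have hsm := pdM_smooth hf hp (fun j => (Sᶜ.filter fun s => L s = j).card)
    have hcard : ∑ j, (Sᶜ.filter fun s => L s = j).card = m - S.card := by
      rw [← Finset.card_eq_sum_card_fiberwise (fun s _ => Finset.mem_univ (L s)),
        Finset.card_compl, Fintype.card_fin]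
    have h1 := bessel_mul Λ (fun l => (∏ s ∈ S, (l (L s) : ℂ)) * a l) hsm.1.continuous hsm.2
      (M := W (m - S.card)) fun x => by
        have := hW (fun j => (Sᶜ.filter fun s => L s = j).card) x
        rwa [hcard] at this
    refine h1.trans ?_
    have h2 : ∑ l ∈ Λ, ‖(∏ s ∈ S, (l (L s) : ℂ)) * a l‖ ^ 2 ≤ SE Λ S.card a := by
      refine Finset.sum_le_sum fun l _ => ?_
      rw [norm_mul, mul_pow]
      gcongr
      have : ‖∏ s ∈ S, (l (L s) : ℂ)‖ ^ 2 = (∏ s ∈ S, (l (L s) : ℝ)) ^ 2 := by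
        have h3 : (∏ s ∈ S, (l (L s) : ℂ)) = ((∏ s ∈ S, (l (L s) : ℝ) : ℝ) : ℂ) := by push_cast; rfl
        rw [h3, Complex.norm_real, norm_eq_abs, sq_abs]
      rw [this]
      exact prod_sq_le_q_pow L S l
    have hS : S.card ∈ Finset.range (m + 1) := by
      have := Finset.card_le_univ S
      rw [Fintype.card_fin] at this
      exact Finset.mem_range.2 (by omega)
    calc _ ≤ W (m - S.card) ^ 2 * SE Λ S.card a := mul_le_mul_of_nonneg_left h2 (sq_nonneg _)
      _ ≤ R := Finset.single_le_sum (f := fun j => W (m - j) ^ 2 * SE Λ j a)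
        (fun j _ => mul_nonneg (sq_nonneg _) (SE_nonneg Λ j a)) hS
  have hL : ∀ L : Fin m → Fin 3, ∑ k ∈ Λ, (∏ s, (k (L s) : ℝ)) ^ 2 * ‖c k‖ ^ 2 ≤ 4 ^ m * R := by
    intro L
    calc ∑ k ∈ Λ, (∏ s, (k (L s) : ℝ)) ^ 2 * ‖c k‖ ^ 2
        ≤ ∑ k ∈ Λ, 2 ^ m * ∑ S : Finset (Fin m), ‖T L S k‖ ^ 2 := by
          refine Finset.sum_le_sum fun k _ => ?_
          have h3 : (∏ s, (k (L s) : ℝ)) ^ 2 * ‖c k‖ ^ 2 = ‖(∏ s, (k (L s) : ℂ)) * c k‖ ^ 2 := by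
            have h3 : (∏ s, (k (L s) : ℂ)) = ((∏ s, (k (L s) : ℝ) : ℝ) : ℂ) := by push_cast; rfl
            rw [h3, norm_mul, mul_pow, Complex.norm_real, norm_eq_abs, sq_abs]
          rw [h3]
          have h4 := sq_sum_le_card_mul_sum_sq (s := (Finset.univ : Finset (Finset (Fin m))))
            (f := fun S => ‖T L S k‖)
          rw [Finset.card_univ, Fintype.card_finset, Fintype.card_fin] at h4
          push_cast at h4
          exact (pow_le_pow_left₀ (norm_nonneg _) (hsplit L k) 2).trans h4
      _ = 2 ^ m * ∑ S : Finset (Fin m), ∑ k ∈ Λ, ‖T L S k‖ ^ 2 := by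
          rw [← Finset.mul_sum, Finset.sum_comm]
      _ ≤ 2 ^ m * ∑ S : Finset (Fin m), R := by
          gcongr with S _
          exact hTb L S
      _ = 4 ^ m * R := by
          rw [Finset.sum_const, Finset.card_univ, Fintype.card_finset, Fintype.card_fin, nsmul_eq_mul,
            show (4 : ℝ) = 2 * 2 by norm_num, mul_pow]
          push_cast
          ring
  calc SE Λ m c = ∑ L : Fin m → Fin 3, ∑ k ∈ Λ, (∏ s, (k (L s) : ℝ)) ^ 2 * ‖c k‖ ^ 2 := by
        rw [Finset.sum_comm, SE]
        refine Finset.sum_congr rfl fun k _ => ?_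
        rw [q_pow_eq_sum, Finset.sum_mul]
    _ ≤ ∑ L : Fin m → Fin 3, 4 ^ m * R := Finset.sum_le_sum fun L _ => hL L
    _ = 12 ^ m * R := by
        rw [Finset.sum_const, Finset.card_univ, Fintype.card_pi_const, Fintype.card_fin,
          nsmul_eq_mul, show (12 : ℝ) = 3 * 4 by norm_num, mul_pow]
        push_cast
        ring

/-! ### Truncated ordinary differential equations -/

lemma ode_exists_unique {V B : Type*} [NormedAddCommGroup V] [NormedSpace ℝ V]
    [FiniteDimensional ℝ V] [NormedAddCommGroup B] [NormedSpace ℝ B] [FiniteDimensional ℝ B]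
    {g : B × V → V} (hg : ContDiff ℝ 1 g) {R : ℝ} (hR : ∀ p : B × V, R ≤ ‖p.2‖ → g p = 0)
    {T : ℝ} (hT : 0 ≤ T) {b : ℝ → B} (hb : ContinuousOn b (Icc 0 T)) (x₀ : V) :
    ∃ α : ℝ → V, α 0 = x₀ ∧
      (∀ t ∈ Icc 0 T, HasDerivWithinAt α (g (b t, α t)) (Icc 0 T) t) ∧
      ∀ α' : ℝ → V, α' 0 = x₀ →
        (∀ t ∈ Icc 0 T, HasDerivWithinAt α' (g (b t, α' t)) (Icc 0 T) t) →
        EqOn α α' (Icc 0 T) := by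
  have : CompleteSpace V := FiniteDimensional.complete ℝ V
  obtain ⟨M, hM⟩ := isCompact_Icc.exists_bound_of_continuousOn hb
  let φ : ContDiffBump (0 : B) := ⟨|M| + 1, |M| + 2, by positivity, by linarith⟩
  have hφ : ∀ t ∈ Icc 0 T, φ (b t) = 1 := fun t ht => by
    refine φ.one_of_mem_closedBall ?_
    rw [mem_closedBall_zero_iff]
    have := hM t ht
    have := le_abs_self M
    change ‖b t‖ ≤ |M| + 1
    linarith
  set G : B × V → V := fun p => φ p.1 • g p with hG
  have hGc : ContDiff ℝ 1 G := (φ.contDiff.comp contDiff_fst).smul hg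
  have hGs : HasCompactSupport G := by
    refine HasCompactSupport.of_support_subset_isCompact
      ((ProperSpace.isCompact_closedBall (0 : B) (|M| + 2)).prod
        (ProperSpace.isCompact_closedBall (0 : V) R)) fun p hp => ?_
    rw [Function.mem_support] at hp
    refine ⟨?_, ?_⟩
    · by_contra h
      refine hp ?_
      simp only [hG]
      rw [φ.zero_of_le_dist (by
        rw [Metric.mem_closedBall, not_le] at h
        exact h.le), zero_smul]
    · by_contra h
      refine hp ?_
      simp only [hG]
      rw [hR p (by
        rw [mem_closedBall_zero_iff, not_le] at h
        exact h.le), smul_zero]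
  obtain ⟨K, hK⟩ := hGs.exists_bound_of_continuous hGc.continuous
  obtain ⟨C, hC⟩ := ContDiff.lipschitzWith_of_hasCompactSupport hGs hGc one_ne_zero
  have hCt : ∀ t, LipschitzWith C fun x => G (b t, x) := fun t => by
    have h := hC.comp (LipschitzWith.prodMk_left (b t))
    rwa [mul_one] at h
  have hGe : ∀ t ∈ Icc 0 T, ∀ x, G (b t, x) = g (b t, x) := fun t ht x => by
    simp only [hG]
    rw [hφ t ht, one_smul]
  have hPL : IsPicardLindelof (fun t x => G (b t, x)) (tmin := 0) (tmax := T) ⟨0, by simp [hT]⟩ x₀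
      (Real.toNNReal K * Real.toNNReal T) 0 (Real.toNNReal K) C := by
    refine ⟨fun t _ => (hCt t).lipschitzOnWith, fun x _ => ?_, fun t _ x _ => ?_, ?_⟩
    · exact hGc.continuous.comp_continuousOn (hb.prodMk continuousOn_const)
    · exact (hK _).trans (Real.le_coe_toNNReal K)
    · simp [hT, Real.coe_toNNReal']
  obtain ⟨α, hα0, hα⟩ := hPL.exists_eq_forall_mem_Icc_hasDerivWithinAt₀
  refine ⟨α, hα0, fun t ht => ?_, fun α' h0 h' => ?_⟩
  · rw [← hGe t ht]
    exact hα t ht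
  · have key : ∀ γ : ℝ → V, (∀ t ∈ Icc 0 T, HasDerivWithinAt γ (G (b t, γ t)) (Icc 0 T) t) →
        ContinuousOn γ (Icc 0 T) ∧ ∀ t ∈ Ico 0 T, HasDerivWithinAt γ (G (b t, γ t)) (Ici t) t := by
      intro γ hγ
      refine ⟨fun t ht => (hγ t ht).continuousWithinAt, fun t ht => ?_⟩
      exact (hγ t ⟨ht.1, ht.2.le⟩).mono_of_mem_nhdsWithin
        (Filter.mem_of_superset (Icc_mem_nhdsGE ht.2) (Icc_subset_Icc_left ht.1))
    have h1 := key α hα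
    have h2 := key α' fun t ht => by
      rw [hGe t ht]
      exact h' t ht
    exact ODE_solution_unique hCt h1.1 h1.2 h2.1 h2.2 (hα0.trans h0.symm)

/-! ### The Galerkin system -/

/-- The Leray projection at frequency `k`. -/
def Pr (k : K3) (z : Fin 3 → ℂ) (i : Fin 3) : ℂ := z i - k i * (∑ j, k j * z j) / q k

/-- The quadratic and linear interaction terms at frequency `k`. -/
def Nl (Λ : Finset K3) (a b : K3 → Fin 3 → ℂ) (k : K3) (j i : Fin 3) : ℂ :=
  ∑ l ∈ Λ, a l j * a (k - l) i + ∑ l ∈ Λ, a l i * b (k - l) j + ∑ l ∈ Λ, a l j * b (k - l) i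

/-- The vector field of the Galerkin system. -/
def Fld (ν : ℝ) (Λ : Finset K3) (a b : K3 → Fin 3 → ℂ) (k : K3) (i : Fin 3) : ℂ :=
  Pr k (fun i => -(ν * q k : ℝ) * a k i - Complex.I * ∑ j, k j * Nl Λ a b k j i) i

/-- The homogeneous energy of order `m`. -/
def En (Λ : Finset K3) (m : ℕ) (a : K3 → Fin 3 → ℂ) : ℝ := ∑ i, SE Λ m fun k => a k i

/-- A smooth cutoff, one on `(-∞, δ]` and vanishing on `[2δ, ∞)`. -/
def cut (δ s : ℝ) : ℝ := Real.smoothTransition (2 - s / δ)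

lemma cut_nonneg (δ s : ℝ) : 0 ≤ cut δ s := Real.smoothTransition.nonneg _

lemma cut_le_one (δ s : ℝ) : cut δ s ≤ 1 := Real.smoothTransition.le_one _

lemma cut_eq_one {δ s : ℝ} (hδ : 0 < δ) (h : s ≤ δ) : cut δ s = 1 := by
  refine Real.smoothTransition.one_of_one_le ?_
  have : s / δ ≤ 1 := (div_le_one hδ).2 h
  linarith

lemma cut_eq_zero {δ s : ℝ} (hδ : 0 < δ) (h : 2 * δ ≤ s) : cut δ s = 0 := by
  refine Real.smoothTransition.zero_of_nonpos ?_
  have : 2 ≤ s / δ := (le_div_iff₀ hδ).2 h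
  linarith

lemma contDiff_cut (δ : ℝ) {n : ℕ∞} : ContDiff ℝ n (cut δ) :=
  Real.smoothTransition.contDiff.comp (contDiff_const.sub (contDiff_id.div_const δ))

/-- Extension by zero of a finite family of coefficients. -/
def extz {D : Finset K3} (a : D → Fin 3 → ℂ) (k : K3) (i : Fin 3) : ℂ :=
  if h : k ∈ D then a ⟨k, h⟩ i else 0

lemma extz_mem {D : Finset K3} (a : D → Fin 3 → ℂ) {k : K3} (h : k ∈ D) (i : Fin 3) :
    extz a k i = a ⟨k, h⟩ i := dif_pos h

lemma extz_not_mem {D : Finset K3} (a : D → Fin 3 → ℂ) {k : K3} (h : k ∉ D) (i : Fin 3) :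
    extz a k i = 0 := dif_neg h

lemma contDiff_extz {D : Finset K3} (k : K3) (i : Fin 3) {n : WithTop ℕ∞} :
    ContDiff ℝ n fun a : D → Fin 3 → ℂ => extz a k i := by
  by_cases h : k ∈ D
  · simp only [extz_mem _ h]
    fun_prop
  · simp only [extz_not_mem _ h]
    exact contDiff_const

lemma contDiff_Fld (ν : ℝ) (Λ D : Finset K3) (k : K3) (i : Fin 3) {n : WithTop ℕ∞} :
    ContDiff ℝ n fun p : (D → Fin 3 → ℂ) × (Λ → Fin 3 → ℂ) =>
      Fld ν Λ (extz p.2) (extz p.1) k i := by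
  have h1 : ∀ k i, ContDiff ℝ n fun p : (D → Fin 3 → ℂ) × (Λ → Fin 3 → ℂ) => extz p.1 k i :=
    fun k i => (contDiff_extz k i).comp contDiff_fst
  have h2 : ∀ k i, ContDiff ℝ n fun p : (D → Fin 3 → ℂ) × (Λ → Fin 3 → ℂ) => extz p.2 k i :=
    fun k i => (contDiff_extz k i).comp contDiff_snd
  have h3 : ∀ j i, ContDiff ℝ n fun p : (D → Fin 3 → ℂ) × (Λ → Fin 3 → ℂ) =>
      Nl Λ (extz p.2) (extz p.1) k j i := fun j i =>
    ((ContDiff.sum fun l _ => (h2 l j).mul (h2 (k - l) i)).add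
      (ContDiff.sum fun l _ => (h2 l i).mul (h1 (k - l) j))).add
      (ContDiff.sum fun l _ => (h2 l j).mul (h1 (k - l) i))
  have h4 : ∀ i, ContDiff ℝ n fun p : (D → Fin 3 → ℂ) × (Λ → Fin 3 → ℂ) =>
      -((ν * q k : ℝ) : ℂ) * extz p.2 k i -
        Complex.I * ∑ j, k j * Nl Λ (extz p.2) (extz p.1) k j i := fun i =>
    (contDiff_const.mul (h2 k i)).sub
      (contDiff_const.mul (ContDiff.sum fun j _ => contDiff_const.mul (h3 j i)))
  exact (h4 i).sub
    ((contDiff_const.mul (ContDiff.sum fun j _ => contDiff_const.mul (h4 j))).div_const _)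

lemma contDiff_En (Λ : Finset K3) (m : ℕ) {n : WithTop ℕ∞} :
    ContDiff ℝ n fun a : Λ → Fin 3 → ℂ => En Λ m (extz a) :=
  ContDiff.sum fun i _ => ContDiff.sum fun k _ =>
    contDiff_const.mul ((contDiff_extz k i).norm_sq ℝ)

lemma En_nonneg (Λ : Finset K3) (m : ℕ) (a : K3 → Fin 3 → ℂ) : 0 ≤ En Λ m a :=
  Finset.sum_nonneg fun _ _ => SE_nonneg _ _ _

lemma En_congr {Λ : Finset K3} {a a' : K3 → Fin 3 → ℂ} (h : ∀ k ∈ Λ, ∀ i, a k i = a' k i) (m : ℕ) :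
    En Λ m a = En Λ m a' :=
  Finset.sum_congr rfl fun i _ => Finset.sum_congr rfl fun k hk => by simp only [h k hk i]

lemma norm_sq_le_En {Λ : Finset K3} (m : ℕ) (a : K3 → Fin 3 → ℂ) {k : K3}
    (hk : k ∈ Λ) (i : Fin 3) : q k ^ m * ‖a k i‖ ^ 2 ≤ En Λ m a := by
  have h1 : q k ^ m * ‖a k i‖ ^ 2 ≤ SE Λ m fun k => a k i :=
    Finset.single_le_sum (f := fun k => q k ^ m * ‖a k i‖ ^ 2)
      (fun k _ => mul_nonneg (pow_nonneg (q_nonneg k) m) (sq_nonneg _)) hk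
  exact h1.trans (Finset.single_le_sum (f := fun i => SE Λ m fun k => a k i)
    (fun i _ => SE_nonneg _ _ _) (Finset.mem_univ i))

lemma sum_neg_comm {Λ : Finset K3} (hΛ : ∀ k ∈ Λ, -k ∈ Λ) {E : Type*} [AddCommMonoid E]
    (f : K3 → E) : ∑ k ∈ Λ, f (-k) = ∑ k ∈ Λ, f k :=
  Finset.sum_nbij' (fun k => -k) (fun k => -k) hΛ hΛ (by simp) (by simp) (by simp)

lemma Fld_conj (ν : ℝ) {Λ : Finset K3} (hΛ : ∀ k ∈ Λ, -k ∈ Λ) (a b : K3 → Fin 3 → ℂ)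
    (hb : ∀ k i, b (-k) i = (starRingEnd ℂ) (b k i)) (k : K3) (i : Fin 3) :
    Fld ν Λ (fun k i => (starRingEnd ℂ) (a (-k) i)) b k i =
      (starRingEnd ℂ) (Fld ν Λ a b (-k) i) := by
  have hN : ∀ j i, Nl Λ (fun k i => (starRingEnd ℂ) (a (-k) i)) b k j i =
      (starRingEnd ℂ) (Nl Λ a b (-k) j i) := fun j i => by
    simp only [Nl, map_add, map_sum, map_mul]
    rw [← sum_neg_comm hΛ, ← sum_neg_comm hΛ (fun l => (starRingEnd ℂ) (a (-l) i) * b (k - l) j),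
      ← sum_neg_comm hΛ (fun l => (starRingEnd ℂ) (a (-l) j) * b (k - l) i)]
    simp only [sub_eq_add_neg, ← hb, neg_add_rev, neg_neg, add_comm (-k), add_comm k]
  simp only [Fld, Pr, map_sub, map_mul, map_div₀, map_sum, hN, Complex.conj_ofReal, map_neg, q_neg,
    Complex.conj_I, Pi.neg_apply, Int.cast_neg, map_intCast]
  simp only [mul_neg, neg_mul, Finset.sum_neg_distrib, neg_neg, sub_neg_eq_add,
    Finset.mul_sum, mul_sub, mul_add, Finset.sum_sub_distrib, Finset.sum_add_distrib]
  ring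

lemma En_conj {Λ : Finset K3} (hΛ : ∀ k ∈ Λ, -k ∈ Λ) (m : ℕ) (a : K3 → Fin 3 → ℂ) :
    En Λ m (fun k i => (starRingEnd ℂ) (a (-k) i)) = En Λ m a := by
  refine Finset.sum_congr rfl fun i _ => ?_
  rw [SE, SE, ← sum_neg_comm hΛ]
  simp only [q_neg, neg_neg, RCLike.norm_conj]

lemma Fld_congr (ν : ℝ) {Λ : Finset K3} {a b b' : K3 → Fin 3 → ℂ} {k : K3}
    (h : ∀ l ∈ Λ, ∀ i, b (k - l) i = b' (k - l) i) (i : Fin 3) :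
    Fld ν Λ a b k i = Fld ν Λ a b' k i := by
  have hN : ∀ j i, Nl Λ a b k j i = Nl Λ a b' k j i := fun j i => by
    unfold Nl
    congr 1
    · congr 1
      exact Finset.sum_congr rfl fun l hl => by rw [h l hl]
    · exact Finset.sum_congr rfl fun l hl => by rw [h l hl]
  simp only [Fld, hN]

/-- Global solvability of the truncated Galerkin system. -/
lemma galerkin {Λ : Finset K3} (h0 : (0 : K3) ∉ Λ) (hΛ : ∀ k ∈ Λ, -k ∈ Λ) (ν : ℝ) {δ T : ℝ}
    (hδ : 0 < δ) (hT : 0 ≤ T) {b : ℝ → K3 → Fin 3 → ℂ}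
    (hb : ∀ k i, ContinuousOn (fun t => b t k i) (Icc 0 T))
    (hbs : ∀ t k i, b t (-k) i = (starRingEnd ℂ) (b t k i))
    {a0 : K3 → Fin 3 → ℂ} (ha0 : ∀ k i, a0 (-k) i = (starRingEnd ℂ) (a0 k i)) :
    ∃ a : ℝ → K3 → Fin 3 → ℂ, (∀ t, ∀ k ∉ Λ, ∀ i, a t k i = 0) ∧ (∀ k ∈ Λ, ∀ i, a 0 k i = a0 k i) ∧
      (∀ t ∈ Icc 0 T, ∀ k ∈ Λ, ∀ i, HasDerivWithinAt (fun t => a t k i)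
        (cut δ (En Λ 1 (a t)) * Fld ν Λ (a t) (b t) k i) (Icc 0 T) t) ∧
      ∀ t ∈ Icc 0 T, ∀ k i, a t (-k) i = (starRingEnd ℂ) (a t k i) := by
  set D : Finset K3 := Finset.image (fun p : K3 × K3 => p.1 - p.2) (Λ ×ˢ Λ) with hD
  have hDm : ∀ k ∈ Λ, ∀ l ∈ Λ, k - l ∈ D := fun k hk l hl =>
    Finset.mem_image.2 ⟨(k, l), Finset.mem_product.2 ⟨hk, hl⟩, rfl⟩
  let g : (D → Fin 3 → ℂ) × (Λ → Fin 3 → ℂ) → (Λ → Fin 3 → ℂ) := fun p k i =>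
    (cut δ (En Λ 1 (extz p.2)) : ℂ) * Fld ν Λ (extz p.2) (extz p.1) k i
  have hg : ContDiff ℝ 1 g := by
    refine contDiff_pi.2 fun k => contDiff_pi.2 fun i => ContDiff.mul ?_ (contDiff_Fld ν Λ D k i)
    exact Complex.ofRealCLM.contDiff.comp
      ((contDiff_cut δ (n := 1)).comp ((contDiff_En Λ 1).comp contDiff_snd))
  have hR : ∀ p, √(2 * δ) + 1 ≤ ‖p.2‖ → g p = 0 := by
    intro p hp
    have hE : 2 * δ ≤ En Λ 1 (extz p.2) := by
      by_contra! hlt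
      have : ‖p.2‖ ≤ √(2 * δ) := by
        refine (pi_norm_le_iff_of_nonneg (Real.sqrt_nonneg _)).2 fun k =>
          (pi_norm_le_iff_of_nonneg (Real.sqrt_nonneg _)).2 fun i => ?_
        refine Real.le_sqrt_of_sq_le ?_
        have h1 := norm_sq_le_En 1 (extz p.2) k.2 i
        rw [extz_mem _ k.2, pow_one] at h1
        have h2 := one_le_q (k := (k : K3)) fun h => h0 (h ▸ k.2)
        have h3 : ‖p.2 k i‖ ^ 2 ≤ q k * ‖p.2 k i‖ ^ 2 := le_mul_of_one_le_left (sq_nonneg _) h2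
        exact h3.trans (h1.trans hlt.le)
      linarith
    funext k i
    simp only [g]
    rw [cut_eq_zero hδ hE]
    simp
  have hbD : ContinuousOn (fun t => fun (k : D) i => b t k i) (Icc 0 T) :=
    continuousOn_pi.2 fun k => continuousOn_pi.2 fun i => hb k i
  obtain ⟨α, hα0, hα, hu⟩ := ode_exists_unique hg hR hT hbD (fun (k : Λ) i => a0 k i)
  have hF : ∀ t a, ∀ k : Λ, ∀ i, Fld ν Λ a (extz fun (k : D) i => b t k i) k i =
      Fld ν Λ a (b t) k i := fun t a k i =>
    Fld_congr ν (fun l hl i => extz_mem _ (hDm k k.2 l hl) i) i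
  have hd : ∀ t ∈ Icc 0 T, ∀ k : Λ, ∀ i, HasDerivWithinAt (fun t => α t k i)
        (cut δ (En Λ 1 (extz (α t))) * Fld ν Λ (extz (α t)) (b t) k i) (Icc 0 T) t := by
    intro t ht k i
    have := hasDerivWithinAt_pi.1 (hasDerivWithinAt_pi.1 (hα t ht) k) i
    rwa [← hF]
  refine ⟨fun t => extz (α t), fun t k hk i => extz_not_mem _ hk i, fun k hk i => ?_,
    fun t ht k hk i => ?_, ?_⟩
  · simp only
    rw [extz_mem _ hk, hα0]
  · simp only [extz_mem _ hk]
    exact hd t ht ⟨k, hk⟩ i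
  · have hex : ∀ t, extz (fun (k : Λ) i => (starRingEnd ℂ) (α t ⟨-k, hΛ k k.2⟩ i)) =
        fun k i => (starRingEnd ℂ) (extz (α t) (-k) i) := fun t => by
      funext k i
      by_cases hk : k ∈ Λ
      · rw [extz_mem _ hk, extz_mem _ (hΛ k hk)]
      · rw [extz_not_mem _ hk, extz_not_mem _ fun h => hk (by simpa using hΛ _ h), map_zero]
    have h := hu (fun t k i => (starRingEnd ℂ) (α t ⟨-k, hΛ k k.2⟩ i)) (by
      rw [hα0]
      funext k i
      simp only
      rw [ha0, Complex.conj_conj]) fun t ht => by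
        refine hasDerivWithinAt_pi.2 fun k => hasDerivWithinAt_pi.2 fun i => ?_
        have h1 := (hd t ht ⟨-k, hΛ k k.2⟩ i).star
        refine HasDerivWithinAt.congr_deriv (f := fun x => (starRingEnd ℂ) (α x ⟨-k, hΛ k k.2⟩ i)) h1 ?_
        simp only [g]
        rw [hex t, En_conj hΛ, hF, Fld_conj ν hΛ _ _ (hbs t)]
        simp
    intro t ht k i
    have h2 := hex t
    have h3 := h ht
    simp only at h3
    rw [← h3] at h2
    have h4 := congrFun (congrFun h2 (-k)) i
    rwa [neg_neg] at h4

/-! ### Energy estimates for the Galerkin system -/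

lemma Fld_re (ν : ℝ) (Λ : Finset K3) (a b : K3 → Fin 3 → ℂ) (k : K3)
    (h : ∑ j, (k j : ℂ) * a k j = 0) {ε : ℝ} (hε : 0 < ε) :
    ∑ i, 2 * ((starRingEnd ℂ) (a k i) * Fld ν Λ a b k i).re ≤
      (-2 * ν + ε) * (q k * ∑ i, ‖a k i‖ ^ 2) + ε⁻¹ * ∑ j, ∑ i, ‖Nl Λ a b k j i‖ ^ 2 := by
  have h' : ∑ i, (starRingEnd ℂ) (a k i) * (k i : ℂ) = 0 := by
    have := congrArg (starRingEnd ℂ) h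
    rw [map_sum, map_zero] at this
    rw [← this]
    exact Finset.sum_congr rfl fun j _ => by simp [mul_comm]
  have h1 : ∑ i, (starRingEnd ℂ) (a k i) * Fld ν Λ a b k i =
      ∑ i, (starRingEnd ℂ) (a k i) *
        (-(ν * q k : ℝ) * a k i - Complex.I * ∑ j, k j * Nl Λ a b k j i) := by
    set z : Fin 3 → ℂ := fun i => -(ν * q k : ℝ) * a k i - Complex.I * ∑ j, k j * Nl Λ a b k j i
    change ∑ i, (starRingEnd ℂ) (a k i) * (z i - k i * (∑ j, k j * z j) / q k) =
      ∑ i, (starRingEnd ℂ) (a k i) * z i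
    simp only [mul_sub, mul_div_assoc, ← mul_assoc]
    rw [Finset.sum_sub_distrib, ← Finset.sum_mul, h', zero_mul, sub_zero]
  have h2 : ∑ i, 2 * ((starRingEnd ℂ) (a k i) * Fld ν Λ a b k i).re =
      2 * (∑ i, (starRingEnd ℂ) (a k i) * Fld ν Λ a b k i).re := by
    rw [Complex.re_sum, Finset.mul_sum]
  rw [h2, h1, Complex.re_sum, Finset.mul_sum]
  have hq : q k = ∑ j, (k j : ℝ) ^ 2 := rfl
  have h3 : ∀ i, 2 * ((starRingEnd ℂ) (a k i) *
      (-(ν * q k : ℝ) * a k i - Complex.I * ∑ j, k j * Nl Λ a b k j i)).re ≤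
      (-2 * ν + ε) * (q k * ‖a k i‖ ^ 2) + ε⁻¹ * ∑ j, ‖Nl Λ a b k j i‖ ^ 2 := by
    intro i
    have e1 : (starRingEnd ℂ) (a k i) *
        (-(ν * q k : ℝ) * a k i - Complex.I * ∑ j, k j * Nl Λ a b k j i) =
        ((-(ν * q k) * ‖a k i‖ ^ 2 : ℝ) : ℂ) +
          ∑ j, -((starRingEnd ℂ) (a k i) * Complex.I * (k j * Nl Λ a b k j i)) := by
      have := Complex.conj_mul' (a k i)
      rw [Finset.sum_neg_distrib, ← Finset.mul_sum]
      push_cast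
      rw [← this]
      ring
    have e2 : ∀ j, 2 * (-((starRingEnd ℂ) (a k i) * Complex.I * (k j * Nl Λ a b k j i))).re ≤
        ε * ((k j : ℝ) ^ 2 * ‖a k i‖ ^ 2) + ε⁻¹ * ‖Nl Λ a b k j i‖ ^ 2 := by
      intro j
      have h5 := Complex.re_le_norm (-((starRingEnd ℂ) (a k i) * Complex.I * (k j * Nl Λ a b k j i)))
      have h6 : ‖-((starRingEnd ℂ) (a k i) * Complex.I * (k j * Nl Λ a b k j i))‖ =
          (|(k j : ℝ)| * ‖a k i‖) * ‖Nl Λ a b k j i‖ := by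
        have : ‖(k j : ℂ)‖ = |(k j : ℝ)| := by
          rw [Complex.norm_intCast]
        rw [norm_neg, norm_mul, norm_mul, norm_mul, this, RCLike.norm_conj, Complex.norm_I]
        ring
      rw [h6] at h5
      have h7 : ε * ((k j : ℝ) ^ 2 * ‖a k i‖ ^ 2) = ε * (|(k j : ℝ)| * ‖a k i‖) ^ 2 := by
        rw [mul_pow, sq_abs]
      rw [h7]
      set X := |(k j : ℝ)| * ‖a k i‖
      set Y := ‖Nl Λ a b k j i‖
      have h8 : 0 ≤ ε⁻¹ * (ε * X - Y) ^ 2 := by positivity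
      have h9 : ε⁻¹ * (ε * X - Y) ^ 2 = ε * X ^ 2 + ε⁻¹ * Y ^ 2 - 2 * (X * Y) := by
        field_simp
        ring
      linarith
    rw [e1, Complex.add_re, Complex.ofReal_re, Complex.re_sum, mul_add]
    have e3 := Finset.sum_le_sum fun j (_ : j ∈ Finset.univ) => e2 j
    simp only [Finset.sum_add_distrib, ← Finset.mul_sum, ← Finset.sum_mul, ← hq] at e3
    linarith
  refine (Finset.sum_le_sum fun i _ => h3 i).trans (le_of_eq ?_)
  rw [Finset.sum_add_distrib, ← Finset.mul_sum, ← Finset.mul_sum, ← Finset.mul_sum, Finset.sum_comm]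

/-- The rate of change of the homogeneous energy along the untruncated field. -/
def dEn (ν : ℝ) (Λ : Finset K3) (m : ℕ) (a b : K3 → Fin 3 → ℂ) : ℝ :=
  ∑ k ∈ Λ, q k ^ m * ∑ i, 2 * ((starRingEnd ℂ) (a k i) * Fld ν Λ a b k i).re

lemma En_eq (Λ : Finset K3) (m : ℕ) (a : K3 → Fin 3 → ℂ) :
    En Λ m a = ∑ k ∈ Λ, q k ^ m * ∑ i, ‖a k i‖ ^ 2 := by
  simp only [En, SE, Finset.mul_sum]
  exact Finset.sum_comm

lemma En_mono {Λ : Finset K3} (h0 : (0 : K3) ∉ Λ) {m n : ℕ} (h : m ≤ n) (a : K3 → Fin 3 → ℂ) :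
    En Λ m a ≤ En Λ n a := by
  rw [En_eq, En_eq]
  refine Finset.sum_le_sum fun k hk => ?_
  have := one_le_q (k := k) fun h => h0 (h ▸ hk)
  gcongr

lemma hasDerivWithinAt_En {Λ : Finset K3} {ν χ t : ℝ} {a : ℝ → K3 → Fin 3 → ℂ}
    {b : K3 → Fin 3 → ℂ} {S : Set ℝ}
    (h : ∀ k ∈ Λ, ∀ i, HasDerivWithinAt (fun t => a t k i) (χ * Fld ν Λ (a t) b k i) S t) (m : ℕ) :
    HasDerivWithinAt (fun t => En Λ m (a t)) (χ * dEn ν Λ m (a t) b) S t := by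
  simp only [En_eq]
  unfold dEn
  rw [Finset.mul_sum]
  refine HasDerivWithinAt.fun_sum fun k hk => ?_
  rw [mul_left_comm]
  refine HasDerivWithinAt.const_mul _ ?_
  rw [Finset.mul_sum]
  refine HasDerivWithinAt.fun_sum fun i _ => ?_
  have h1 := (h k hk i).norm_sq
  refine h1.congr_deriv ?_
  rw [Complex.inner, mul_left_comm, mul_assoc, Complex.re_ofReal_mul,
    mul_comm (Fld _ _ _ _ _ _)]

lemma dEn_le (ν : ℝ) (Λ : Finset K3) (a b : K3 → Fin 3 → ℂ)
    (h : ∀ k, ∑ j, (k j : ℂ) * a k j = 0) {ε : ℝ} (hε : 0 < ε) (m : ℕ) :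
    dEn ν Λ m a b ≤ (-2 * ν + ε) * En Λ (m + 1) a +
      ε⁻¹ * ∑ j, ∑ i, SE Λ m fun k => Nl Λ a b k j i := by
  have h1 : dEn ν Λ m a b ≤ ∑ k ∈ Λ, q k ^ m * ((-2 * ν + ε) * (q k * ∑ i, ‖a k i‖ ^ 2) +
      ε⁻¹ * ∑ j, ∑ i, ‖Nl Λ a b k j i‖ ^ 2) :=
    Finset.sum_le_sum fun k _ => mul_le_mul_of_nonneg_left (Fld_re ν Λ a b k (h k) hε)
      (pow_nonneg (q_nonneg k) m)
  refine h1.trans (le_of_eq ?_)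
  simp only [mul_add, Finset.sum_add_distrib]
  congr 1
  · rw [En_eq, Finset.mul_sum]
    exact Finset.sum_congr rfl fun k _ => by ring
  · simp only [SE, Finset.mul_sum]
    rw [Finset.sum_comm]
    refine Finset.sum_congr rfl fun j _ => ?_
    rw [Finset.sum_comm]
    exact Finset.sum_congr rfl fun i _ => Finset.sum_congr rfl fun k _ => by ring

lemma SE_add3_le (Λ : Finset K3) (m : ℕ) (f g h : K3 → ℂ) :
    SE Λ m (fun k => f k + g k + h k) ≤ 3 * (SE Λ m f + SE Λ m g + SE Λ m h) := by
  simp only [SE]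
  rw [← Finset.sum_add_distrib, ← Finset.sum_add_distrib, Finset.mul_sum]
  refine Finset.sum_le_sum fun k _ => ?_
  have h1 : ‖f k + g k + h k‖ ≤ ‖f k‖ + ‖g k‖ + ‖h k‖ := norm_add₃_le
  have h2 : ‖f k + g k + h k‖ ^ 2 ≤ 3 * (‖f k‖ ^ 2 + ‖g k‖ ^ 2 + ‖h k‖ ^ 2) := by
    refine (pow_le_pow_left₀ (norm_nonneg _) h1 2).trans ?_
    nlinarith [sq_nonneg (‖f k‖ - ‖g k‖), sq_nonneg (‖f k‖ - ‖h k‖), sq_nonneg (‖g k‖ - ‖h k‖)]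
  calc q k ^ m * ‖f k + g k + h k‖ ^ 2 ≤
      q k ^ m * (3 * (‖f k‖ ^ 2 + ‖g k‖ ^ 2 + ‖h k‖ ^ 2)) :=
        mul_le_mul_of_nonneg_left h2 (pow_nonneg (q_nonneg k) m)
    _ = _ := by ring

lemma Nl_le (Λ : Finset K3) {w : E3 → E3} (hw : ∀ i, ContDiff ℝ (⊤ : ℕ∞) fun x => w x i)
    (hp : ∀ i, SpacePeriodic fun x => w x i) {W : ℕ → ℝ}
    (hW : ∀ i β x, |pdM β (fun x => w x i) x| ≤ W (∑ j, β j)) (a : K3 → Fin 3 → ℂ) (m : ℕ) :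
    ∑ j, ∑ i, SE Λ m (fun k => Nl Λ a (fun k i => fc (fun x => w x i) k) k j i) ≤
      3 * ∑ j, ∑ i, SE Λ m (fun k => ∑ l ∈ Λ, a l j * a (k - l) i) +
        18 * 12 ^ m * ∑ j ∈ Finset.range (m + 1), W (m - j) ^ 2 * En Λ j a := by
  set R : Fin 3 → ℝ := fun i => 12 ^ m * ∑ j ∈ Finset.range (m + 1),
    W (m - j) ^ 2 * SE Λ j (fun k => a k i) with hR
  have h1 : ∀ j i, SE Λ m (fun k => Nl Λ a (fun k i => fc (fun x => w x i) k) k j i) ≤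
      3 * SE Λ m (fun k => ∑ l ∈ Λ, a l j * a (k - l) i) + (3 * R i + 3 * R j) := fun j i => by
    refine (SE_add3_le Λ m _ _ _).trans ?_
    have h2 := conv_field Λ (hw j) (hp j) (hW j) (fun k => a k i) m
    have h3 := conv_field Λ (hw i) (hp i) (hW i) (fun k => a k j) m
    linarith
  refine (Finset.sum_le_sum fun j _ => Finset.sum_le_sum fun i _ => h1 j i).trans (le_of_eq ?_)
  have h4 : ∑ i, R i = 12 ^ m * ∑ j ∈ Finset.range (m + 1), W (m - j) ^ 2 * En Λ j a := by
    simp only [hR, En]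
    rw [← Finset.mul_sum, Finset.sum_comm]
    simp only [Finset.mul_sum]
  simp only [Finset.sum_add_distrib, ← Finset.mul_sum, Finset.sum_const, Finset.card_univ,
    Fintype.card_fin, nsmul_eq_mul]
  rw [mul_assoc 18, ← h4]
  push_cast
  ring

lemma self_le_low {Λ : Finset K3} (h0 : (0 : K3) ∉ Λ) {a : K3 → Fin 3 → ℂ}
    (ha : ∀ k ∉ Λ, ∀ i, a k i = 0) (m : ℕ) :
    ∑ j, ∑ i, SE Λ m (fun k => ∑ l ∈ Λ, a l j * a (k - l) i) ≤
      4 ^ m * (16 * SJ) * (En Λ (m + 1) a * En Λ 1 a) := by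
  refine (Finset.sum_le_sum fun j _ => Finset.sum_le_sum fun i _ =>
    conv_low Λ h0 (fun k => a k j) (fun k => a k i) (fun k hk => ha k hk i) m).trans (le_of_eq ?_)
  simp only [← Finset.mul_sum, Finset.sum_add_distrib, ← Finset.sum_mul, En]
  ring

lemma self_le_high {Λ : Finset K3} (h0 : (0 : K3) ∉ Λ) {a : K3 → Fin 3 → ℂ}
    (ha : ∀ k ∉ Λ, ∀ i, a k i = 0) (m : ℕ) :
    ∑ j, ∑ i, SE Λ m (fun k => ∑ l ∈ Λ, a l j * a (k - l) i) ≤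
      4 ^ m * (16 * SJ) * (En Λ m a * En Λ 2 a) := by
  refine (Finset.sum_le_sum fun j _ => Finset.sum_le_sum fun i _ =>
    conv_high Λ h0 (fun k => a k j) (fun k => a k i) (fun k hk => ha k hk i) m).trans (le_of_eq ?_)
  simp only [← Finset.mul_sum, Finset.sum_add_distrib, ← Finset.sum_mul, En]
  ring

/-! ### Grönwall inequalities -/

lemma gronwall {T : ℝ} {y y' c h : ℝ → ℝ} (hc : Continuous c) (hh : Continuous h)
    (hc0 : ∀ t, 0 ≤ c t) (hh0 : ∀ t, 0 ≤ h t)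
    (hy : ∀ t ∈ Icc 0 T, HasDerivWithinAt y (y' t) (Icc 0 T) t)
    (hle : ∀ t ∈ Icc 0 T, y' t ≤ c t * y t + h t) :
    ∀ t ∈ Icc 0 T, y t ≤ exp (∫ τ in (0:ℝ)..t, c τ) * (y 0 + ∫ τ in (0:ℝ)..t, h τ) := by
  intro t ht
  have hC : ∀ t, HasDerivAt (fun t => ∫ τ in (0:ℝ)..t, c τ) (c t) t := fun t =>
    hc.integral_hasStrictDerivAt 0 t |>.hasDerivAt
  have hH : ∀ t, HasDerivAt (fun t => ∫ τ in (0:ℝ)..t, h τ) (h t) t := fun t =>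
    hh.integral_hasStrictDerivAt 0 t |>.hasDerivAt
  have hz : ∀ t ∈ Icc 0 T, HasDerivWithinAt
      (fun t => y t * exp (-∫ τ in (0:ℝ)..t, c τ) - ∫ τ in (0:ℝ)..t, h τ)
      (y' t * exp (-∫ τ in (0:ℝ)..t, c τ) + y t * (exp (-∫ τ in (0:ℝ)..t, c τ) * -c t) - h t)
      (Icc 0 T) t := fun t ht =>
    ((hy t ht).mul (hC t).neg.exp.hasDerivWithinAt).sub (hH t).hasDerivWithinAt
  have hanti := antitoneOn_of_hasDerivWithinAt_nonpos (convex_Icc 0 T)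
    (fun t ht => (hz t ht).continuousWithinAt)
    (fun t ht => (hz t (interior_subset ht)).mono interior_subset) fun t ht => by
      have ht' := interior_subset ht
      have h1 := hle t ht'
      have h2 : exp (-∫ τ in (0:ℝ)..t, c τ) ≤ 1 := by
        refine Real.exp_le_one_iff.2 (neg_nonpos.2 ?_)
        exact intervalIntegral.integral_nonneg ht'.1 fun τ _ => hc0 τ
      have h3 := Real.exp_pos (-∫ τ in (0:ℝ)..t, c τ)
      have h4 := mul_le_mul_of_nonneg_right h1 h3.le
      have h5 := mul_le_of_le_one_right (hh0 t) h2
      nlinarith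
  have h1 := hanti ⟨le_rfl, ht.1.trans ht.2⟩ ht ht.1
  simp only [intervalIntegral.integral_same, neg_zero, Real.exp_zero, mul_one, sub_zero] at h1
  rw [Real.exp_neg] at h1
  have h3 := Real.exp_pos (∫ τ in (0:ℝ)..t, c τ)
  have h6 : y t * (exp (∫ τ in (0:ℝ)..t, c τ))⁻¹ ≤ y 0 + ∫ τ in (0:ℝ)..t, h τ := by linarith
  rwa [← div_eq_mul_inv, div_le_iff₀' h3] at h6

/-- The recursion defining the quantities `Q`. -/
def IsQ (W Qs : ℕ → ℝ → ℝ) : Prop := ∀ m t, 0 ≤ t →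
  Qs m t = 1 + ∑ j ∈ Finset.range m, Qs j t * ∫ τ in (0:ℝ)..t, W (m - j) τ ^ 2

lemma integral_sq_nonneg {f : ℝ → ℝ} {t : ℝ} (ht : 0 ≤ t) : 0 ≤ ∫ τ in (0:ℝ)..t, f τ ^ 2 :=
  intervalIntegral.integral_nonneg ht fun _ _ => sq_nonneg _

lemma IsQ.one_le {W Qs : ℕ → ℝ → ℝ} (h : IsQ W Qs) (m : ℕ) {t : ℝ} (ht : 0 ≤ t) :
    1 ≤ Qs m t := by
  induction m using Nat.strong_induction_on with
  | _ m ih =>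
    rw [h m t ht, le_add_iff_nonneg_right]
    exact Finset.sum_nonneg fun j hj => mul_nonneg
      (zero_le_one.trans (ih j (Finset.mem_range.1 hj))) (integral_sq_nonneg ht)

lemma integral_sq_mono {f : ℝ → ℝ} (hf : Continuous f) {s t : ℝ} (hs : 0 ≤ s) (hst : s ≤ t) :
    ∫ τ in (0:ℝ)..s, f τ ^ 2 ≤ ∫ τ in (0:ℝ)..t, f τ ^ 2 :=
  intervalIntegral.integral_mono_interval le_rfl hs hst
    (Filter.Eventually.of_forall fun _ => sq_nonneg _) ((hf.pow 2).intervalIntegrable _ _)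

lemma IsQ.mono {W Qs : ℕ → ℝ → ℝ} (h : IsQ W Qs) (hW : ∀ m, Continuous (W m)) (m : ℕ) {s t : ℝ}
    (hs : 0 ≤ s) (hst : s ≤ t) : Qs m s ≤ Qs m t := by
  induction m using Nat.strong_induction_on with
  | _ m ih =>
    rw [h m t (hs.trans hst), h m s hs, add_le_add_iff_left]
    refine Finset.sum_le_sum fun j hj => mul_le_mul (ih j (Finset.mem_range.1 hj))
      (integral_sq_mono (hW _) hs hst) (integral_sq_nonneg hs)
      (zero_le_one.trans (h.one_le j (hs.trans hst)))

lemma gronwall_system {K : ℝ} (hK : 0 ≤ K) (M : ℕ) : ∃ C : ℝ, 1 ≤ C ∧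
    ∀ (T : ℝ) (W Qs y y' : ℕ → ℝ → ℝ), (∀ m, Continuous (W m)) → IsQ W Qs →
      (∀ m ≤ M, ∀ t ∈ Icc 0 T, HasDerivWithinAt (y m) (y' m t) (Icc 0 T) t) →
      (∀ m ≤ M, ∀ t ∈ Icc 0 T, 0 ≤ y m t) → (∀ m ≤ M, ∀ j ≤ m, y j 0 ≤ y m 0) →
      (∀ m ≤ M, ∀ t ∈ Icc 0 T,
        y' m t ≤ K * ∑ j ∈ Finset.range (m + 1), W (m - j) t ^ 2 * y j t) →
      ∀ m ≤ M, ∀ t ∈ Icc 0 T,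
        y m t ≤ C * Qs m t * exp (C * ∫ τ in (0:ℝ)..t, W 0 τ ^ 2) * y m 0 := by
  have main : ∀ N : ℕ, ∃ C : ℝ, 1 ≤ C ∧
    ∀ (T : ℝ) (W Qs y y' : ℕ → ℝ → ℝ), (∀ m, Continuous (W m)) → IsQ W Qs →
      (∀ m ≤ M, ∀ t ∈ Icc 0 T, HasDerivWithinAt (y m) (y' m t) (Icc 0 T) t) →
      (∀ m ≤ M, ∀ t ∈ Icc 0 T, 0 ≤ y m t) → (∀ m ≤ M, ∀ j ≤ m, y j 0 ≤ y m 0) →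
      (∀ m ≤ M, ∀ t ∈ Icc 0 T,
        y' m t ≤ K * ∑ j ∈ Finset.range (m + 1), W (m - j) t ^ 2 * y j t) →
      ∀ m < N, m ≤ M → ∀ t ∈ Icc 0 T,
        y m t ≤ C * Qs m t * exp (C * ∫ τ in (0:ℝ)..t, W 0 τ ^ 2) * y m 0 := by
    intro N
    induction N with
    | zero => exact ⟨1, le_rfl, by intros; omega⟩
    | succ N ih =>
      obtain ⟨C, hC1, hC⟩ := ih
      have hC0 : 0 ≤ C := zero_le_one.trans hC1
      refine ⟨(1 + K) * (1 + C), by nlinarith, ?_⟩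
      intro T W Qs y y' hW hQ hy hy0 hmono hle m hm hmM t ht
      have hIH := hC T W Qs y y' hW hQ hy hy0 hmono hle
      have h0t : (0:ℝ) ∈ Icc 0 T := ⟨le_rfl, ht.1.trans ht.2⟩
      have hym := hy0 m hmM 0 h0t
      have hQ1 := hQ.one_le m ht.1
      set Φ := ∫ τ in (0:ℝ)..t, W 0 τ ^ 2 with hΦ
      have hΦ0 : 0 ≤ Φ := integral_sq_nonneg ht.1
      rcases Nat.lt_succ_iff_lt_or_eq.1 hm with hm' | rfl
      · refine (hIH m hm' hmM t ht).trans ?_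
        have : C ≤ (1 + K) * (1 + C) := by nlinarith
        gcongr
      · set h : ℝ → ℝ := fun τ => ∑ j ∈ Finset.range m,
          (K * C * exp (C * Φ) * y m 0) * (Qs j t * W (m - j) τ ^ 2) with hh
        have hsub : ∀ τ ∈ Icc 0 t, τ ∈ Icc 0 T := fun τ hτ => ⟨hτ.1, hτ.2.trans ht.2⟩
        have hg := gronwall (T := t) (y := y m) (y' := y' m) (c := fun τ => K * W 0 τ ^ 2) (h := h)
          (by have := hW 0; fun_prop)
          (continuous_finsetSum _ fun j _ => by have := hW (m - j); fun_prop)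
          (fun τ => by positivity)
          (fun τ => Finset.sum_nonneg fun j _ => by
            have := hQ.one_le j ht.1
            positivity)
          (fun τ hτ => (hy m hmM τ (hsub τ hτ)).mono (Icc_subset_Icc_right ht.2))
          (fun τ hτ => by
            refine (hle m hmM τ (hsub τ hτ)).trans ?_
            rw [Finset.sum_range_succ, Nat.sub_self, mul_add, add_comm]
            refine add_le_add (le_of_eq (by ring)) ?_
            rw [hh, Finset.mul_sum]
            refine Finset.sum_le_sum fun j hj => ?_
            have hjm := Finset.mem_range.1 hj
            have h1 := hIH j hjm (hjm.le.trans hmM) τ (hsub τ hτ)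
            have h2 : y j τ ≤ C * Qs j t * exp (C * Φ) * y m 0 := by
              refine h1.trans ?_
              have := hQ.mono hW j hτ.1 hτ.2
              have := hmono m hmM j hjm.le
              have := integral_sq_mono (hW 0) hτ.1 hτ.2
              have := hQ.one_le j hτ.1
              have := hQ.one_le j ht.1
              have := hy0 j (hjm.le.trans hmM) 0 h0t
              gcongr
            calc K * (W (m - j) τ ^ 2 * y j τ)
                ≤ K * (W (m - j) τ ^ 2 * (C * Qs j t * exp (C * Φ) * y m 0)) := by gcongr
              _ = _ := by ring)
          t ⟨ht.1, le_rfl⟩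
        refine hg.trans ?_
        have e1 : ∫ τ in (0:ℝ)..t, K * W 0 τ ^ 2 = K * Φ := by
          rw [intervalIntegral.integral_const_mul]
        have e2 : ∫ τ in (0:ℝ)..t, h τ = (K * C * exp (C * Φ) * y m 0) * (Qs m t - 1) := by
          rw [hQ m t ht.1, hh, intervalIntegral.integral_finsetSum fun j _ =>
            Continuous.intervalIntegrable (by have := hW (m - j); fun_prop) _ _, add_sub_cancel_left,
            Finset.mul_sum]
          simp only [intervalIntegral.integral_const_mul]
        rw [e1, e2]
        have hE : 1 ≤ exp (C * Φ) := Real.one_le_exp (by positivity)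
        calc exp (K * Φ) * (y m 0 + K * C * exp (C * Φ) * y m 0 * (Qs m t - 1))
            ≤ exp (K * Φ) * (exp (C * Φ) * y m 0 * Qs m t + K * C * exp (C * Φ) * y m 0 * Qs m t) := by
              have h1 : y m 0 ≤ exp (C * Φ) * y m 0 * Qs m t := by
                calc y m 0 = 1 * y m 0 * 1 := by ring
                  _ ≤ exp (C * Φ) * y m 0 * Qs m t := by gcongr
              have h2 : K * C * exp (C * Φ) * y m 0 * (Qs m t - 1) ≤
                  K * C * exp (C * Φ) * y m 0 * Qs m t := by gcongr; linarith
              gcongr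
          _ = (1 + K * C) * Qs m t * exp ((K + C) * Φ) * y m 0 := by
              rw [add_mul K C Φ, Real.exp_add]
              ring
          _ ≤ _ := by
              have h1 : 1 + K * C ≤ (1 + K) * (1 + C) := by nlinarith
              have h2 : K + C ≤ (1 + K) * (1 + C) := by nlinarith
              gcongr
  obtain ⟨C, h1, h2⟩ := main (M + 1)
  exact ⟨C, h1, fun T W Qs y y' a b c d e f m hm => h2 T W Qs y y' a b c d e f m (by omega) hm⟩

/-! ### A priori bounds for the Galerkin solutions -/

/-- Fourier coefficients of a time-dependent vector field. -/
def bw (w : E3 → ℝ → E3) (t : ℝ) (k : K3) (i : Fin 3) : ℂ := fc (fun x => w x t i) k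

/-- A background field together with majorants of its derivatives. -/
structure Bg (w : E3 → ℝ → E3) (W : ℕ → ℝ → ℝ) : Prop where
  smooth : ∀ t, 0 ≤ t → ∀ i, ContDiff ℝ (⊤ : ℕ∞) fun x => w x t i
  per : ∀ t i, SpacePeriodic fun x => w x t i
  bound : ∀ t, 0 ≤ t → ∀ i β x, |pdM β (fun x => w x t i) x| ≤ W (∑ j, β j) t
  cont : ∀ m, Continuous (W m)
  coeff : ∀ k i, ContinuousOn (fun t => bw w t k i) (Ici 0)

lemma bw_neg (w : E3 → ℝ → E3) (t : ℝ) (k : K3) (i : Fin 3) :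
    bw w t (-k) i = (starRingEnd ℂ) (bw w t k i) := fc_neg _ _

lemma Bg.dEn_low {w : E3 → ℝ → E3} {W : ℕ → ℝ → ℝ} (hB : Bg w W) {t : ℝ} (ht : 0 ≤ t)
    {Λ : Finset K3} (h0 : (0 : K3) ∉ Λ) {a : K3 → Fin 3 → ℂ} (ha : ∀ k ∉ Λ, ∀ i, a k i = 0)
    (hd : ∀ k, ∑ j, (k j : ℂ) * a k j = 0) {ν σ ε δ : ℝ} (hν : 0 < ν) (hσ : 0 < σ)
    (hε : ε = ν * (1 - σ)) (hε0 : 0 < ε) {M : ℕ} (hδ : 96 * 4 ^ M * SJ * δ ≤ ε ^ 2)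
    (hE : En Λ 1 a ≤ 2 * δ) {m : ℕ} (hm : m ≤ M) :
    dEn ν Λ m a (bw w t) ≤ -(2 * ν * σ) * En Λ m a +
      ε⁻¹ * (18 * 12 ^ M) * ∑ j ∈ Finset.range (m + 1), W (m - j) t ^ 2 * En Λ j a := by
  have h1 := dEn_le ν Λ a (bw w t) hd hε0 m
  have h2 := Nl_le Λ (W := fun m => W m t) (hB.smooth t ht) (hB.per t) (hB.bound t ht) a m
  have h3 := self_le_low h0 ha m
  have hSJ := SJ_nonneg
  set S := ∑ j ∈ Finset.range (m + 1), W (m - j) t ^ 2 * En Λ j a with hS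
  have hS0 : 0 ≤ S := Finset.sum_nonneg fun j _ => mul_nonneg (sq_nonneg _) (En_nonneg _ _ _)
  have hE1 := En_nonneg Λ (m + 1) a
  have h4 : 3 * (4 ^ m * (16 * SJ) * (En Λ (m + 1) a * En Λ 1 a)) ≤ ε ^ 2 * En Λ (m + 1) a := by
    calc 3 * (4 ^ m * (16 * SJ) * (En Λ (m + 1) a * En Λ 1 a))
        ≤ 3 * (4 ^ M * (16 * SJ) * (En Λ (m + 1) a * (2 * δ))) := by
          have : (4:ℝ) ^ m ≤ 4 ^ M := pow_le_pow_right₀ (by norm_num) hm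
          have := En_nonneg Λ 1 a
          gcongr
      _ = 96 * 4 ^ M * SJ * δ * En Λ (m + 1) a := by ring
      _ ≤ _ := by gcongr
  have h5 : 18 * 12 ^ m * S ≤ 18 * 12 ^ M * S := by
    have : (12:ℝ) ^ m ≤ 12 ^ M := pow_le_pow_right₀ (by norm_num) hm
    gcongr
  have h6 : ε⁻¹ * ∑ j, ∑ i, SE Λ m (fun k => Nl Λ a (bw w t) k j i) ≤
      ε⁻¹ * (ε ^ 2 * En Λ (m + 1) a + 18 * 12 ^ M * S) := by
    refine mul_le_mul_of_nonneg_left ?_ (inv_nonneg.2 hε0.le)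
    refine h2.trans ?_
    linarith
  have h7 : ε⁻¹ * (ε ^ 2 * En Λ (m + 1) a + 18 * 12 ^ M * S) =
      ε * En Λ (m + 1) a + ε⁻¹ * (18 * 12 ^ M) * S := by
    field_simp
  have h8 := En_mono h0 (Nat.le_succ m) a
  have h9 : 2 * ν * σ * En Λ m a ≤ 2 * ν * σ * En Λ (m + 1) a := by gcongr
  have h10 : (-2 * ν + ε) * En Λ (m + 1) a + ε * En Λ (m + 1) a =
      -(2 * ν * σ * En Λ (m + 1) a) := by
    rw [hε]
    ring
  linarith

lemma Bg.dEn_high {w : E3 → ℝ → E3} {W : ℕ → ℝ → ℝ} (hB : Bg w W) {t : ℝ} (ht : 0 ≤ t)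
    {Λ : Finset K3} (h0 : (0 : K3) ∉ Λ) {a : K3 → Fin 3 → ℂ} (ha : ∀ k ∉ Λ, ∀ i, a k i = 0)
    (hd : ∀ k, ∑ j, (k j : ℂ) * a k j = 0) {ν : ℝ} (hν : 0 < ν) (m : ℕ) :
    dEn ν Λ m a (bw w t) ≤ (2 * ν)⁻¹ * (48 * 4 ^ m * SJ + 18 * 12 ^ m) *
      (En Λ 2 a + ∑ j ∈ Finset.range (m + 1), W (m - j) t ^ 2) * En Λ m a := by
  have hν2 : 0 < 2 * ν := by positivity
  have h1 := dEn_le ν Λ a (bw w t) hd hν2 m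
  have h2 := Nl_le Λ (W := fun m => W m t) (hB.smooth t ht) (hB.per t) (hB.bound t ht) a m
  have h3 := self_le_high h0 ha m
  have hSJ := SJ_nonneg
  have hm0 := En_nonneg Λ m a
  have h20 := En_nonneg Λ 2 a
  set S := ∑ j ∈ Finset.range (m + 1), W (m - j) t ^ 2 with hS
  have hS0 : 0 ≤ S := Finset.sum_nonneg fun j _ => sq_nonneg _
  have h4 : ∑ j ∈ Finset.range (m + 1), W (m - j) t ^ 2 * En Λ j a ≤ S * En Λ m a := by
    rw [hS, Finset.sum_mul]
    refine Finset.sum_le_sum fun j hj => ?_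
    have := En_mono h0 (Nat.lt_succ_iff.1 (Finset.mem_range.1 hj)) a
    gcongr
  have h5 : 18 * 12 ^ m * ∑ j ∈ Finset.range (m + 1), W (m - j) t ^ 2 * En Λ j a ≤
      18 * 12 ^ m * (S * En Λ m a) := by gcongr
  have h6 : ∑ j, ∑ i, SE Λ m (fun k => Nl Λ a (bw w t) k j i) ≤
      (48 * 4 ^ m * SJ + 18 * 12 ^ m) * (En Λ 2 a + S) * En Λ m a := by
    refine h2.trans ?_
    have e1 : 0 ≤ 48 * 4 ^ m * SJ * (S * En Λ m a) := by positivity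
    have e2 : 0 ≤ (18:ℝ) * 12 ^ m * (En Λ 2 a * En Λ m a) := by positivity
    linarith
  have h7 := mul_le_mul_of_nonneg_left h6 (inv_nonneg.2 hν2.le)
  have h8 : (-2 * ν + 2 * ν) * En Λ (m + 1) a = 0 := by ring
  linarith

lemma sum_mul_Pr {k : K3} (hk : k ≠ 0) (z : Fin 3 → ℂ) : ∑ i, (k i : ℂ) * Pr k z i = 0 := by
  have hq : (q k : ℂ) ≠ 0 := by
    exact_mod_cast (lt_of_lt_of_le one_pos (one_le_q hk)).ne'
  have hq' : (q k : ℂ) = ∑ j, (k j : ℂ) ^ 2 := by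
    simp only [q]
    push_cast
    rfl
  simp only [Pr, mul_sub, Finset.sum_sub_distrib]
  have : ∀ i, (k i : ℂ) * (k i * (∑ j, k j * z j) / q k) =
      (k i : ℂ) ^ 2 * ((∑ j, k j * z j) / q k) := fun i => by ring
  rw [Finset.sum_congr rfl fun i _ => this i, ← Finset.sum_mul, ← hq', mul_div_cancel₀ _ hq, sub_self]

lemma galerkin_div {Λ : Finset K3} (h0 : (0 : K3) ∉ Λ) {ν T : ℝ} {χ : ℝ → ℝ}
    {a b : ℝ → K3 → Fin 3 → ℂ} (ha : ∀ t, ∀ k ∉ Λ, ∀ i, a t k i = 0)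
    (hd : ∀ t ∈ Icc 0 T, ∀ k ∈ Λ, ∀ i, HasDerivWithinAt (fun t => a t k i)
        (χ t * Fld ν Λ (a t) (b t) k i) (Icc 0 T) t)
    (hz : ∀ k ∈ Λ, ∑ j, (k j : ℂ) * a 0 k j = 0) {t : ℝ} (ht : t ∈ Icc 0 T) (k : K3) :
    ∑ j, (k j : ℂ) * a t k j = 0 := by
  by_cases hk : k ∈ Λ
  · have h1 : ∀ s ∈ Icc 0 T, HasDerivWithinAt (fun s => ∑ j, (k j : ℂ) * a s k j) 0 (Icc 0 T) s := by
      intro s hs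
      have h2 : HasDerivWithinAt (fun s => ∑ j, (k j : ℂ) * a s k j)
          (∑ j, (k j : ℂ) * (χ s * Fld ν Λ (a s) (b s) k j)) (Icc 0 T) s :=
        HasDerivWithinAt.fun_sum fun j _ => (hd s hs k hk j).const_mul _
      refine h2.congr_deriv ?_
      simp only [mul_left_comm _ (χ s : ℂ), ← Finset.mul_sum]
      unfold Fld
      rw [sum_mul_Pr (fun h => h0 (h ▸ hk)), mul_zero]
    have h3 := (convex_Icc 0 T).norm_image_sub_le_of_norm_hasDerivWithin_le h1
      (fun s _ => norm_zero.le) ⟨le_rfl, ht.1.trans ht.2⟩ ht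
    rw [zero_mul, hz k hk, sub_zero] at h3
    exact norm_le_zero_iff.1 h3
  · simp [ha t k hk]

/-- The growth constants for the higher energies. -/
def KH (ν : ℝ) (m : ℕ) : ℝ := (2 * ν)⁻¹ * (48 * 4 ^ m * SJ + 18 * 12 ^ m)

/-- Galerkin solutions with energy bounds uniform in the truncation. -/
theorem galerkin_bounds {r : ℕ} (hr : 1 ≤ r) {σ ν : ℝ} (hσ0 : 0 < σ) (hσ1 : σ < 1) (hν : 0 < ν) :
    ∃ C δ : ℝ, 1 ≤ C ∧ 0 < δ ∧ ∀ (w : E3 → ℝ → E3) (W Qs : ℕ → ℝ → ℝ), Bg w W → IsQ W Qs →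
      ∀ (T : ℝ), 0 ≤ T → ∀ Λ : Finset K3, (0 : K3) ∉ Λ → (∀ k ∈ Λ, -k ∈ Λ) →
      ∀ a0 : K3 → Fin 3 → ℂ, (∀ k i, a0 (-k) i = (starRingEnd ℂ) (a0 k i)) →
      (∀ k, ∑ j, (k j : ℂ) * a0 k j = 0) →
      C * Qs r T * exp (C * ∫ τ in (0:ℝ)..T, W 0 τ ^ 2) * En Λ r a0 ≤ δ →
      ∃ a : ℝ → K3 → Fin 3 → ℂ, (∀ t, ∀ k ∉ Λ, ∀ i, a t k i = 0) ∧
        (∀ k ∈ Λ, ∀ i, a 0 k i = a0 k i) ∧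
        (∀ t ∈ Icc 0 T, ∀ k ∈ Λ, ∀ i,
          HasDerivWithinAt (fun t => a t k i) (Fld ν Λ (a t) (bw w t) k i) (Icc 0 T) t) ∧
        (∀ t ∈ Icc 0 T, ∀ k i, a t (-k) i = (starRingEnd ℂ) (a t k i)) ∧
        (∀ t ∈ Icc 0 T, ∀ k, ∑ j, (k j : ℂ) * a t k j = 0) ∧
        (∀ m ≤ r, ∀ t ∈ Icc 0 T, En Λ m (a t) ≤
          C * Qs m t * exp (C * ∫ τ in (0:ℝ)..t, W 0 τ ^ 2) * En Λ m a0 * exp (-(2 * ν * σ * t))) ∧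
        ∀ m, ∀ S ∈ Icc 0 T, ∀ t ∈ Icc 0 S, En Λ m (a t) ≤ exp (∫ τ in (0:ℝ)..t, KH ν m *
          (C * Qs 2 S * exp (C * ∫ τ in (0:ℝ)..S, W 0 τ ^ 2) * En Λ 2 a0 +
            ∑ j ∈ Finset.range (m + 1), W (m - j) τ ^ 2)) * En Λ m a0 := by
  set ε := ν * (1 - σ) with hε
  have hε0 : 0 < ε := mul_pos hν (by linarith)
  set M := max r 2 with hM
  have hrM : r ≤ M := le_max_left _ _
  have h2M : 2 ≤ M := le_max_right _ _
  set K := ε⁻¹ * (18 * 12 ^ M) with hK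
  have hK0 : 0 ≤ K := by positivity
  have hSJ := SJ_nonneg
  obtain ⟨C, hC1, hC⟩ := gronwall_system hK0 M
  set δ := ε ^ 2 / (96 * 4 ^ M * SJ + 1) with hδdef
  have hden : 0 < 96 * 4 ^ M * SJ + 1 := by positivity
  have hδ0 : 0 < δ := by positivity
  have hδ : 96 * 4 ^ M * SJ * δ ≤ ε ^ 2 := by
    have : (96 * 4 ^ M * SJ + 1) * δ = ε ^ 2 := by
      rw [hδdef]
      field_simp
    linarith
  refine ⟨C, δ, hC1, hδ0, ?_⟩
  intro w W Qs hB hQ T hT Λ h0 hΛ a0 ha0 hdiv0 hsmall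
  obtain ⟨a, haz, ha0', had, has⟩ := galerkin h0 hΛ ν hδ0 hT (b := bw w)
    (fun k i => (hB.coeff k i).mono fun t ht => ht.1) (bw_neg w) ha0
  have hdiv : ∀ t ∈ Icc 0 T, ∀ k, ∑ j, (k j : ℂ) * a t k j = 0 := fun t ht k =>
    galerkin_div h0 haz had (fun k hk => by
      rw [← hdiv0 k]
      exact Finset.sum_congr rfl fun j _ => by rw [ha0' k hk]) ht k
  have hE0 : ∀ m, En Λ m (a 0) = En Λ m a0 := fun m => En_congr ha0' m
  have h0T : (0:ℝ) ∈ Icc 0 T := ⟨le_rfl, hT⟩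
  have hEd : ∀ m, ∀ t ∈ Icc 0 T, HasDerivWithinAt (fun t => En Λ m (a t))
      (cut δ (En Λ 1 (a t)) * dEn ν Λ m (a t) (bw w t)) (Icc 0 T) t := fun m t ht =>
    hasDerivWithinAt_En (had t ht) m
  have hS0 : ∀ m t, 0 ≤ ∑ j ∈ Finset.range (m + 1), W (m - j) t ^ 2 * En Λ j (a t) := fun m t =>
    Finset.sum_nonneg fun j _ => mul_nonneg (sq_nonneg _) (En_nonneg _ _ _)
  have hb1 := hC T W Qs (fun m t => En Λ m (a t))
    (fun m t => cut δ (En Λ 1 (a t)) * dEn ν Λ m (a t) (bw w t)) hB.cont hQ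
    (fun m _ => hEd m) (fun m _ t _ => En_nonneg _ _ _) (fun m _ j hj => En_mono h0 hj _)
    (fun m hm t ht => by
      have hc0 := cut_nonneg δ (En Λ 1 (a t))
      have hc1 := cut_le_one δ (En Λ 1 (a t))
      have h1 : 0 ≤ K * ∑ j ∈ Finset.range (m + 1), W (m - j) t ^ 2 * En Λ j (a t) :=
        mul_nonneg hK0 (hS0 m t)
      by_cases h : 2 * δ ≤ En Λ 1 (a t)
      · simp only [cut_eq_zero hδ0 h, zero_mul]
        exact h1
      · have h2 := hB.dEn_low ht.1 h0 (haz t) (hdiv t ht) hν hσ0 hε hε0 hδ (not_le.1 h).le hm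
        have h3 : 0 ≤ 2 * ν * σ * En Λ m (a t) := by
          have := En_nonneg Λ m (a t)
          positivity
        have h4 : dEn ν Λ m (a t) (bw w t) ≤
          K * ∑ j ∈ Finset.range (m + 1), W (m - j) t ^ 2 * En Λ j (a t) := by linarith
        calc _ ≤ cut δ (En Λ 1 (a t)) *
              (K * ∑ j ∈ Finset.range (m + 1), W (m - j) t ^ 2 * En Λ j (a t)) := by gcongr
          _ ≤ _ := mul_le_of_le_one_left h1 hc1)
  simp only [hE0] at hb1
  have hbT : ∀ m ≤ M, ∀ S ∈ Icc 0 T, ∀ t ∈ Icc 0 S, En Λ m (a t) ≤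
      C * Qs m S * exp (C * ∫ τ in (0:ℝ)..S, W 0 τ ^ 2) * En Λ m a0 := fun m hm S hS t ht => by
    refine (hb1 m hm t ⟨ht.1, ht.2.trans hS.2⟩).trans ?_
    have h1 := hQ.mono hB.cont m ht.1 ht.2
    have h2 := integral_sq_mono (hB.cont 0) ht.1 ht.2
    have h3 := En_nonneg Λ m a0
    have h4 := hQ.one_le m ht.1
    have h5 := hQ.one_le m hS.1
    gcongr
  have hE1 : ∀ t ∈ Icc 0 T, En Λ 1 (a t) ≤ δ := fun t ht =>
    (En_mono h0 hr _).trans ((hbT r hrM T ⟨hT, le_rfl⟩ t ht).trans hsmall)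
  have hcut : ∀ t ∈ Icc 0 T, cut δ (En Λ 1 (a t)) = 1 := fun t ht => cut_eq_one hδ0 (hE1 t ht)
  have hEd' : ∀ m, ∀ t ∈ Icc 0 T, HasDerivWithinAt (fun t => En Λ m (a t))
      (dEn ν Λ m (a t) (bw w t)) (Icc 0 T) t := fun m t ht => by
    have := hEd m t ht
    rwa [hcut t ht, one_mul] at this
  refine ⟨a, haz, ha0', fun t ht k hk i => ?_, has, hdiv, fun m hm t ht => ?_,
    fun m S hS t ht => ?_⟩
  · have := had t ht k hk i
    rwa [hcut t ht, Complex.ofReal_one, one_mul] at this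
  · have h := hC T W Qs (fun m t => En Λ m (a t) * exp (2 * ν * σ * t))
      (fun m t => dEn ν Λ m (a t) (bw w t) * exp (2 * ν * σ * t) +
        En Λ m (a t) * (exp (2 * ν * σ * t) * (2 * ν * σ))) hB.cont hQ
      (fun m _ t ht => (hEd' m t ht).mul (by
        have := ((hasDerivAt_id t).const_mul (2 * ν * σ)).exp
        simp only [id_eq, mul_one] at this
        exact this.hasDerivWithinAt))
      (fun m _ t _ => mul_nonneg (En_nonneg _ _ _) (Real.exp_pos _).le)
      (fun m _ j hj => by
        have := En_mono h0 hj (a 0)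
        gcongr)
      (fun m hm t ht => by
        have h2 := hB.dEn_low ht.1 h0 (haz t) (hdiv t ht) hν hσ0 hε hε0 hδ
          ((hE1 t ht).trans (by linarith)) hm
        have h3 := Real.exp_pos (2 * ν * σ * t)
        have h4 := mul_le_mul_of_nonneg_right h2 h3.le
        simp only [← mul_assoc (W _ _ ^ 2), ← Finset.sum_mul]
        linarith)
      m (hm.trans hrM) t ht
    simp only [hE0, mul_zero, Real.exp_zero, mul_one] at h
    rw [Real.exp_neg, ← div_eq_mul_inv, le_div_iff₀ (Real.exp_pos _)]
    exact h
  · have hKH : 0 ≤ KH ν m := by unfold KH; positivity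
    have hA : 0 ≤ C * Qs 2 S * exp (C * ∫ τ in (0:ℝ)..S, W 0 τ ^ 2) * En Λ 2 a0 := by
      have h5 := hQ.one_le 2 hS.1
      have := En_nonneg Λ 2 a0
      positivity
    have h := gronwall (T := S) (y := fun t => En Λ m (a t))
      (y' := fun t => dEn ν Λ m (a t) (bw w t)) (h := fun _ => 0)
      (c := fun τ => KH ν m *
          (C * Qs 2 S * exp (C * ∫ τ in (0:ℝ)..S, W 0 τ ^ 2) * En Λ 2 a0 +
            ∑ j ∈ Finset.range (m + 1), W (m - j) τ ^ 2))
      (by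
        refine continuous_const.mul (continuous_const.add (continuous_finsetSum _ fun j _ => ?_))
        exact (hB.cont _).pow 2)
      continuous_const
      (fun t => mul_nonneg hKH (add_nonneg hA (Finset.sum_nonneg fun j _ => sq_nonneg _)))
      (fun _ => le_rfl) (fun t ht => (hEd' m t ⟨ht.1, ht.2.trans hS.2⟩).mono (Icc_subset_Icc_right hS.2))
      (fun t ht => by
        have ht' : t ∈ Icc 0 T := ⟨ht.1, ht.2.trans hS.2⟩
        refine (hB.dEn_high ht.1 h0 (haz t) (hdiv t ht') hν m).trans ?_
        rw [add_zero]
        have h1 := hbT 2 h2M S hS t ht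
        have h2 := En_nonneg Λ m (a t)
        change KH ν m * _ * _ ≤ _
        gcongr) t ht
    simpa only [hE0, intervalIntegral.integral_zero, add_zero] using h

/-! ### Smooth time-dependent periodic functions -/

/-- Smooth time-dependent periodic scalar functions on `[0, ∞)`. -/
structure TS (f : E3 → ℝ → ℝ) : Prop where
  sm : SmoothOnTimeS f (Ici 0)
  per : ∀ t, SpacePeriodic fun x => f x t

/-- The space-time domain. -/
def ST : Set (E3 × ℝ) := univ ×ˢ Ici 0

lemma uniqueDiffOn_ST : UniqueDiffOn ℝ ST := uniqueDiffOn_univ.prod (uniqueDiffOn_Ici 0)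

lemma mem_ST {x : E3} {t : ℝ} (ht : 0 ≤ t) : (x, t) ∈ ST := ⟨mem_univ _, ht⟩

/-- The one-sided time derivative. -/
def dt (f : E3 → ℝ → ℝ) (x : E3) (t : ℝ) : ℝ := derivWithin (fun τ => f x τ) (Ici 0) t

lemma TS.slice {f : E3 → ℝ → ℝ} (h : TS f) {t : ℝ} (ht : 0 ≤ t) :
    ContDiff ℝ (⊤ : ℕ∞) fun x => f x t := by
  rw [← contDiffOn_univ]
  exact ContDiffOn.comp h.sm (g := fun p : E3 × ℝ => f p.1 p.2) (f := fun x : E3 => (x, t))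
    (by fun_prop) fun x _ => mem_ST ht

lemma TS.hasFDerivWithinAt {f : E3 → ℝ → ℝ} (h : TS f) {x : E3} {t : ℝ} (ht : 0 ≤ t) :
    HasFDerivWithinAt (fun p : E3 × ℝ => f p.1 p.2)
      (fderivWithin ℝ (fun p : E3 × ℝ => f p.1 p.2) ST (x, t)) ST (x, t) :=
  (h.sm.differentiableOn (by simp) _ (mem_ST ht)).hasFDerivWithinAt

lemma TS.pd_eq {f : E3 → ℝ → ℝ} (h : TS f) (j : Fin 3) {x : E3} {t : ℝ} (ht : 0 ≤ t) :
    pd j (fun y => f y t) x =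
      fderivWithin ℝ (fun p : E3 × ℝ => f p.1 p.2) ST (x, t) (Pi.single j 1, 0) := by
  have h1 : HasFDerivWithinAt (fun y : E3 => (y, t)) (ContinuousLinearMap.inl ℝ E3 ℝ) univ x :=
    (hasFDerivAt_prodMk_left x t).hasFDerivWithinAt
  have h2 := (h.hasFDerivWithinAt (x := x) ht).comp x h1 fun y _ => mem_ST ht
  rw [hasFDerivWithinAt_univ] at h2
  have h3 : fderiv ℝ (fun y => f y t) x = _ := h2.fderiv
  rw [pd, h3]
  rfl

lemma TS.hasDerivWithinAt' {f : E3 → ℝ → ℝ} (h : TS f) {x : E3} {t : ℝ} (ht : 0 ≤ t) :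
    HasDerivWithinAt (fun τ => f x τ)
      (fderivWithin ℝ (fun p : E3 × ℝ => f p.1 p.2) ST (x, t) (0, 1)) (Ici 0) t := by
  have h1 : HasFDerivWithinAt (fun τ : ℝ => (x, τ)) (ContinuousLinearMap.inr ℝ E3 ℝ) (Ici 0) t :=
    (hasFDerivAt_prodMk_right x t).hasFDerivWithinAt
  have h2 := (h.hasFDerivWithinAt (x := x) ht).comp t h1 fun y hy => mem_ST hy
  exact h2.hasDerivWithinAt

lemma TS.hasDerivWithinAt {f : E3 → ℝ → ℝ} (h : TS f) {x : E3} {t : ℝ} (ht : 0 ≤ t) :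
    HasDerivWithinAt (fun τ => f x τ) (dt f x t) (Ici 0) t :=
  (h.hasDerivWithinAt' ht).differentiableWithinAt.hasDerivWithinAt

lemma TS.dt_eq {f : E3 → ℝ → ℝ} (h : TS f) {x : E3} {t : ℝ} (ht : 0 ≤ t) :
    dt f x t = fderivWithin ℝ (fun p : E3 × ℝ => f p.1 p.2) ST (x, t) (0, 1) :=
  (h.hasDerivWithinAt' ht).derivWithin (uniqueDiffOn_Ici 0 t ht)

lemma TS.fderivWithin_apply {f : E3 → ℝ → ℝ} (h : TS f) (v : E3 × ℝ) :
    ContDiffOn ℝ (⊤ : ℕ∞)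
      (fun p => fderivWithin ℝ (fun p : E3 × ℝ => f p.1 p.2) ST p v) ST :=
  (h.sm.fderivWithin uniqueDiffOn_ST le_rfl).clm_apply contDiffOn_const

lemma TS.pd {f : E3 → ℝ → ℝ} (h : TS f) (j : Fin 3) : TS fun x t => pd j (fun y => f y t) x :=
  ⟨(h.fderivWithin_apply _).congr fun _ hp => h.pd_eq j hp.2, fun t => periodic_pd (h.per t) j⟩

lemma TS.dt {f : E3 → ℝ → ℝ} (h : TS f) : TS (dt f) :=
  ⟨(h.fderivWithin_apply _).congr fun _ hp => h.dt_eq hp.2, fun t x j => by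
    have : (fun τ => f (x + (2 * π) • (Pi.single j 1 : E3)) τ) = fun τ => f x τ :=
      funext fun τ => h.per τ x j
    simp only [NSE.dt, this]⟩

lemma TS.sub {f g : E3 → ℝ → ℝ} (hf : TS f) (hg : TS g) : TS fun x t => f x t - g x t :=
  ⟨ContDiffOn.sub hf.sm hg.sm, fun t x j => by
    have h1 := hf.per t x j
    have h2 := hg.per t x j
    simp only at h1 h2 ⊢
    rw [h1, h2]⟩

lemma TS.sum {ι : Type*} (s : Finset ι) {f : ι → E3 → ℝ → ℝ} (hf : ∀ i ∈ s, TS (f i)) :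
    TS fun x t => ∑ i ∈ s, f i x t :=
  ⟨ContDiffOn.sum fun i hi => (hf i hi).sm, fun t x j =>
    Finset.sum_congr rfl fun i hi => (hf i hi).per t x j⟩

lemma TS.iterate_pd {f : E3 → ℝ → ℝ} (h : TS f) (j : Fin 3) (n : ℕ) :
    TS fun x t => (_root_.pd j)^[n] (fun y => f y t) x := by
  induction n with
  | zero => exact h
  | succ n ih =>
    simp only [Function.iterate_succ_apply']
    exact ih.pd j

lemma TS.pdM {f : E3 → ℝ → ℝ} (h : TS f) (β : Fin 3 → ℕ) :
    TS fun x t => pdM β (fun y => f y t) x :=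
  ((h.iterate_pd 2 (β 2)).iterate_pd 1 (β 1)).iterate_pd 0 (β 0)

lemma TS.lap {f : E3 → ℝ → ℝ} (h : TS f) : TS fun x t => lap (fun y => f y t) x :=
  TS.sum Finset.univ fun j _ => (h.pd j).pd j

lemma TS.bes {f : E3 → ℝ → ℝ} (h : TS f) (n : ℕ) : TS fun x t => bes^[n] (fun y => f y t) x := by
  induction n with
  | zero => exact h
  | succ n ih =>
    simp only [Function.iterate_succ_apply']
    exact ih.sub ih.lap

lemma TS.exists_bound {f : E3 → ℝ → ℝ} (h : TS f) (T : ℝ) :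
    ∃ M, ∀ x ∈ T3, ∀ t ∈ Icc 0 T, |f x t| ≤ M := by
  obtain ⟨M, hM⟩ := (isCompact_T3.prod (isCompact_Icc (a := (0:ℝ)) (b := T))).exists_bound_of_continuousOn
    (h.sm.continuousOn.mono fun p hp => ⟨mem_univ _, hp.2.1⟩)
  exact ⟨M, fun x hx t ht => hM (x, t) ⟨hx, ht⟩⟩

lemma TS.exists_dec {f : E3 → ℝ → ℝ} (h : TS f) (n : ℕ) (T : ℝ) :
    ∃ M, ∀ t ∈ Icc 0 T, Dec n M (fc fun x => f x t) := by
  obtain ⟨M, hM⟩ := (h.bes n).exists_bound T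
  exact ⟨M, fun t ht => fc_dec (h.slice ht.1) (h.per t) fun x hx => hM x hx t ht⟩

/-! ### First order expansions -/

lemma expansion_of_lipschitz {E : Type*} [NormedAddCommGroup E] [NormedSpace ℝ E] {f g : ℝ → E}
    {T L : ℝ} (hf : ∀ t ∈ Icc 0 T, HasDerivWithinAt f (g t) (Icc 0 T) t)
    (hg : ∀ s ∈ Icc 0 T, ∀ t ∈ Icc 0 T, ‖g t - g s‖ ≤ L * |t - s|) {s t : ℝ} (hs : s ∈ Icc 0 T)
    (ht : t ∈ Icc 0 T) : ‖f t - f s - (t - s) • g s‖ ≤ L * |t - s| ^ 2 := by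
  have hsub : uIcc s t ⊆ Icc 0 T := (ordConnected_Icc.uIcc_subset hs ht)
  have hd : ∀ τ ∈ uIcc s t, HasDerivWithinAt (fun τ => f τ - τ • g s) (g τ - g s) (uIcc s t) τ := by
    intro τ hτ
    have h1 := ((hf τ (hsub hτ)).mono hsub).sub ((hasDerivWithinAt_id τ _).smul_const (g s))
    simp only [one_smul] at h1
    exact h1
  have hL : ∀ τ ∈ uIcc s t, ‖g τ - g s‖ ≤ L * |t - s| := fun τ hτ => by
    refine (hg s hs τ (hsub hτ)).trans ?_
    have h1 := abs_sub_left_of_mem_uIcc hτ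
    by_cases hL0 : 0 ≤ L
    · gcongr
    · have h2 := (norm_nonneg _).trans (hg s hs t ht)
      have h3 : |t - s| = 0 := by
        have := abs_nonneg (t - s)
        nlinarith
      have h4 : |τ - s| = 0 := le_antisymm (h3 ▸ h1) (abs_nonneg _)
      rw [h3, h4]
  have h := (convex_uIcc s t).norm_image_sub_le_of_norm_hasDerivWithin_le hd hL left_mem_uIcc
    right_mem_uIcc
  rw [Real.norm_eq_abs] at h
  calc ‖f t - f s - (t - s) • g s‖ = ‖f t - t • g s - (f s - s • g s)‖ := by
        congr 1
        rw [sub_smul]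
        abel
    _ ≤ L * |t - s| * |t - s| := h
    _ = _ := by ring

lemma hasDerivWithinAt_of_expansion {E : Type*} [NormedAddCommGroup E] [NormedSpace ℝ E]
    {f : ℝ → E} {g' : E} {S : Set ℝ} {L s : ℝ}
    (h : ∀ t ∈ S, ‖f t - f s - (t - s) • g'‖ ≤ L * |t - s| ^ 2) : HasDerivWithinAt f g' S s := by
  rw [hasDerivWithinAt_iff_isLittleO]
  have h1 : (fun t => f t - f s - (t - s) • g') =O[nhdsWithin s S] fun t => (t - s) ^ 2 := by
    refine Asymptotics.IsBigO.of_bound L ?_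
    filter_upwards [self_mem_nhdsWithin] with t ht
    rw [norm_pow, Real.norm_eq_abs]
    exact h t ht
  refine h1.trans_isLittleO ?_
  refine Asymptotics.IsLittleO.mono ?_ nhdsWithin_le_nhds
  have := Asymptotics.isLittleO_pow_sub_sub s (one_lt_two)
  simpa using this

lemma hasDerivWithinAt_Ici {E : Type*} [NormedAddCommGroup E] [NormedSpace ℝ E]
    {f : ℝ → E} {g' : E} {T s : ℝ} (hsT : s < T)
    (h : HasDerivWithinAt f g' (Icc 0 T) s) : HasDerivWithinAt f g' (Ici 0) s := by
  refine h.mono_of_mem_nhdsWithin ?_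
  rw [← Ici_inter_Iic]
  exact Filter.inter_mem self_mem_nhdsWithin (mem_nhdsWithin_of_mem_nhds (Iic_mem_nhds hsT))

lemma TS.exists_lipschitz {f : E3 → ℝ → ℝ} (h : TS f) (T : ℝ) :
    ∃ L, ∀ x ∈ T3, ∀ s ∈ Icc 0 T, ∀ t ∈ Icc 0 T, |f x t - f x s| ≤ L * |t - s| := by
  obtain ⟨L, hL⟩ := h.dt.exists_bound T
  refine ⟨L, fun x hx s hs t ht => ?_⟩
  exact (convex_Icc 0 T).norm_image_sub_le_of_norm_hasDerivWithin_le
    (fun τ hτ => (h.hasDerivWithinAt hτ.1).mono Icc_subset_Ici_self) (fun τ hτ => hL x hx τ hτ) hs ht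

lemma TS.hasDerivWithinAt_fc {f : E3 → ℝ → ℝ} (h : TS f) (k : K3) {t : ℝ} (ht : 0 ≤ t) :
    HasDerivWithinAt (fun t => fc (fun x => f x t) k) (fc (fun x => NSE.dt f x t) k) (Ici 0) t := by
  obtain ⟨L, hL⟩ := h.dt.exists_lipschitz (t + 1)
  refine hasDerivWithinAt_Ici (T := t + 1) (by linarith) (hasDerivWithinAt_of_expansion (L := L) ?_)
  intro s hs
  have ht' : t ∈ Icc 0 (t + 1) := ⟨ht, by linarith⟩
  have h1 : ∀ x ∈ T3, |f x s - f x t - (s - t) * NSE.dt f x t| ≤ L * |s - t| ^ 2 := fun x hx =>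
    expansion_of_lipschitz (f := fun τ => f x τ) (g := fun τ => NSE.dt f x τ)
      (fun τ hτ => (h.hasDerivWithinAt hτ.1).mono Icc_subset_Ici_self)
      (fun a ha b hb => hL x hx a ha b hb) ht' hs
  have h2 := fc_norm_le h1 k
  have c1 := (h.slice hs.1).continuous
  have c2 := (h.slice ht).continuous
  have c3 := (h.dt.slice ht).continuous
  rw [fc_sub (by fun_prop) (by fun_prop), fc_sub c1 c2, fc_const_mul] at h2
  rwa [Complex.real_smul]

/-! ### The background flow -/

lemma TS.of_field {w : E3 → ℝ → E3} (hw : SmoothOnTime w (Ici 0))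
    (hp : ∀ t, SpacePeriodic fun x => w x t) (i : Fin 3) : TS fun x t => w x t i :=
  ⟨contDiffOn_pi.1 hw i, fun t x j => congrFun (hp t x j) i⟩

lemma TS.mul {f g : E3 → ℝ → ℝ} (hf : TS f) (hg : TS g) : TS fun x t => f x t * g x t :=
  ⟨ContDiffOn.mul hf.sm hg.sm, fun t x j => by
    have h1 := hf.per t x j
    have h2 := hg.per t x j
    simp only at h1 h2 ⊢
    rw [h1, h2]⟩

lemma exists_T3_rep (x : E3) :
    ∃ y ∈ T3, ∀ F : E3 → ℝ, Continuous F → SpacePeriodic F → F x = F y := by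
  refine ⟨(2 * π) • fun i => Int.fract (x i / (2 * π)), ⟨fun i => ?_, fun i => ?_⟩, fun F hF hp => ?_⟩
  · have := Int.fract_nonneg (x i / (2 * π))
    have := Real.pi_pos
    simp only [Pi.zero_apply, Pi.smul_apply, smul_eq_mul]
    positivity
  · have := (Int.fract_lt_one (x i / (2 * π))).le
    have := Real.pi_pos
    simp only [Pi.smul_apply, smul_eq_mul]
    nlinarith
  · obtain ⟨G, hG⟩ := exists_torus_lift hF hp
    have h1 := hG ((2 * π)⁻¹ • x)
    rw [smul_inv_smul₀ (by have := Real.pi_pos; positivity)] at h1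
    rw [← h1, ← hG]
    congr 1
    funext i
    have h2 : ((2 * π)⁻¹ • x) i = Int.fract (x i / (2 * π)) + (⌊x i / (2 * π)⌋ : ℝ) := by
      rw [Int.fract_add_floor, Pi.smul_apply, smul_eq_mul, div_eq_inv_mul]
    have h3 : (((⌊x i / (2 * π)⌋ : ℤ) : ℝ) : UnitAddCircle) = 0 :=
      (AddCircle.coe_eq_zero_iff 1).2 ⟨⌊x i / (2 * π)⌋, by simp⟩
    rw [h2, AddCircle.coe_add, h3, add_zero]

lemma TS.gradSq {w : E3 → ℝ → E3} (hw : ∀ i, TS fun x t => w x t i) (m : ℕ) :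
    TS fun x t => gradSq m (fun y => w y t) x :=
  TS.sum Finset.univ fun i _ => TS.sum _ fun β _ => by
    simp only [sq]
    exact ((hw i).pdM β).mul ((hw i).pdM β)

/-- The sup norms of the derivatives, extended to a continuous function on the line. -/
def wW (w : E3 → ℝ → E3) (m : ℕ) (t : ℝ) : ℝ := wNormInf m w (max t 0)

lemma wW_eq (w : E3 → ℝ → E3) (m : ℕ) {t : ℝ} (ht : 0 ≤ t) : wW w m t = wNormInf m w t := by
  rw [wW, max_eq_left ht]

lemma range_eq_image_T3 {F : E3 → ℝ} (hF : Continuous F) (hp : SpacePeriodic F) :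
    range F = F '' T3 := by
  refine subset_antisymm ?_ (image_subset_range F T3)
  rintro _ ⟨x, rfl⟩
  obtain ⟨y, hy, h⟩ := exists_T3_rep x
  exact ⟨y, hy, (h F hF hp).symm⟩

lemma sqrt_gradSq {w : E3 → ℝ → E3} (hw : ∀ i, TS fun x t => w x t i) (m : ℕ) {t : ℝ}
    (ht : 0 ≤ t) : Continuous (fun x => √(gradSq m (fun y => w y t) x)) ∧
      SpacePeriodic (fun x => √(gradSq m (fun y => w y t) x)) :=
  ⟨((TS.gradSq hw m).slice ht).continuous.sqrt, fun x j =>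
    congrArg Real.sqrt ((TS.gradSq hw m).per t x j)⟩

lemma continuous_wW {w : E3 → ℝ → E3} (hw : ∀ i, TS fun x t => w x t i) (m : ℕ) :
    Continuous (wW w m) := by
  have h1 : wW w m = fun t => sSup ((fun t x => √(gradSq m (fun y => w y (max t 0)) x)) t '' T3) := by
    funext t
    obtain ⟨hc, hp⟩ := sqrt_gradSq hw m (le_max_right t 0)
    rw [wW, wNormInf, LinfGrad, iSup, range_eq_image_T3 hc hp]
  rw [h1]
  refine isCompact_T3.continuous_sSup ?_
  refine Continuous.sqrt ?_
  exact (TS.gradSq hw m).sm.continuousOn.comp_continuous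
    (f := fun p : ℝ × E3 => (p.2, max p.1 0)) (by fun_prop) fun p => mem_ST (le_max_right _ _)

lemma abs_pdM_le_wNormInf {w : E3 → ℝ → E3} (hw : ∀ i, TS fun x t => w x t i) {t : ℝ}
    (ht : 0 ≤ t) (i : Fin 3) (β : Fin 3 → ℕ) (x : E3) :
    |pdM β (fun x => w x t i) x| ≤ wNormInf (∑ j, β j) w t := by
  obtain ⟨hc, hp⟩ := sqrt_gradSq hw (∑ j, β j) ht
  have hb : BddAbove (range fun x => √(gradSq (∑ j, β j) (fun y => w y t) x)) := by
    rw [range_eq_image_T3 hc hp]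
    exact isCompact_T3.bddAbove_image hc.continuousOn
  refine le_trans ?_ (le_ciSup hb x)
  refine Real.abs_le_sqrt ?_
  calc pdM β (fun x => w x t i) x ^ 2
      ≤ ∑ β' ∈ midx (∑ j, β j), pdM β' (fun y => w y t i) x ^ 2 :=
        Finset.single_le_sum (f := fun β' => pdM β' (fun y => w y t i) x ^ 2)
          (fun _ _ => sq_nonneg _) (mem_midx.2 rfl)
    _ ≤ _ := Finset.single_le_sum
        (f := fun i => ∑ β' ∈ midx (∑ j, β j), pdM β' (fun y => w y t i) x ^ 2)
        (fun _ _ => Finset.sum_nonneg fun _ _ => sq_nonneg _) (Finset.mem_univ i)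

lemma bg_of_TS {w : E3 → ℝ → E3} (hw : ∀ i, TS fun x t => w x t i) : Bg w (wW w) where
  smooth t ht i := (hw i).slice ht
  per t i := (hw i).per t
  bound t ht i β x := by
    rw [wW_eq w _ ht]
    exact abs_pdM_le_wNormInf hw ht i β x
  cont m := continuous_wW hw m
  coeff k i := fun t ht => ((hw i).hasDerivWithinAt_fc k ht).continuousWithinAt

lemma integral_wW (w : E3 → ℝ → E3) (m : ℕ) {t : ℝ} (ht : 0 ≤ t) :
    ∫ τ in (0:ℝ)..t, wW w m τ ^ 2 = ∫ τ in (0:ℝ)..t, wNormInf m w τ ^ 2 := by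
  refine intervalIntegral.integral_congr fun τ hτ => ?_
  rw [uIcc_of_le ht] at hτ
  simp only [wW_eq w m hτ.1]

lemma isQ_wW (w : E3 → ℝ → E3) : IsQ (wW w) (Q w) := by
  intro m t ht
  cases m with
  | zero => simp [Q]
  | succ j =>
    rw [Q, Finset.sum_attach (Finset.range (j + 1))
      (fun m => Q w m t * ∫ τ in (0:ℝ)..t, (wNormInf (j + 1 - m) w τ) ^ 2)]
    simp only [integral_wW w _ ht]

lemma integral_le_Ioi {w : E3 → ℝ → E3} {m : ℕ}
    (h : IntegrableOn (fun t => (wNormInf m w t) ^ 2) (Ioi (0:ℝ))) {t : ℝ} (ht : 0 ≤ t) :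
    ∫ τ in (0:ℝ)..t, wW w m τ ^ 2 ≤ ∫ τ in Ioi (0:ℝ), (wNormInf m w τ) ^ 2 := by
  rw [integral_wW w m ht, intervalIntegral.integral_of_le ht]
  exact setIntegral_mono_set h (Filter.Eventually.of_forall fun _ => sq_nonneg _)
    (LE.le.eventuallyLE Ioc_subset_Ioi_self)

lemma exists_Q_bound {w : E3 → ℝ → E3} {r : ℕ}
    (h : ∀ m ≤ r, IntegrableOn (fun t => (wNormInf m w t) ^ 2) (Ioi (0:ℝ))) :
    ∀ m ≤ r, ∃ B, ∀ t, 0 ≤ t → Q w m t ≤ B := by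
  intro m
  induction m using Nat.strong_induction_on with
  | _ m ih =>
    intro hm
    have h1 : ∀ j : ℕ, ∃ B, j < m → ∀ t, 0 ≤ t → Q w j t ≤ B := fun j => by
      by_cases hj : j < m
      · obtain ⟨B, hB⟩ := ih j hj (hj.le.trans hm)
        exact ⟨B, fun _ => hB⟩
      · exact ⟨0, fun h => absurd h hj⟩
    choose B hB using h1
    refine ⟨1 + ∑ j ∈ Finset.range m, B j * ∫ τ in Ioi (0:ℝ), (wNormInf (m - j) w τ) ^ 2,
      fun t ht => ?_⟩
    rw [isQ_wW w m t ht]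
    refine add_le_add le_rfl (Finset.sum_le_sum fun j hj => ?_)
    have hj' := Finset.mem_range.1 hj
    have h2 := (isQ_wW w).one_le j ht
    have h3 := hB j hj' t ht
    exact mul_le_mul h3 (integral_le_Ioi (h _ ((Nat.sub_le _ _).trans hm)) ht)
      (intervalIntegral.integral_nonneg ht fun _ _ => sq_nonneg _) (by linarith)

lemma Q_le_Qinf {w : E3 → ℝ → E3} {r : ℕ}
    (h : ∀ m ≤ r, IntegrableOn (fun t => (wNormInf m w t) ^ 2) (Ioi (0:ℝ))) {t : ℝ} (ht : 0 ≤ t) :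
    Q w r t ≤ Qinf w r := by
  obtain ⟨B, hB⟩ := exists_Q_bound h r le_rfl
  exact le_ciSup (f := fun t : Ici (0:ℝ) => Q w r t)
    ⟨B, by rintro _ ⟨s, rfl⟩; exact hB s s.2⟩ ⟨t, ht⟩

/-! ### The Navier–Stokes equations in Fourier variables -/

/-- The Navier–Stokes vector field in Fourier variables. -/
def NSF (ν : ℝ) (b : K3 → Fin 3 → ℂ) (k : K3) (i : Fin 3) : ℂ :=
  Pr k (fun i => -((ν * q k : ℝ) : ℂ) * b k i -
    Complex.I * ∑ j, (k j : ℂ) * cv (fun l => b l j) (fun l => b l i) k) i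

lemma eq_Pr_of_grad {k : K3} {z z' : Fin 3 → ℂ} {c : ℂ} (h : ∀ i, z i = z' i - c * k i)
    (hz : ∑ j, (k j : ℂ) * z j = 0) (i : Fin 3) : z i = Pr k z' i := by
  have h1 : ∑ j, (k j : ℂ) * z' j = c * (q k : ℂ) := by
    have h2 : ∀ j, (k j : ℂ) * z' j = (k j : ℂ) * z j + c * (k j : ℂ) ^ 2 := fun j => by
      rw [h j]
      ring
    simp only [h2, Finset.sum_add_distrib, hz, zero_add, ← Finset.mul_sum]
    simp [q]
  rw [Pr, h1, h i]
  by_cases hk : k = 0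
  · simp [hk]
  · have h3 : (q k : ℂ) ≠ 0 := by
      have := one_le_q hk
      exact_mod_cast (by linarith : q k ≠ 0)
    field_simp

lemma Dec.mul_coord {p : ℕ} {A : ℝ} {f : K3 → ℂ} (h : Dec (p + 1) A f) (j : Fin 3) :
    Dec p A fun k => (k j : ℂ) * f k := by
  have := h.smul (c := fun k => (k j : ℂ)) (M := 1) (s := 1) (fun k => by
    rw [Complex.norm_intCast]
    simpa using abs_le_J k j)
  simpa using this

lemma cv_div {b : K3 → Fin 3 → ℂ} {A : ℝ} (hb : ∀ j, Dec 3 A fun l => b l j)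
    (hd : ∀ l : K3, ∑ j, (l j : ℂ) * b l j = 0) (k : K3) (i : Fin 3) :
    ∑ j, (k j : ℂ) * cv (fun l => b l j) (fun l => b l i) k =
      ∑ j, cv (fun l => b l j) (fun l => (l j : ℂ) * b l i) k := by
  have s1 : ∀ j, Summable fun l => b l j * (((k - l) j : ℂ) * b (k - l) i) := fun j =>
    (cv_summable ((hb j).mono (by norm_num) le_rfl)
      (((hb i).mul_coord j).mono (by norm_num) le_rfl) k).of_norm
  have s2 : ∀ j, Summable fun l => ((l j : ℂ) * b l j) * b (k - l) i := fun j =>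
    (cv_summable ((hb j).mul_coord j) ((hb i).mono (by norm_num) le_rfl) k).of_norm
  have h1 : ∀ j, (k j : ℂ) * cv (fun l => b l j) (fun l => b l i) k =
      cv (fun l => b l j) (fun l => (l j : ℂ) * b l i) k +
        ∑' l, ((l j : ℂ) * b l j) * b (k - l) i := fun j => by
    rw [cv, cv, ← tsum_mul_left, ← (s1 j).tsum_add (s2 j)]
    refine tsum_congr fun l => ?_
    simp only [Pi.sub_apply, Int.cast_sub]
    ring
  simp only [h1, Finset.sum_add_distrib]
  rw [← Summable.tsum_finsetSum fun j _ => s2 j]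
  simp only [← Finset.sum_mul, hd, zero_mul, tsum_zero, add_zero]

lemma bw_div {w : E3 → ℝ → E3} (hw : ∀ i, TS fun x t => w x t i) {t : ℝ} (ht : 0 ≤ t)
    (hd : ∀ x, vdiv (fun y => w y t) x = 0) (k : K3) : ∑ j, (k j : ℂ) * bw w t k j = 0 := by
  have h1 : fc (vdiv fun y => w y t) k = 0 := by
    have : vdiv (fun y => w y t) = fun _ => 0 * 0 := by
      funext x
      simp [hd x]
    rw [this, fc_const_mul]
    simp
  have h2 : fc (vdiv fun y => w y t) k = ∑ j, Complex.I * k j * bw w t k j := by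
    rw [show vdiv (fun y => w y t) = fun x => ∑ j, pd j (fun y => w y t j) x from rfl,
      fc_sum _ fun j _ => (contDiff_pd ((hw j).slice ht) j).continuous]
    exact Finset.sum_congr rfl fun j _ => fc_pd ((hw j).slice ht) ((hw j).per t) j k
  rw [h1] at h2
  simp only [mul_assoc, ← Finset.mul_sum] at h2
  exact (mul_eq_zero.1 h2.symm).resolve_left Complex.I_ne_zero

lemma hasDerivWithinAt_bw {ν : ℝ} {w : E3 → ℝ → E3} {P : E3 → ℝ → ℝ}
    (hw : ∀ i, TS fun x t => w x t i) (hP : TS P) (hns : IsNS ν (Ici 0) w P) {t : ℝ} (ht : 0 ≤ t)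
    (k : K3) (i : Fin 3) :
    HasDerivWithinAt (fun t => bw w t k i) (NSF ν (bw w t) k i) (Ici 0) t := by
  have h1 : ∀ i, HasDerivWithinAt (fun t => bw w t k i) (fc (fun x => dt (fun x t => w x t i) x t) k)
      (Ici 0) t := fun i => (hw i).hasDerivWithinAt_fc k ht
  have hdiv : ∀ s, 0 ≤ s → ∀ k : K3, ∑ j, (k j : ℂ) * bw w s k j = 0 := fun s hs k =>
    bw_div hw hs (hns.2 s hs) k
  have h2 : ∑ j, (k j : ℂ) * fc (fun x => dt (fun x t => w x t j) x t) k = 0 := by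
    have h3 := HasDerivWithinAt.fun_sum (u := Finset.univ) fun j _ => (h1 j).const_mul (k j : ℂ)
    have h4 : HasDerivWithinAt (fun s => ∑ j, (k j : ℂ) * bw w s k j) 0 (Ici 0) t :=
      (hasDerivWithinAt_const t (Ici 0) (0:ℂ)).congr (fun s hs => hdiv s hs k) (hdiv t ht k)
    exact (uniqueDiffOn_Ici (0:ℝ) t ht).eq_deriv _ h3 h4
  obtain ⟨A, hA⟩ : ∃ A, ∀ j, Dec 3 A fun l => bw w t l j := by
    choose A hA using fun j => exists_fc_dec ((hw j).slice ht) ((hw j).per t) 3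
    exact ⟨∑ j, A j, fun j => (hA j).mono le_rfl (Finset.single_le_sum (f := A)
      (fun j _ => (hA j).nonneg) (Finset.mem_univ j))⟩
  refine (h1 i).congr_deriv ?_
  refine eq_Pr_of_grad (z := fun i => fc (fun x => dt (fun x t => w x t i) x t) k)
    (c := Complex.I * fc (fun x => P x t) k) (fun i => ?_) h2 i
  have e1 : (fun x => dt (fun x t => w x t i) x t + ∑ j, w x t j * pd j (fun y => w y t i) x) =
      fun x => ν * lap (fun y => w y t i) x - pd i (fun y => P y t) x := by
    funext x
    have := hns.1 t ht x i
    rw [dt]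
    linarith
  have e2 := congrFun (congrArg fc e1) k
  have cw : ∀ i, Continuous fun x => w x t i := fun i => ((hw i).slice ht).continuous
  have cp : ∀ j, Continuous (pd j fun y => w y t i) := fun j =>
    (contDiff_pd ((hw i).slice ht) j).continuous
  have cm : ∀ j, Continuous fun x => w x t j * pd j (fun y => w y t i) x := fun j =>
    (cw j).mul (cp j)
  have cl : Continuous fun x => ν * lap (fun y => w y t i) x :=
    continuous_const.mul (lap_smooth ((hw i).slice ht) ((hw i).per t)).1.continuous
  rw [fc_add ((hw i).dt.slice ht).continuous
      (continuous_finsetSum _ fun j _ => cm j),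
    fc_sub cl
      (contDiff_pd (hP.slice ht) i).continuous, fc_const_mul,
    fc_lap ((hw i).slice ht) ((hw i).per t), fc_pd (hP.slice ht) (hP.per t),
    fc_sum _ fun j _ => cm j] at e2
  have e3 : ∀ j, fc (fun x => w x t j * pd j (fun y => w y t i) x) k =
      Complex.I * cv (fun l => bw w t l j) (fun l => (l j : ℂ) * bw w t l i) k := fun j => by
    rw [fc_mul ((hw j).slice ht) ((hw j).per t) (cp j), cv, cv, ← tsum_mul_left]
    refine tsum_congr fun l => ?_
    rw [fc_pd ((hw i).slice ht) ((hw i).per t)]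
    simp only [bw]
    ring
  simp only [e3, ← Finset.mul_sum] at e2
  rw [cv_div hA (hdiv t ht)]
  have e4 : fc (fun x => w x t i) k = bw w t k i := rfl
  rw [e4] at e2
  push_cast
  linear_combination e2

/-! ### The perturbation equation in Fourier variables -/

/-- The quadratic and linear interaction terms of the perturbation equation. -/
def Qd (a b : K3 → Fin 3 → ℂ) (k : K3) (j i : Fin 3) : ℂ :=
  cv (fun l => a l j) (fun l => a l i) k + cv (fun l => a l i) (fun l => b l j) k +
    cv (fun l => a l j) (fun l => b l i) k

/-- The vector field of the perturbation equation. -/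
def Gd (ν : ℝ) (a b : K3 → Fin 3 → ℂ) (k : K3) (i : Fin 3) : ℂ :=
  Pr k (fun i => -((ν * q k : ℝ) : ℂ) * a k i - Complex.I * ∑ j, (k j : ℂ) * Qd a b k j i) i

lemma Fld_eq_Gd (ν : ℝ) {Λ : Finset K3} {a : K3 → Fin 3 → ℂ} (ha : ∀ k ∉ Λ, ∀ i, a k i = 0)
    (b : K3 → Fin 3 → ℂ) (k : K3) (i : Fin 3) : Fld ν Λ a b k i = Gd ν a b k i := by
  have h : ∀ j (g : K3 → ℂ), cv (fun l => a l j) g k = ∑ l ∈ Λ, a l j * g (k - l) := fun j g =>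
    tsum_eq_sum fun l hl => by simp [ha l hl]
  simp only [Fld, Gd, Nl, Qd, h]

lemma Pr_add (k : K3) (z z' : Fin 3 → ℂ) (i : Fin 3) :
    Pr k (fun i => z i + z' i) i = Pr k z i + Pr k z' i := by
  simp only [Pr, mul_add, Finset.sum_add_distrib]
  ring

lemma Pr_sub (k : K3) (z z' : Fin 3 → ℂ) (i : Fin 3) :
    Pr k (fun i => z i - z' i) i = Pr k z i - Pr k z' i := by
  simp only [Pr, mul_sub, Finset.sum_sub_distrib]
  ring

lemma abs_mul_le_q (k : K3) (i j : Fin 3) : |(k i : ℝ)| * |(k j : ℝ)| ≤ q k := by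
  have h1 := sq_le_q k i
  have h2 := sq_le_q k j
  rw [← sq_abs] at h1 h2
  nlinarith [sq_nonneg (|(k i : ℝ)| - |(k j : ℝ)|)]

lemma norm_Pr_le {k : K3} {z : Fin 3 → ℂ} {M : ℝ} (h : ∀ i, ‖z i‖ ≤ M) (i : Fin 3) :
    ‖Pr k z i‖ ≤ 4 * M := by
  have hM : 0 ≤ M := (norm_nonneg _).trans (h 0)
  by_cases hk : k = 0
  · simp only [Pr, hk, Pi.zero_apply, Int.cast_zero, zero_mul, zero_div, sub_zero]
    linarith [h i]
  have hq : 0 < q k := by linarith [one_le_q hk]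
  have h1 : ‖(k i : ℂ) * (∑ j, (k j : ℂ) * z j) / (q k : ℂ)‖ ≤ 3 * M := by
    rw [norm_div, Complex.norm_real, Real.norm_of_nonneg hq.le, div_le_iff₀ hq, Finset.mul_sum]
    calc ‖∑ j, (k i : ℂ) * ((k j : ℂ) * z j)‖ ≤ ∑ j : Fin 3, q k * M := by
          refine norm_sum_le_of_le _ fun j _ => ?_
          rw [norm_mul, norm_mul, Complex.norm_intCast, Complex.norm_intCast, ← mul_assoc]
          exact mul_le_mul (abs_mul_le_q k i j) (h j) (norm_nonneg _) hq.le
      _ = 3 * M * q k := by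
          simp
          ring
  calc ‖Pr k z i‖ ≤ ‖z i‖ + _ := norm_sub_le _ _
    _ ≤ M + 3 * M := add_le_add (h i) h1
    _ = _ := by ring

lemma cv_add_left {A B C : ℝ} {f f' g : K3 → ℂ} (hf : Dec 2 A f) (hf' : Dec 2 B f')
    (hg : Dec 0 C g) (k : K3) : cv (fun l => f l + f' l) g k = cv f g k + cv f' g k := by
  rw [cv, cv, cv, ← ((cv_summable hf hg k).of_norm).tsum_add ((cv_summable hf' hg k).of_norm)]
  exact tsum_congr fun l => add_mul _ _ _

lemma cv_add_right {A B C : ℝ} {f f' g : K3 → ℂ} (hf : Dec 2 A f) (hf' : Dec 2 B f')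
    (hg : Dec 0 C g) (k : K3) : cv g (fun l => f l + f' l) k = cv g f k + cv g f' k := by
  rw [cv_comm, cv_add_left hf hf' hg, cv_comm f, cv_comm f']

lemma NSF_add {a b : K3 → Fin 3 → ℂ} {A B : ℝ} (ha : ∀ i, Dec 2 A fun l => a l i)
    (hb : ∀ i, Dec 2 B fun l => b l i) (ν : ℝ) (k : K3) (i : Fin 3) :
    NSF ν (fun k i => a k i + b k i) k i = Gd ν a b k i + NSF ν b k i := by
  rw [NSF, Gd, NSF, ← Pr_add]
  congr 1
  funext i
  have h : ∀ j, cv (fun l => a l j + b l j) (fun l => a l i + b l i) k =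
      Qd a b k j i + cv (fun l => b l j) (fun l => b l i) k := fun j => by
    rw [cv_add_left (ha j) (hb j) (((ha i).add (hb i)).mono (Nat.zero_le 2) le_rfl),
      cv_add_right (ha i) (hb i) ((ha j).mono (Nat.zero_le 2) le_rfl),
      cv_add_right (ha i) (hb i) ((hb j).mono (Nat.zero_le 2) le_rfl),
      cv_comm (fun l => b l j) (fun l => a l i), Qd]
    ring
  simp only [h, mul_add, Finset.sum_add_distrib]
  ring

lemma cv_sub_le {A D : ℝ} {f f' g g' : K3 → ℂ} (hf : Dec 2 A f) (hf' : Dec 2 A f')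
    (hg : Dec 2 A g) (hg' : Dec 2 A g') (hff : ∀ k, ‖f k - f' k‖ ≤ D) (hgg : ∀ k, ‖g k - g' k‖ ≤ D)
    (k : K3) : ‖cv f g k - cv f' g' k‖ ≤ 2 * A * D * SJ := by
  have h0 : ∀ {h : K3 → ℂ}, Dec 2 A h → Dec 0 A h := fun h => h.mono (Nat.zero_le 2) le_rfl
  have h1 : cv f g k - cv f' g' k =
      cv f (fun l => g l - g' l) k + cv g' (fun l => f l - f' l) k := by
    rw [cv_comm g', cv, cv, cv, cv,
      ← (cv_summable hf (h0 hg) k).of_norm.tsum_sub (cv_summable hf' (h0 hg') k).of_norm]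
    have e : ∀ l, f l * g (k - l) - f' l * g' (k - l) =
        f l * (g (k - l) - g' (k - l)) + (f l - f' l) * g' (k - l) := fun l => by ring
    simp only [e]
    have s1 : Summable fun l => f l * (g (k - l) - g' (k - l)) := by
      simp only [mul_sub]
      exact (cv_summable hf (h0 hg) k).of_norm.sub (cv_summable hf (h0 hg') k).of_norm
    have s2 : Summable fun l => (f l - f' l) * g' (k - l) := by
      simp only [sub_mul]
      exact (cv_summable hf (h0 hg') k).of_norm.sub (cv_summable hf' (h0 hg') k).of_norm
    exact s1.tsum_add s2
  have hd : ∀ {h h' : K3 → ℂ}, (∀ k, ‖h k - h' k‖ ≤ D) → Dec 0 D fun l => h l - h' l :=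
    fun hh k => by simpa using hh k
  have h2 := (cv_dec (p := 0) hf (hd hgg)).norm_le k
  have h3 := (cv_dec (p := 0) hg' (hd hff)).norm_le k
  rw [h1]
  refine (norm_add_le _ _).trans ?_
  rw [pow_zero, one_mul] at h2 h3
  linarith

lemma Gd_sub_le (ν : ℝ) {a a' b b' : K3 → Fin 3 → ℂ} {A D : ℝ} (ha : ∀ i, Dec 2 A fun l => a l i)
    (ha' : ∀ i, Dec 2 A fun l => a' l i) (hb : ∀ i, Dec 2 A fun l => b l i)
    (hb' : ∀ i, Dec 2 A fun l => b' l i) (haa : ∀ k i, ‖a k i - a' k i‖ ≤ D)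
    (hbb : ∀ k i, ‖b k i - b' k i‖ ≤ D) (k : K3) (i : Fin 3) :
    ‖Gd ν a b k i - Gd ν a' b' k i‖ ≤
      4 * (|ν| * q k + ∑ j, |(k j : ℝ)| * (6 * A * SJ)) * D := by
  have hQ : ∀ j i, ‖Qd a b k j i - Qd a' b' k j i‖ ≤ 6 * A * D * SJ := fun j i => by
    have h1 := cv_sub_le (ha j) (ha' j) (ha i) (ha' i) (haa · j) (haa · i) k
    have h2 := cv_sub_le (ha i) (ha' i) (hb j) (hb' j) (haa · i) (hbb · j) k
    have h3 := cv_sub_le (ha j) (ha' j) (hb i) (hb' i) (haa · j) (hbb · i) k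
    rw [Qd, Qd, add_sub_add_comm, add_sub_add_comm]
    refine (norm_add₃_le).trans ?_
    linarith
  rw [Gd, Gd, ← Pr_sub, mul_assoc]
  refine norm_Pr_le (fun i => ?_) i
  have e : -((ν * q k : ℝ) : ℂ) * a k i - Complex.I * ∑ j, (k j : ℂ) * Qd a b k j i -
      (-((ν * q k : ℝ) : ℂ) * a' k i - Complex.I * ∑ j, (k j : ℂ) * Qd a' b' k j i) =
      -((ν * q k : ℝ) : ℂ) * (a k i - a' k i) -
        Complex.I * ∑ j, (k j : ℂ) * (Qd a b k j i - Qd a' b' k j i) := by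
    simp only [mul_sub, Finset.sum_sub_distrib]
    ring
  rw [e, add_mul, Finset.sum_mul]
  refine (norm_sub_le _ _).trans (add_le_add ?_ ?_)
  · rw [norm_mul, norm_neg, Complex.norm_real, Real.norm_eq_abs, abs_mul,
      abs_of_nonneg (q_nonneg k)]
    exact mul_le_mul_of_nonneg_left (haa k i) (mul_nonneg (abs_nonneg _) (q_nonneg k))
  · rw [norm_mul, Complex.norm_I, one_mul]
    refine norm_sum_le_of_le _ fun j _ => ?_
    rw [norm_mul, Complex.norm_intCast]
    calc _ ≤ |(k j : ℝ)| * (6 * A * D * SJ) :=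
          mul_le_mul_of_nonneg_left (hQ j i) (abs_nonneg _)
      _ = _ := by ring

lemma Gd_bound (ν : ℝ) (A : ℝ) : ∃ L, ∀ a b : K3 → Fin 3 → ℂ, (∀ i, Dec 3 A fun l => a l i) →
    (∀ i, Dec 3 A fun l => b l i) → ∀ k i, ‖Gd ν a b k i‖ ≤ L := by
  refine ⟨4 * (|ν| * A + ∑ _j : Fin 3, 3 * (2 ^ 1 * A * A * SJ)), fun a b ha hb k i => ?_⟩
  have h1 : ∀ {f g : K3 → ℂ}, Dec 3 A f → Dec 3 A g → Dec 1 (2 ^ 1 * A * A * SJ) (cv f g) :=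
    fun hf hg => cv_dec (p := 1) hf (hg.mono (by norm_num) le_rfl)
  refine norm_Pr_le (fun i => (norm_sub_le _ _).trans (add_le_add ?_ ?_)) i
  · have h2 := (ha i).mono (by norm_num : 1 ≤ 3) le_rfl k
    rw [pow_one] at h2
    rw [norm_mul, norm_neg, Complex.norm_real, Real.norm_eq_abs, abs_mul,
      abs_of_nonneg (q_nonneg k), mul_assoc]
    refine mul_le_mul_of_nonneg_left (le_trans ?_ h2) (abs_nonneg _)
    rw [mul_comm]
    exact mul_le_mul_of_nonneg_left (by unfold J; linarith) (norm_nonneg _)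
  · rw [norm_mul, Complex.norm_I, one_mul]
    refine norm_sum_le_of_le _ fun j _ => ?_
    have h3 := (((h1 (ha j) (ha i)).add (h1 (ha i) (hb j))).add (h1 (ha j) (hb i))).mul_coord
      (p := 0) j
    refine (h3.norm_le k).trans (le_of_eq (by ring))

lemma tendsto_cv {F : Filter ℕ} {A : ℝ} {f g : ℕ → K3 → ℂ} {f' g' : K3 → ℂ}
    (hf : ∀ᶠ n in F, Dec 2 A (f n)) (hg : ∀ᶠ n in F, Dec 2 A (g n))
    (hff : ∀ k, Filter.Tendsto (fun n => f n k) F (nhds (f' k)))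
    (hgg : ∀ k, Filter.Tendsto (fun n => g n k) F (nhds (g' k))) (k : K3) :
    Filter.Tendsto (fun n => cv (f n) (g n) k) F (nhds (cv f' g' k)) := by
  refine tendsto_tsum_of_dominated_convergence (bound := fun l => 2 ^ 0 * A * A * (J l ^ 2)⁻¹)
    (summable_J.mul_left _) (fun l => (hff l).mul (hgg (k - l))) ?_
  filter_upwards [hf, hg] with n h1 h2 l
  simpa using cv_term_le (p := 0) h1 (h2.mono (Nat.zero_le 2) le_rfl) k l

lemma tendsto_Gd {F : Filter ℕ} {A : ℝ} (ν : ℝ) {a : ℕ → K3 → Fin 3 → ℂ} {a' b : K3 → Fin 3 → ℂ}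
    (ha : ∀ᶠ n in F, ∀ i, Dec 2 A fun l => a n l i) (hb : ∀ i, Dec 2 A fun l => b l i)
    (haa : ∀ k i, Filter.Tendsto (fun n => a n k i) F (nhds (a' k i))) (k : K3) (i : Fin 3) :
    Filter.Tendsto (fun n => Gd ν (a n) b k i) F (nhds (Gd ν a' b k i)) := by
  have hA : ∀ j, ∀ᶠ n in F, Dec 2 A fun l => a n l j := fun j => ha.mono fun n h => h j
  have hB : ∀ j, ∀ᶠ n in F, Dec 2 A fun l => b l j := fun j => Filter.Eventually.of_forall
    fun _ => hb j
  have hQ : ∀ j i, Filter.Tendsto (fun n => Qd (a n) b k j i) F (nhds (Qd a' b k j i)) :=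
    fun j i => ((tendsto_cv (hA j) (hA i) (haa · j) (haa · i) k).add
      (tendsto_cv (hA i) (hB j) (haa · i) (fun _ => tendsto_const_nhds) k)).add
      (tendsto_cv (hA j) (hB i) (haa · j) (fun _ => tendsto_const_nhds) k)
  have hz : ∀ i, Filter.Tendsto (fun n => -((ν * q k : ℝ) : ℂ) * a n k i -
      Complex.I * ∑ j, (k j : ℂ) * Qd (a n) b k j i) F (nhds (-((ν * q k : ℝ) : ℂ) * a' k i -
      Complex.I * ∑ j, (k j : ℂ) * Qd a' b k j i)) := fun i =>
    ((haa k i).const_mul _).sub ((tendsto_finsetSum _ fun j _ => (hQ j i).const_mul _).const_mul _)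
  unfold Gd Pr
  exact (hz i).sub ((((tendsto_finsetSum _ fun j _ => (hz j).const_mul _).const_mul _)).div_const _)

/-- A family of time-dependent coefficients decaying rapidly, locally uniformly in time. -/
def RD (c : ℝ → K3 → ℂ) : Prop := ∀ p T, ∃ M, ∀ t ∈ Icc 0 T, Dec p M (c t)

/-- Compactness of approximate solutions of the perturbation equation. -/
theorem exists_limit (ν : ℝ) {a : ℕ → ℝ → K3 → Fin 3 → ℂ} {b : ℝ → K3 → Fin 3 → ℂ}
    {Λ : ℕ → Finset K3}
    (haz : ∀ N t, ∀ k ∉ Λ N, ∀ i, a N t k i = 0)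
    (hΛ : ∀ k ≠ 0, ∀ᶠ N in Filter.atTop, k ∈ Λ N) (h0 : ∀ N, 0 ∉ Λ N)
    (had : ∀ N : ℕ, ∀ t ∈ Icc 0 (N:ℝ), ∀ k ∈ Λ N, ∀ i,
      HasDerivWithinAt (fun t => a N t k i) (Gd ν (a N t) (b t) k i) (Icc 0 (N:ℝ)) t)
    (hdec : ∀ (p : ℕ) (T : ℝ), ∃ M, ∀ N : ℕ, T ≤ N → ∀ t ∈ Icc 0 T, ∀ i, Dec p M fun k => a N t k i)
    (hbd : ∀ i, RD fun t k => b t k i)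
    (hbl : ∀ T : ℝ, ∃ L, ∀ s ∈ Icc 0 T, ∀ t ∈ Icc 0 T, ∀ k i, ‖b t k i - b s k i‖ ≤ L * |t - s|) :
    ∃ v : ℝ → K3 → Fin 3 → ℂ,
      (∀ t, 0 ≤ t → ∀ k i, Filter.Tendsto (fun N => a N t k i) (Filter.hyperfilter ℕ)
        (nhds (v t k i))) ∧
      (∀ t, 0 ≤ t → ∀ k i, HasDerivWithinAt (fun t => v t k i) (Gd ν (v t) (b t) k i) (Ici 0) t) ∧
      ∀ i, RD fun t k => v t k i := by
  have hlarge : ∀ T : ℝ, ∀ᶠ N : ℕ in (Filter.hyperfilter ℕ : Filter ℕ), T ≤ N := fun T =>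
    (tendsto_natCast_atTop_atTop.eventually_ge_atTop T).filter_mono Nat.hyperfilter_le_atTop
  have hex : ∀ t k i, ∃ z, 0 ≤ t → Filter.Tendsto (fun N => a N t k i)
      (Filter.hyperfilter ℕ) (nhds z) := fun t k i => by
    by_cases ht : 0 ≤ t
    · obtain ⟨M, hM⟩ := hdec 0 t
      obtain ⟨z, -, hz⟩ := (isCompact_closedBall (0:ℂ) M).ultrafilter_le_nhds
        ((Filter.hyperfilter ℕ).map fun N => a N t k i) (by
          rw [Filter.le_principal_iff]
          refine (hlarge t).mono fun N hN => ?_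
          rw [mem_closedBall_zero_iff]
          exact (hM N hN t ⟨ht, le_rfl⟩ i).norm_le k)
      exact ⟨z, fun _ => hz⟩
    · exact ⟨0, fun h => absurd h ht⟩
  choose v hv using hex
  have hv' : ∀ t, 0 ≤ t → ∀ k i, Filter.Tendsto (fun N => a N t k i) (Filter.hyperfilter ℕ)
      (nhds (v t k i)) := fun t ht k i => hv t k i ht
  refine ⟨v, hv', fun t ht k i => ?_, fun i p T => ?_⟩
  · set T := t + 1 with hT
    have htT : t ∈ Icc 0 T := ⟨ht, by linarith⟩
    obtain ⟨Ma, hMa⟩ := hdec 3 T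
    choose Mb hMb using fun i => hbd i 3 T
    obtain ⟨Lb, hLb⟩ := hbl T
    set A := Ma + ∑ i, Mb i with hA
    have hMb0 : ∀ i, 0 ≤ Mb i := fun i => (hMb i t htT).nonneg
    have hAb : ∀ s ∈ Icc 0 T, ∀ i, Dec 3 (max A (∑ i, Mb i)) fun l => b s l i := fun s hs i =>
      (hMb i s hs).mono le_rfl (le_trans (Finset.single_le_sum (fun i _ => hMb0 i)
        (Finset.mem_univ i)) (le_max_right _ _))
    have hAa : ∀ N : ℕ, T ≤ N → ∀ s ∈ Icc 0 T, ∀ i, Dec 3 (max A (∑ i, Mb i)) fun l => a N s l i :=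
      fun N hN s hs i => (hMa N hN s hs i).mono le_rfl
        (le_trans (le_add_of_nonneg_right (Finset.sum_nonneg fun i _ => hMb0 i)) (le_max_left _ _))
    set B := max A (∑ i, Mb i) with hB
    obtain ⟨L1, hL1⟩ := Gd_bound ν B
    have hd : ∀ N : ℕ, T ≤ N → ∀ k, k ∈ Λ N → ∀ i, ∀ s ∈ Icc 0 T,
        HasDerivWithinAt (fun t => a N t k i) (Gd ν (a N s) (b s) k i) (Icc 0 T) s :=
      fun N hN k hk i s hs =>
        (had N s ⟨hs.1, hs.2.trans hN⟩ k hk i).mono (Icc_subset_Icc_right hN)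
    have hL1' : 0 ≤ L1 := by
      obtain ⟨N, hN⟩ := exists_nat_ge T
      exact (norm_nonneg _).trans (hL1 _ _ (hAa N hN t htT) (hAb t htT) 0 0)
    have hlip : ∀ N : ℕ, T ≤ N → ∀ s ∈ Icc 0 T, ∀ s' ∈ Icc 0 T, ∀ k i,
        ‖a N s' k i - a N s k i‖ ≤ L1 * |s' - s| := fun N hN s hs s' hs' k i => by
      by_cases hk : k ∈ Λ N
      · exact (convex_Icc 0 T).norm_image_sub_le_of_norm_hasDerivWithin_le (hd N hN k hk i)
          (fun τ hτ => hL1 _ _ (hAa N hN τ hτ) (hAb τ hτ) k i) hs hs'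
      · rw [haz N s k hk, haz N s' k hk, sub_zero, norm_zero]
        positivity
    have hLb' : 0 ≤ |Lb| := abs_nonneg _
    set L := 4 * (|ν| * q k + ∑ j, |(k j : ℝ)| * (6 * B * SJ)) * (L1 + |Lb|) with hL
    have hexp : ∀ N : ℕ, T ≤ N → k ∈ Λ N → ∀ s ∈ Icc 0 T,
        ‖a N s k i - a N t k i - (s - t) • Gd ν (a N t) (b t) k i‖ ≤ L * |s - t| ^ 2 :=
      fun N hN hk s hs => by
      refine expansion_of_lipschitz (f := fun s => a N s k i)
        (g := fun s => Gd ν (a N s) (b s) k i) (hd N hN k hk i) (fun s hs s' hs' => ?_) htT hs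
      have d2 : ∀ {f : K3 → ℂ}, Dec 3 B f → Dec 2 B f := fun h => h.mono (by norm_num) le_rfl
      refine (Gd_sub_le ν (D := (L1 + |Lb|) * |s' - s|) (fun i => d2 (hAa N hN s' hs' i))
        (fun i => d2 (hAa N hN s hs i)) (fun i => d2 (hAb s' hs' i)) (fun i => d2 (hAb s hs i))
        (fun k i => ?_) (fun k i => ?_) k i).trans (le_of_eq (by rw [hL]; ring))
      · refine (hlip N hN s hs s' hs' k i).trans ?_
        gcongr
        linarith
      · refine (hLb s hs s' hs' k i).trans ?_
        gcongr
        linarith [le_abs_self Lb]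
    refine hasDerivWithinAt_Ici (T := T) (by linarith)
      (hasDerivWithinAt_of_expansion (L := L) fun s hs => ?_)
    by_cases hk : k = 0
    · have hz : ∀ s, 0 ≤ s → v s k i = 0 := fun s hs => by
        refine tendsto_nhds_unique (hv' s hs k i) ?_
        simp only [haz _ s k (hk ▸ h0 _)]
        exact tendsto_const_nhds
      have hG : Gd ν (v t) (b t) k i = 0 := by
        simp [Gd, Pr, hk, q]
      rw [hz s hs.1, hz t ht, hG]
      simp only [sub_zero, smul_zero, norm_zero]
      have hB0 : 0 ≤ B := (hAb t htT 0).nonneg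
      have := q_nonneg k
      have := SJ_nonneg
      have : 0 ≤ ∑ j, |(k j : ℝ)| * (6 * B * SJ) := Finset.sum_nonneg fun j _ => by positivity
      positivity
    · have hG := tendsto_Gd ν (A := B) (b := b t)
        ((hlarge T).mono fun N hN i => (hAa N hN t htT i).mono (by norm_num : 2 ≤ 3) le_rfl)
        (fun i => (hAb t htT i).mono (by norm_num) le_rfl) (hv' t ht) k i
      refine le_of_tendsto (((hv' s hs.1 k i).sub (hv' t ht k i)).sub (hG.const_smul (s - t))).norm ?_
      filter_upwards [hlarge T, (hΛ k hk).filter_mono Nat.hyperfilter_le_atTop] with N hN hk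
      exact hexp N hN hk s hs
  · obtain ⟨M, hM⟩ := hdec p T
    refine ⟨M, fun t ht k => ?_⟩
    refine le_of_tendsto ((hv' t ht.1 k i).norm.mul_const _) ((hlarge T).mono fun N hN => ?_)
    exact hM N hN t ht i k

/-! ### Existence of the perturbation -/

lemma En_le_of_dec {a : K3 → Fin 3 → ℂ} {m : ℕ} {A : ℝ} (ha : ∀ i, Dec (m + 1) A fun k => a k i)
    (Λ : Finset K3) : En Λ m a ≤ 3 * (A ^ 2 * SJ) := by
  have h : ∀ i, SE Λ m (fun k => a k i) ≤ A ^ 2 * SJ := fun i => by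
    calc SE Λ m (fun k => a k i) ≤ ∑ k ∈ Λ, A ^ 2 * (J k ^ 2)⁻¹ := by
          refine Finset.sum_le_sum fun k _ => ?_
          have hJ := J_pos k
          have h1 : ‖a k i‖ ≤ A * (J k ^ (m + 1))⁻¹ := (ha i).le k
          have h2 : q k ^ m ≤ J k ^ m :=
            pow_le_pow_left₀ (q_nonneg k) (by unfold J; linarith) m
          have h3 : J k ^ m ≤ J k ^ (2 * m) :=
            pow_le_pow_right₀ (one_le_J k) (by omega)
          calc q k ^ m * ‖a k i‖ ^ 2 ≤ J k ^ (2 * m) * (A * (J k ^ (m + 1))⁻¹) ^ 2 := by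
                gcongr
                exact h2.trans h3
            _ = A ^ 2 * (J k ^ 2)⁻¹ := by
                field_simp
                ring
      _ = A ^ 2 * ∑ k ∈ Λ, (J k ^ 2)⁻¹ := by rw [Finset.mul_sum]
      _ ≤ _ := mul_le_mul_of_nonneg_left
          (summable_J.sum_le_tsum Λ fun k _ => by have := J_pos k; positivity) (sq_nonneg A)
  calc En Λ m a ≤ ∑ _i : Fin 3, A ^ 2 * SJ := Finset.sum_le_sum fun i _ => h i
    _ = _ := by simp

lemma En_subset {Λ Λ' : Finset K3} (h : Λ ⊆ Λ') (m : ℕ) (a : K3 → Fin 3 → ℂ) :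
    En Λ m a ≤ En Λ' m a :=
  Finset.sum_le_sum fun _ _ => Finset.sum_le_sum_of_subset_of_nonneg h fun k _ _ =>
    mul_nonneg (pow_nonneg (q_nonneg k) m) (sq_nonneg _)

lemma tendsto_En {F : Filter ℕ} (Λ : Finset K3) (m : ℕ) {a : ℕ → K3 → Fin 3 → ℂ}
    {a' : K3 → Fin 3 → ℂ} (h : ∀ k i, Filter.Tendsto (fun n => a n k i) F (nhds (a' k i))) :
    Filter.Tendsto (fun n => En Λ m (a n)) F (nhds (En Λ m a')) :=
  tendsto_finsetSum _ fun i _ => tendsto_finsetSum _ fun k _ =>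
    (((h k i).norm).pow 2).const_mul _

/-- The truncation of frequency space to a cube without the origin. -/
def cube (N : ℕ) : Finset K3 := (Fintype.piFinset fun _ => Finset.Icc (-(N:ℤ)) N).erase 0

lemma zero_notMem_cube (N : ℕ) : (0 : K3) ∉ cube N := Finset.notMem_erase _ _

lemma neg_mem_cube {N : ℕ} {k : K3} (h : k ∈ cube N) : -k ∈ cube N := by
  simp only [cube, Finset.mem_erase, ne_eq, Fintype.mem_piFinset, Finset.mem_Icc, neg_eq_zero,
    Pi.neg_apply] at h ⊢
  exact ⟨h.1, fun j => ⟨by linarith [(h.2 j).2], by linarith [(h.2 j).1]⟩⟩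

lemma eventually_mem_cube {k : K3} (hk : k ≠ 0) : ∀ᶠ N in Filter.atTop, k ∈ cube N := by
  filter_upwards [Filter.eventually_ge_atTop (∑ j, (k j).natAbs)] with N hN
  simp only [cube, Finset.mem_erase, ne_eq, Fintype.mem_piFinset, Finset.mem_Icc]
  refine ⟨hk, fun j => ?_⟩
  have h1 := Finset.single_le_sum (f := fun j => (k j).natAbs) (fun _ _ => Nat.zero_le _)
    (Finset.mem_univ j)
  omega

lemma dec_of_En {Λ : Finset K3} (h0 : 0 ∉ Λ) {a : K3 → Fin 3 → ℂ} (ha : ∀ k ∉ Λ, ∀ i, a k i = 0)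
    {p : ℕ} {R : ℝ} (h : En Λ (2 * p) a ≤ R) (i : Fin 3) :
    Dec p (2 ^ p * √R) fun k => a k i := fun k => by
  by_cases hk : k ∈ Λ
  · have hk0 : k ≠ 0 := fun h => h0 (h ▸ hk)
    have h1 := (norm_sq_le_En (2 * p) a hk i).trans h
    have h2 : q k ^ p * ‖a k i‖ ≤ √R := by
      refine Real.le_sqrt_of_sq_le (le_trans (le_of_eq ?_) h1)
      ring
    have h3 : J k ^ p ≤ (2 * q k) ^ p := pow_le_pow_left₀ (J_pos k).le (J_le_two_q hk0) p
    calc ‖a k i‖ * J k ^ p ≤ ‖a k i‖ * (2 * q k) ^ p := by gcongr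
      _ = 2 ^ p * (q k ^ p * ‖a k i‖) := by ring
      _ ≤ _ := by gcongr
  · simp only [ha k hk i, norm_zero, zero_mul]
    positivity

lemma exists_dec_uniform {ι : Type*} [Fintype ι] {c : ℝ → ι → K3 → ℂ} {p : ℕ} {T : ℝ}
    (h : ∀ i, ∃ M, ∀ t ∈ Icc 0 T, Dec p M (c t i)) : ∃ M, ∀ t ∈ Icc 0 T, ∀ i, Dec p M (c t i) := by
  choose M hM using h
  refine ⟨∑ i, |M i|, fun t ht i => (hM i t ht).mono le_rfl ?_⟩
  exact (le_abs_self _).trans (Finset.single_le_sum (f := fun i => |M i|)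
    (fun _ _ => abs_nonneg _) (Finset.mem_univ i))

lemma bw_lipschitz {w : E3 → ℝ → E3} (hw : ∀ i, TS fun x t => w x t i) (T : ℝ) :
    ∃ L, ∀ s ∈ Icc 0 T, ∀ t ∈ Icc 0 T, ∀ k i, ‖bw w t k i - bw w s k i‖ ≤ L * |t - s| := by
  choose L hL using fun i => (hw i).exists_lipschitz T
  refine ⟨∑ i, |L i|, fun s hs t ht k i => ?_⟩
  rw [bw, bw, ← fc_sub ((hw i).slice ht.1).continuous ((hw i).slice hs.1).continuous]
  refine fc_norm_le (fun x hx => (hL i x hx s hs t ht).trans ?_) k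
  gcongr
  exact (le_abs_self _).trans (Finset.single_le_sum (f := fun i => |L i|)
    (fun _ _ => abs_nonneg _) (Finset.mem_univ i))

/-- Global existence for the perturbation equation in Fourier variables. -/
theorem exists_perturbation {r : ℕ} (hr : 1 ≤ r) {σ ν : ℝ} (hσ0 : 0 < σ) (hσ1 : σ < 1)
    (hν : 0 < ν) :
    ∃ C δ : ℝ, 1 ≤ C ∧ 0 < δ ∧ ∀ w : E3 → ℝ → E3, (∀ i, TS fun x t => w x t i) →
      ∀ a0 : K3 → Fin 3 → ℂ, (∀ p, ∃ A, ∀ i, Dec p A fun k => a0 k i) → (∀ i, a0 0 i = 0) →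
      (∀ k i, a0 (-k) i = (starRingEnd ℂ) (a0 k i)) → (∀ k, ∑ j, (k j : ℂ) * a0 k j = 0) →
      (∀ T, 0 ≤ T → ∀ Λ : Finset K3,
        C * Q w r T * exp (C * ∫ τ in (0:ℝ)..T, wW w 0 τ ^ 2) * En Λ r a0 ≤ δ) →
      ∃ v : ℝ → K3 → Fin 3 → ℂ,
        (∀ t, 0 ≤ t → ∀ k i,
          HasDerivWithinAt (fun t => v t k i) (Gd ν (v t) (bw w t) k i) (Ici 0) t) ∧
        (∀ i, RD fun t k => v t k i) ∧ (∀ k i, v 0 k i = a0 k i) ∧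
        (∀ t, 0 ≤ t → ∀ i, v t 0 i = 0) ∧
        (∀ t, 0 ≤ t → ∀ k i, v t (-k) i = (starRingEnd ℂ) (v t k i)) ∧
        (∀ t, 0 ≤ t → ∀ k, ∑ j, (k j : ℂ) * v t k j = 0) ∧
        ∀ m ≤ r, ∀ B, (∀ Λ, En Λ m a0 ≤ B) → ∀ t, 0 ≤ t → ∀ Λ : Finset K3, 0 ∉ Λ →
          En Λ m (v t) ≤ C * Q w m t * exp (C * ∫ τ in (0:ℝ)..t, wW w 0 τ ^ 2) * B *
            exp (-(2 * ν * σ * t)) := by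
  obtain ⟨C, δ, hC, hδ, H⟩ := galerkin_bounds hr hσ0 hσ1 hν
  refine ⟨C, δ, hC, hδ, fun w hw a0 hdec0 hz0 hsym0 hdiv0 hsmall => ?_⟩
  have hB := bg_of_TS hw
  have hQ := isQ_wW w
  choose a haz ha0 had hsym hdiv hlow hhigh using fun N : ℕ =>
    H w (wW w) (Q w) hB hQ N N.cast_nonneg (cube N) (zero_notMem_cube N)
      (fun _ => neg_mem_cube) a0 hsym0 hdiv0 (hsmall N N.cast_nonneg (cube N))
  have hE0 : ∀ m, ∃ B, ∀ Λ, En Λ m a0 ≤ B := fun m => by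
    obtain ⟨A, hA⟩ := hdec0 (m + 1)
    exact ⟨_, En_le_of_dec hA⟩
  obtain ⟨v, hv, hvd, hvr⟩ := exists_limit ν (a := a) (b := bw w) haz
    (fun k hk => eventually_mem_cube hk) zero_notMem_cube
    (fun N t ht k hk i => by
      rw [← Fld_eq_Gd ν (haz N t)]
      exact had N t ht k hk i)
    (fun p T => by
      by_cases hT : 0 ≤ T
      · obtain ⟨B2, hB2⟩ := hE0 2
        obtain ⟨B, hB'⟩ := hE0 (2 * p)
        refine ⟨_, fun N hN t ht i => dec_of_En (zero_notMem_cube N) (haz N t)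
          (R := exp (∫ τ in (0:ℝ)..T, KH ν (2 * p) *
          (C * Q w 2 T * exp (C * ∫ τ in (0:ℝ)..T, wW w 0 τ ^ 2) * B2 +
            ∑ j ∈ Finset.range (2 * p + 1), wW w (2 * p - j) τ ^ 2)) * B) ?_ i⟩
        refine (hhigh N (2 * p) T ⟨hT, hN⟩ t ht).trans ?_
        have hKH : 0 ≤ KH ν (2 * p) := by
          have := SJ_nonneg
          unfold KH
          positivity
        have hQ2 := hQ.one_le 2 hT
        have hc : ∀ B : ℝ, Continuous fun τ => KH ν (2 * p) *
            (C * Q w 2 T * exp (C * ∫ τ in (0:ℝ)..T, wW w 0 τ ^ 2) * B +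
            ∑ j ∈ Finset.range (2 * p + 1), wW w (2 * p - j) τ ^ 2) := fun B => by
          refine continuous_const.mul (continuous_const.add (continuous_finsetSum _ fun j _ => ?_))
          exact (hB.cont _).pow 2
        have hB20 : 0 ≤ B2 := (En_nonneg ∅ 2 a0).trans (hB2 ∅)
        have hs : ∀ τ, 0 ≤ ∑ j ∈ Finset.range (2 * p + 1), wW w (2 * p - j) τ ^ 2 := fun τ =>
          Finset.sum_nonneg fun j _ => sq_nonneg _
        have hi : (∫ τ in (0:ℝ)..t, KH ν (2 * p) *
            (C * Q w 2 T * exp (C * ∫ τ in (0:ℝ)..T, wW w 0 τ ^ 2) * En (cube N) 2 a0 +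
            ∑ j ∈ Finset.range (2 * p + 1), wW w (2 * p - j) τ ^ 2)) ≤
            ∫ τ in (0:ℝ)..T, KH ν (2 * p) *
            (C * Q w 2 T * exp (C * ∫ τ in (0:ℝ)..T, wW w 0 τ ^ 2) * B2 +
            ∑ j ∈ Finset.range (2 * p + 1), wW w (2 * p - j) τ ^ 2) := by
          refine (intervalIntegral.integral_mono_on ht.1 ((hc _).intervalIntegrable _ _)
            ((hc B2).intervalIntegrable _ _) fun τ _ => ?_).trans ?_
          · have := hB2 (cube N)
            gcongr
          · refine intervalIntegral.integral_mono_interval le_rfl ht.1 ht.2 ?_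
              ((hc B2).intervalIntegrable _ _)
            refine Filter.Eventually.of_forall fun τ => mul_nonneg hKH (add_nonneg ?_ (hs τ))
            positivity
        have := En_nonneg (cube N) (2 * p) a0
        have := hB' (cube N)
        gcongr
      · exact ⟨0, fun N _ t ht => absurd (ht.1.trans ht.2) hT⟩)
    (fun i p T => (hw i).exists_dec p T) (bw_lipschitz hw)
  have hlarge : ∀ T : ℝ, ∀ᶠ N : ℕ in (Filter.hyperfilter ℕ : Filter ℕ), T ≤ N := fun T =>
    (tendsto_natCast_atTop_atTop.eventually_ge_atTop T).filter_mono Nat.hyperfilter_le_atTop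
  have hcube : ∀ k ≠ (0 : K3), ∀ᶠ N : ℕ in (Filter.hyperfilter ℕ : Filter ℕ), k ∈ cube N :=
    fun k hk => (eventually_mem_cube hk).filter_mono Nat.hyperfilter_le_atTop
  have hv0 : ∀ t, 0 ≤ t → ∀ i, v t 0 i = 0 := fun t ht i => by
    refine tendsto_nhds_unique (hv t ht 0 i) ?_
    simp only [haz _ t 0 (zero_notMem_cube _)]
    exact tendsto_const_nhds
  refine ⟨v, hvd, hvr, fun k i => ?_, hv0, fun t ht k i => ?_, fun t ht k => ?_, ?_⟩
  · by_cases hk : k = 0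
    · rw [hk, hv0 0 le_rfl, hz0]
    · refine tendsto_nhds_unique (hv 0 le_rfl k i) (tendsto_const_nhds.congr' ?_)
      filter_upwards [hcube k hk] with N hN
      exact (ha0 N k hN i).symm
  · refine tendsto_nhds_unique (hv t ht (-k) i)
      (((Complex.continuous_conj.tendsto _).comp (hv t ht k i)).congr' ?_)
    filter_upwards [hlarge t] with N hN
    exact (hsym N t ⟨ht, hN⟩ k i).symm
  · refine tendsto_nhds_unique
      (tendsto_finsetSum Finset.univ fun j _ => (hv t ht k j).const_mul (k j : ℂ))
      (tendsto_const_nhds.congr' ?_)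
    filter_upwards [hlarge t] with N hN
    exact (hdiv N t ⟨ht, hN⟩ k).symm
  · intro m hm B hB t ht Λ hΛ
    refine le_of_tendsto (tendsto_En Λ m (hv t ht)) ?_
    have hsub : ∀ᶠ N : ℕ in (Filter.hyperfilter ℕ : Filter ℕ), ∀ k ∈ Λ, k ∈ cube N :=
      (Filter.eventually_all_finset Λ).2 fun k hk => hcube k fun h => hΛ (h ▸ hk)
    filter_upwards [hlarge t, hsub] with N hN hN'
    refine (En_subset hN' m _).trans ((hlow N m hm t ⟨ht, hN⟩).trans ?_)
    have := hQ.one_le m ht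
    have := hB (cube N)
    gcongr

/-! ### Smoothness in time of rapidly decaying coefficients -/

lemma hasFDerivWithinAt_tsum_of_convex {ι E F : Type*} [NormedAddCommGroup E] [NormedSpace ℝ E]
    [NormedAddCommGroup F] [NormedSpace ℝ F] [CompleteSpace F] {f : ι → E → F}
    {f' : ι → E → E →L[ℝ] F} {S : Set E} (hS : Convex ℝ S) {u : ι → ℝ} (hu : Summable u)
    (hf : ∀ n, ∀ y ∈ S, HasFDerivWithinAt (f n) (f' n y) S y) (hb : ∀ n, ∀ y ∈ S, ‖f' n y‖ ≤ u n)
    (hs : ∀ y ∈ S, Summable fun n => f n y) {x : E} (hx : x ∈ S) :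
    HasFDerivWithinAt (fun y => ∑' n, f n y) (∑' n, f' n x) S x := by
  have hs' : Summable fun n => f' n x := .of_norm_bounded hu fun n => hb n x hx
  have hT : Filter.Tendsto (fun y => ∑' n, ‖y - x‖⁻¹ * ‖f n y - f n x - f' n x (y - x)‖)
      (nhdsWithin x S) (nhds (∑' _ : ι, (0:ℝ))) := by
    refine tendsto_tsum_of_dominated_convergence (bound := fun n => 2 * u n) (hu.mul_left 2)
      (fun n => hasFDerivWithinAt_iff_tendsto.1 (hf n x hx)) ?_
    filter_upwards [self_mem_nhdsWithin] with y hy n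
    have hu0 : 0 ≤ u n := (norm_nonneg _).trans (hb n x hx)
    have h1 := hS.norm_image_sub_le_of_norm_hasFDerivWithin_le (hf n) (hb n) hx hy
    have h2 : ‖f' n x (y - x)‖ ≤ u n * ‖y - x‖ :=
      (f' n x).le_of_opNorm_le (hb n x hx) _
    rw [norm_mul, norm_inv, norm_norm, norm_norm]
    by_cases h0 : y - x = 0
    · simp [h0, hu0]
    · rw [inv_mul_le_iff₀ (norm_pos_iff.2 h0)]
      refine (norm_sub_le _ _).trans ?_
      linarith
  rw [tsum_zero] at hT
  rw [hasFDerivWithinAt_iff_tendsto]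
  refine squeeze_zero' (Filter.Eventually.of_forall fun y => by positivity) ?_ hT
  filter_upwards [self_mem_nhdsWithin] with y hy
  have hs2 : Summable fun n => f' n x (y - x) := hs'.map (ContinuousLinearMap.apply ℝ F (y - x))
    (ContinuousLinearMap.apply ℝ F (y - x)).continuous
  have e : (∑' n, f' n x) (y - x) = ∑' n, f' n x (y - x) :=
    (ContinuousLinearMap.apply ℝ F (y - x)).map_tsum hs'
  rw [e, ← (hs y hy).tsum_sub (hs x hx), ← ((hs y hy).sub (hs x hx)).tsum_sub hs2, tsum_mul_left]
  refine mul_le_mul_of_nonneg_left (norm_tsum_le_tsum_norm ?_) (by positivity)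
  refine Summable.of_nonneg_of_le (fun _ => norm_nonneg _) (fun n => ?_)
    (hu.mul_right (2 * ‖y - x‖))
  have h1 := hS.norm_image_sub_le_of_norm_hasFDerivWithin_le (hf n) (hb n) hx hy
  have h2 : ‖f' n x (y - x)‖ ≤ u n * ‖y - x‖ := (f' n x).le_of_opNorm_le (hb n x hx) _
  refine (norm_sub_le _ _).trans ?_
  linarith

lemma RD.add {c d : ℝ → K3 → ℂ} (hc : RD c) (hd : RD d) : RD fun t k => c t k + d t k :=
  fun p T => by
  obtain ⟨A, hA⟩ := hc p T
  obtain ⟨B, hB⟩ := hd p T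
  exact ⟨A + B, fun t ht => (hA t ht).add (hB t ht)⟩

lemma RD.mul {c : ℝ → K3 → ℂ} (hc : RD c) {μ : K3 → ℂ} {M : ℝ} {s : ℕ} (hM : 0 ≤ M)
    (hμ : ∀ k, ‖μ k‖ ≤ M * J k ^ s) : RD fun t k => μ k * c t k := fun p T => by
  obtain ⟨A, hA⟩ := hc (p + s) T
  exact ⟨M * A, fun t ht => (hA t ht).smul hμ hM⟩

lemma RD.cv {c d : ℝ → K3 → ℂ} (hc : RD c) (hd : RD d) : RD fun t => cv (c t) (d t) :=
  fun p T => by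
  obtain ⟨A, hA⟩ := hc (p + 2) T
  obtain ⟨B, hB⟩ := hd p T
  exact ⟨_, fun t ht => cv_dec (hA t ht) (hB t ht)⟩

/-- `Der c c'` says that the coefficients `c` have the time derivatives `c'`. -/
def Der (c c' : ℝ → K3 → ℂ) : Prop :=
  ∀ t, 0 ≤ t → ∀ k, HasDerivWithinAt (fun t => c t k) (c' t k) (Ici 0) t

lemma Der.cv {c c' d d' : ℝ → K3 → ℂ} (hc : RD c) (hc' : RD c') (hd : RD d) (hd' : RD d')
    (h : Der c c') (h' : Der d d') :
    Der (fun t => NSE.cv (c t) (d t))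
      (fun t k => NSE.cv (c' t) (d t) k + NSE.cv (c t) (d' t) k) := by
  intro t ht k
  obtain ⟨A, hA⟩ := hc 2 (t + 1)
  obtain ⟨A', hA'⟩ := hc' 2 (t + 1)
  obtain ⟨B, hB⟩ := hd 0 (t + 1)
  obtain ⟨B', hB'⟩ := hd' 0 (t + 1)
  have htT : t ∈ Icc 0 (t + 1) := ⟨ht, by linarith⟩
  refine hasDerivWithinAt_Ici (T := t + 1) (by linarith) ?_
  have h1 := hasFDerivWithinAt_tsum_of_convex (convex_Icc 0 (t + 1))
    (f := fun l t => c t l * d t (k - l))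
    (f' := fun l t => ContinuousLinearMap.toSpanSingleton ℝ
      (c' t l * d t (k - l) + c t l * d' t (k - l)))
    (u := fun l => 2 ^ 0 * A' * B * (J l ^ 2)⁻¹ + 2 ^ 0 * A * B' * (J l ^ 2)⁻¹)
    ((summable_J.mul_left _).add (summable_J.mul_left _))
    (fun l s hs => (((h s hs.1 l).mono Icc_subset_Ici_self).mul
      ((h' s hs.1 (k - l)).mono Icc_subset_Ici_self)).hasFDerivWithinAt)
    (fun l s hs => by
      rw [ContinuousLinearMap.norm_toSpanSingleton]
      have e1 := cv_term_le (p := 0) (hA' s hs) (hB s hs) k l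
      have e2 := cv_term_le (p := 0) (hA s hs) (hB' s hs) k l
      rw [pow_zero, mul_one] at e1 e2
      exact (norm_add_le _ _).trans (add_le_add e1 e2))
    (fun s hs => (cv_summable (hA s hs) (hB s hs) k).of_norm) htT
  have s1 := (cv_summable (hA' t htT) (hB t htT) k).of_norm
  have s2 := (cv_summable (hA t htT) (hB' t htT) k).of_norm
  have h2 := h1.hasDerivWithinAt
  refine h2.congr_deriv ?_
  have s3 : Summable fun l => ContinuousLinearMap.toSpanSingleton ℝ
      (c' t l * d t (k - l) + c t l * d' t (k - l)) :=
    .of_norm (by simpa only [ContinuousLinearMap.norm_toSpanSingleton] using (s1.add s2).norm)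
  rw [← ContinuousLinearMap.apply_apply (1:ℝ), ContinuousLinearMap.map_tsum _ s3]
  simpa [NSE.cv] using s1.tsum_add s2

/-- `Sm n c` says that `c` and its first `n` time derivatives decay rapidly in frequency. -/
def Sm : ℕ → (ℝ → K3 → ℂ) → Prop
  | 0, c => RD c
  | n + 1, c => RD c ∧ ∃ c', Sm n c' ∧ Der c c'

lemma Sm.rd {n : ℕ} {c : ℝ → K3 → ℂ} (h : Sm n c) : RD c := by
  cases n with
  | zero => exact h
  | succ n => exact h.1

lemma Sm.pred {n : ℕ} {c : ℝ → K3 → ℂ} (h : Sm (n + 1) c) : Sm n c := by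
  induction n generalizing c with
  | zero => exact h.1
  | succ n ih =>
    obtain ⟨h1, c', h2, h3⟩ := h
    exact ⟨h1, c', ih h2, h3⟩

lemma Sm.add {n : ℕ} {c d : ℝ → K3 → ℂ} (hc : Sm n c) (hd : Sm n d) :
    Sm n fun t k => c t k + d t k := by
  induction n generalizing c d with
  | zero => exact RD.add hc hd
  | succ n ih =>
    obtain ⟨h1, c', h2, h3⟩ := hc
    obtain ⟨g1, d', g2, g3⟩ := hd
    exact ⟨h1.add g1, _, ih h2 g2, fun t ht k => (h3 t ht k).add (g3 t ht k)⟩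

lemma Sm.mul {n : ℕ} {c : ℝ → K3 → ℂ} (hc : Sm n c) {μ : K3 → ℂ} {M : ℝ} {s : ℕ} (hM : 0 ≤ M)
    (hμ : ∀ k, ‖μ k‖ ≤ M * J k ^ s) : Sm n fun t k => μ k * c t k := by
  induction n generalizing c with
  | zero => exact RD.mul hc hM hμ
  | succ n ih =>
    obtain ⟨h1, c', h2, h3⟩ := hc
    exact ⟨h1.mul hM hμ, _, ih h2, fun t ht k => (h3 t ht k).const_mul _⟩

lemma Sm.cv {n : ℕ} {c d : ℝ → K3 → ℂ} (hc : Sm n c) (hd : Sm n d) :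
    Sm n fun t => cv (c t) (d t) := by
  induction n generalizing c d with
  | zero => exact RD.cv hc hd
  | succ n ih =>
    obtain ⟨h1, c', h2, h3⟩ := id hc
    obtain ⟨g1, d', g2, g3⟩ := id hd
    exact ⟨h1.cv g1, _, (ih h2 hd.pred).add (ih hc.pred g2), Der.cv h1 h2.rd g1 g2.rd h3 g3⟩

lemma Sm.sum {n : ℕ} {c : Fin 3 → ℝ → K3 → ℂ} (hc : ∀ j, Sm n (c j)) :
    Sm n fun t k => ∑ j, c j t k := by
  simp only [Fin.sum_univ_three]
  exact ((hc 0).add (hc 1)).add (hc 2)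

lemma Sm.coord {n : ℕ} {c : ℝ → K3 → ℂ} (hc : Sm n c) (j : Fin 3) :
    Sm n fun t k => (k j : ℂ) * c t k :=
  hc.mul (M := 1) (s := 1) zero_le_one fun k => by
    rw [Complex.norm_intCast]
    simpa using abs_le_J k j

lemma norm_mul_div_q_le (k : K3) (i j : Fin 3) : ‖-((k i : ℂ) * k j / q k)‖ ≤ 1 := by
  rw [norm_neg, norm_div, norm_mul, Complex.norm_intCast, Complex.norm_intCast, Complex.norm_real,
    Real.norm_of_nonneg (q_nonneg k)]
  exact div_le_one_of_le₀ (abs_mul_le_q k i j) (q_nonneg k)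

lemma Sm.pr {n : ℕ} {c : ℝ → K3 → Fin 3 → ℂ} (hc : ∀ i, Sm n fun t k => c t k i) (i : Fin 3) :
    Sm n fun t k => Pr k (c t k) i := by
  have h := (hc i).add (Sm.sum fun j => (hc j).mul (μ := fun k => -((k i : ℂ) * k j / q k))
    (M := 1) (s := 0) zero_le_one fun k => by simpa using norm_mul_div_q_le k i j)
  convert h using 3 with t k
  rw [Pr, sub_eq_add_neg, Finset.mul_sum, Finset.sum_div, ← Finset.sum_neg_distrib]
  congr 1
  exact Finset.sum_congr rfl fun j _ => by ring

lemma Sm.nsf {n : ℕ} {c : ℝ → K3 → Fin 3 → ℂ} (hc : ∀ i, Sm n fun t k => c t k i) (ν : ℝ)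
    (i : Fin 3) : Sm n fun t k => NSF ν (c t) k i := by
  refine Sm.pr (c := fun t k i => -((ν * q k : ℝ) : ℂ) * c t k i - Complex.I * ∑ j, (k j : ℂ) *
    NSE.cv (fun l => c t l j) (fun l => c t l i) k) (fun i => ?_) i
  have h1 := (hc i).mul (μ := fun k => -((ν * q k : ℝ) : ℂ)) (M := |ν|) (s := 1) (abs_nonneg ν)
    fun k => by
      rw [norm_neg, Complex.norm_real, norm_mul, Real.norm_eq_abs, Real.norm_of_nonneg (q_nonneg k)]
      refine mul_le_mul_of_nonneg_left ?_ (abs_nonneg ν)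
      simp [J]
  have h2 := (Sm.sum fun j => ((hc j).cv (hc i)).coord j).mul (μ := fun _ => -Complex.I) (M := 1)
    (s := 0) zero_le_one fun k => by simp
  convert h1.add h2 using 3 with t k
  ring

/-- Solutions of the Navier–Stokes equations in Fourier variables are smooth in time. -/
lemma Sm.of_nsf {ν : ℝ} {c : ℝ → K3 → Fin 3 → ℂ} (hc : ∀ i, RD fun t k => c t k i)
    (hd : ∀ t, 0 ≤ t → ∀ k i, HasDerivWithinAt (fun t => c t k i) (NSF ν (c t) k i) (Ici 0) t)
    (n : ℕ) (i : Fin 3) : Sm n fun t k => c t k i := by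
  induction n generalizing i with
  | zero => exact hc i
  | succ n ih => exact ⟨hc i, _, Sm.nsf ih ν i, fun t ht k => hd t ht k i⟩

lemma TS.sm_fc {f : E3 → ℝ → ℝ} (h : TS f) (n : ℕ) : Sm n fun t => fc fun x => f x t := by
  induction n generalizing f with
  | zero => exact fun p T => h.exists_dec p T
  | succ n ih => exact ⟨fun p T => h.exists_dec p T, _, ih h.dt, fun t ht k => h.hasDerivWithinAt_fc k ht⟩

/-! ### Synthesis of smooth functions -/

/-- The Fourier series with time-dependent coefficients `c`. -/
def US (c : ℝ → K3 → ℂ) (p : E3 × ℝ) : ℂ := ∑' k, c p.2 k * ee k p.1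

lemma hasFDerivWithinAt_US {c c' : ℝ → K3 → ℂ} (hc : RD c) (hc' : RD c') (h : Der c c')
    {p : E3 × ℝ} (hp : p ∈ ST) :
    HasFDerivWithinAt (US c)
      (∑ j, (US (fun t k => Complex.I * (k j * c t k)) p) •
          (Complex.ofRealCLM.comp ((ContinuousLinearMap.proj j).comp (ContinuousLinearMap.fst ℝ E3 ℝ))) +
        (US c' p) • (Complex.ofRealCLM.comp (ContinuousLinearMap.snd ℝ E3 ℝ))) ST p := by
  obtain ⟨x, t⟩ := p
  have ht : 0 ≤ t := hp.2
  set ρ : Fin 3 → (E3 × ℝ →L[ℝ] ℂ) := fun j => Complex.ofRealCLM.comp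
    ((ContinuousLinearMap.proj j).comp (ContinuousLinearMap.fst ℝ E3 ℝ)) with hρ
  set σ : E3 × ℝ →L[ℝ] ℂ := Complex.ofRealCLM.comp (ContinuousLinearMap.snd ℝ E3 ℝ) with hσ
  set T := t + 1
  have hrd : ∀ j : Fin 3, RD fun t (k : K3) => Complex.I * (k j * c t k) := fun j =>
    (Sm.coord (n := 0) hc j).mul (n := 0) (M := 1) (s := 0) zero_le_one (μ := fun _ => Complex.I)
      fun k => by simp
  obtain ⟨A, hA⟩ := hc 2 T
  obtain ⟨A', hA'⟩ := hc' 2 T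
  choose B hB using fun j => hrd j 2 T
  have htT : t ∈ Icc 0 T := ⟨ht, by simp [T]⟩
  have hsum : ∀ {d : K3 → ℂ} {A : ℝ}, Dec 2 A d → ∀ x, Summable fun k => d k * ee k x :=
    fun hd x => .of_norm (by simpa [norm_mul, norm_ee] using hd.summable)
  have key := hasFDerivWithinAt_tsum_of_convex (S := univ ×ˢ Icc 0 T)
    (convex_univ.prod (convex_Icc 0 T)) (x := (x, t))
    (f := fun k p => c p.2 k * ee k p.1)
    (f' := fun k p => ∑ j, ((Complex.I * (k j * c p.2 k)) * ee k p.1) • ρ j +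
      (c' p.2 k * ee k p.1) • σ)
    (u := fun k => (∑ j, B j * ‖ρ j‖ + A' * ‖σ‖) * (J k ^ 2)⁻¹)
    (summable_J.mul_left _) (fun k p hp => ?_) (fun k p hp => ?_)
    (fun p hp => hsum (hA p.2 hp.2) p.1) ⟨mem_univ _, htT⟩
  · have e : ∑' k, (∑ j, ((Complex.I * (k j * c t k)) * ee k x) • ρ j + (c' t k * ee k x) • σ) =
        ∑ j, (US (fun t k => Complex.I * (k j * c t k)) (x, t)) • ρ j + (US c' (x, t)) • σ := by
      refine HasSum.tsum_eq (HasSum.add (hasSum_sum fun j _ => ?_) ?_)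
      · exact (hsum (hB j t htT) x).hasSum.smul_const (ρ j)
      · exact (hsum (hA' t htT) x).hasSum.smul_const σ
    simp only at key
    rw [e] at key
    refine key.mono_of_mem_nhdsWithin ?_
    have h1 : (univ : Set E3) ×ˢ Iio T ∈ nhds (x, t) :=
      prod_mem_nhds Filter.univ_mem (Iio_mem_nhds (by simp [T]))
    filter_upwards [mem_nhdsWithin_of_mem_nhds h1, self_mem_nhdsWithin] with y hy1 hy2
    exact ⟨mem_univ _, hy2.2, hy1.2.le⟩
  · have h1 : HasFDerivWithinAt (fun p : E3 × ℝ => c p.2 k)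
        ((ContinuousLinearMap.toSpanSingleton ℝ (c' p.2 k)).comp (ContinuousLinearMap.snd ℝ E3 ℝ))
        (univ ×ˢ Icc 0 T) p :=
      HasFDerivWithinAt.comp (t := Ici 0) p (h p.2 hp.2.1 k).hasFDerivWithinAt
        hasFDerivWithinAt_snd fun y hy => hy.2.1
    have h2 : HasFDerivWithinAt (fun p : E3 × ℝ => ee k p.1)
        ((ee k p.1 • phase k).comp (ContinuousLinearMap.fst ℝ E3 ℝ))
        (univ ×ˢ Icc 0 T) p :=
      ((hasFDerivAt_ee k p.1).comp p hasFDerivAt_fst).hasFDerivWithinAt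
    refine (h1.mul h2).congr_fderiv ?_
    ext v
    · simp [hρ, hσ, phase_apply, Finset.mul_sum]
      exact Finset.sum_congr rfl fun i _ => by ring
    · simp [hρ, hσ]
      ring
  · refine (norm_add_le _ _).trans ?_
    rw [add_mul, Finset.sum_mul]
    refine add_le_add (norm_sum_le_of_le _ fun j _ => ?_) ?_
    · rw [norm_smul, norm_mul, norm_ee, mul_one, mul_right_comm]
      exact mul_le_mul_of_nonneg_right ((hB j p.2 hp.2).le k) (norm_nonneg _)
    · rw [norm_smul, norm_mul, norm_ee, mul_one, mul_right_comm]
      exact mul_le_mul_of_nonneg_right ((hA' p.2 hp.2).le k) (norm_nonneg _)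

lemma contDiffOn_US {n : ℕ} {c : ℝ → K3 → ℂ} (hc : Sm (n + 1) c) : ContDiffOn ℝ n (US c) ST := by
  induction n generalizing c with
  | zero =>
    obtain ⟨h1, c', h2, h3⟩ := hc
    rw [Nat.cast_zero, contDiffOn_zero]
    exact fun p hp => (hasFDerivWithinAt_US h1 h2.rd h3 hp).continuousWithinAt
  | succ n ih =>
    obtain ⟨h1, c', h2, h3⟩ := id hc
    rw [Nat.cast_add, Nat.cast_one, contDiffOn_succ_iff_hasFDerivWithinAt_of_uniqueDiffOn uniqueDiffOn_ST]
    refine ⟨by simp, _, ?_, fun p hp => hasFDerivWithinAt_US h1 h2.rd h3 hp⟩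
    refine ContDiffOn.add (ContDiffOn.sum fun j _ => ContDiffOn.smul (ih ?_) contDiffOn_const)
      (ContDiffOn.smul (ih h2) contDiffOn_const)
    exact (hc.pred.coord j).mul (M := 1) (s := 0) zero_le_one (μ := fun _ => Complex.I)
      fun k => by simp

/-- The real part of the Fourier series with time-dependent coefficients `c`. -/
def RS (c : ℝ → K3 → ℂ) (x : E3) (t : ℝ) : ℝ := (US c (x, t)).re

lemma TS.rs {c : ℝ → K3 → ℂ} (hc : ∀ n, Sm n c) : TS (RS c) where
  sm := by
    refine contDiffOn_infty.2 fun n => ?_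
    exact Complex.reCLM.contDiff.comp_contDiffOn (contDiffOn_US (hc (n + 1)))
  per t x j := by simp only [RS, US, ee_periodic _ x j]

lemma fc_rs {c : ℝ → K3 → ℂ} (hc : RD c) {t : ℝ} (ht : 0 ≤ t)
    (hs : ∀ k, c t (-k) = (starRingEnd ℂ) (c t k)) (k : K3) : fc (fun x => RS c x t) k = c t k := by
  obtain ⟨A, hA⟩ := hc 2 t
  have h1 := (hA t ⟨ht, le_rfl⟩).summable
  rw [fc, ← FC_tsum h1 k]
  congr 1
  funext x
  refine Complex.conj_eq_iff_re.1 ?_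
  rw [US, Complex.conj_tsum, ← (Equiv.neg K3).tsum_eq]
  refine tsum_congr fun k => ?_
  simp [hs, ee_neg]

/-! ### Navier–Stokes solutions from their Fourier coefficients -/

lemma eq_of_fc {f g : E3 → ℝ} (hf : ContDiff ℝ (⊤ : ℕ∞) f) (hpf : SpacePeriodic f)
    (hg : ContDiff ℝ (⊤ : ℕ∞) g) (hpg : SpacePeriodic g) (h : ∀ k, fc f k = fc g k) : f = g := by
  funext x
  have h1 := hasSum_fc hf hpf x
  simp only [h] at h1
  exact_mod_cast h1.unique (hasSum_fc hg hpg x)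

lemma TS.const_mul {f : E3 → ℝ → ℝ} (h : TS f) (a : ℝ) : TS fun x t => a * f x t where
  sm := contDiffOn_const.mul h.sm
  per t x j := by
    have := h.per t x j
    simp only at this ⊢
    rw [this]

lemma fc_convection {u : E3 → ℝ → E3} (hu : ∀ i, TS fun x t => u x t i) {t : ℝ} (ht : 0 ≤ t)
    (hd : ∀ k : K3, ∑ j, (k j : ℂ) * bw u t k j = 0) (i : Fin 3) (k : K3) :
    fc (fun x => ∑ j, u x t j * pd j (fun y => u y t i) x) k =
      Complex.I * ∑ j, (k j : ℂ) * cv (fun l => bw u t l j) (fun l => bw u t l i) k := by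
  obtain ⟨A, hA⟩ : ∃ A, ∀ j, Dec 3 A fun l => bw u t l j := by
    choose A hA using fun j => exists_fc_dec ((hu j).slice ht) ((hu j).per t) 3
    exact ⟨∑ j, A j, fun j => (hA j).mono le_rfl (Finset.single_le_sum (f := A)
      (fun j _ => (hA j).nonneg) (Finset.mem_univ j))⟩
  have cp : ∀ j, Continuous (pd j fun y => u y t i) := fun j =>
    (contDiff_pd ((hu i).slice ht) j).continuous
  have cm : ∀ j, Continuous fun x => u x t j * pd j (fun y => u y t i) x := fun j =>
    ((hu j).slice ht).continuous.mul (cp j)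
  rw [fc_sum _ fun j _ => cm j, cv_div hA hd, Finset.mul_sum]
  refine Finset.sum_congr rfl fun j _ => ?_
  rw [fc_mul ((hu j).slice ht) ((hu j).per t) (cp j), cv, cv, ← tsum_mul_left]
  refine tsum_congr fun l => ?_
  rw [fc_pd ((hu i).slice ht) ((hu i).per t)]
  simp only [bw]
  ring

lemma norm_coord_div_q_le (k : K3) (j : Fin 3) : ‖-(Complex.I * (k j : ℂ) / q k)‖ ≤ 1 := by
  rw [norm_neg, norm_div, norm_mul, Complex.norm_I, one_mul, Complex.norm_intCast,
    Complex.norm_real, Real.norm_of_nonneg (q_nonneg k)]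
  refine div_le_one_of_le₀ (le_trans ?_ (sq_le_q k j)) (q_nonneg k)
  have h : |k j| ≤ k j ^ 2 := by
    rw [← sq_abs]
    rcases (abs_nonneg (k j)).eq_or_lt with h0 | h0
    · rw [← h0]; norm_num
    · nlinarith
  exact_mod_cast h

theorem exists_solution_of_coeff {ν : ℝ} {c : ℝ → K3 → Fin 3 → ℂ} (hc : ∀ i, RD fun t k => c t k i)
    (hd : ∀ t, 0 ≤ t → ∀ k i, HasDerivWithinAt (fun t => c t k i) (NSF ν (c t) k i) (Ici 0) t)
    (hsym : ∀ t, 0 ≤ t → ∀ k i, c t (-k) i = (starRingEnd ℂ) (c t k i))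
    (hdiv : ∀ t, 0 ≤ t → ∀ k, ∑ j, (k j : ℂ) * c t k j = 0) :
    ∃ (u : E3 → ℝ → E3) (P : E3 → ℝ → ℝ), (∀ i, TS fun x t => u x t i) ∧ TS P ∧
      IsNS ν (Ici 0) u P ∧ ∀ t, 0 ≤ t → ∀ k i, bw u t k i = c t k i := by
  set u : E3 → ℝ → E3 := fun x t i => RS (fun t k => c t k i) x t with hu_def
  have hu : ∀ i, TS fun x t => u x t i := fun i => TS.rs fun n => Sm.of_nsf hc hd n i
  have hbw : ∀ t, 0 ≤ t → ∀ k i, bw u t k i = c t k i := fun t ht k i =>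
    fc_rs (hc i) ht (fun k => hsym t ht k i) k
  have hbw' : ∀ t, 0 ≤ t → bw u t = c t := fun t ht => by
    funext k i
    exact hbw t ht k i
  set N : Fin 3 → E3 → ℝ → ℝ := fun i x t => ∑ j, u x t j * pd j (fun y => u y t i) x with hN_def
  have hN : ∀ i, TS (N i) := fun i => TS.sum _ fun j _ => (hu j).mul ((hu i).pd j)
  set Z : Fin 3 → E3 → ℝ → ℝ := fun i x t => ν * lap (fun y => u y t i) x - N i x t with hZ_def
  have hZ : ∀ i, TS (Z i) := fun i => ((hu i).lap.const_mul ν).sub (hN i)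
  have hz : ∀ t, 0 ≤ t → ∀ i k, fc (fun x => Z i x t) k = -((ν * q k : ℝ) : ℂ) * c t k i -
      Complex.I * ∑ j, (k j : ℂ) * cv (fun l => c t l j) (fun l => c t l i) k := fun t ht i k => by
    have e := fc_convection hu ht (by rw [hbw' t ht]; exact hdiv t ht) i k
    rw [hbw' t ht] at e
    have e1 : fc (fun x => u x t i) k = c t k i := hbw t ht k i
    rw [fc_sub (f := fun x => ν * lap (fun y => u y t i) x) (g := fun x => N i x t)
      (((hu i).lap.const_mul ν).slice ht).continuous ((hN i).slice ht).continuous, e,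
      fc_const_mul, fc_lap ((hu i).slice ht) ((hu i).per t), e1]
    push_cast
    ring
  set p : ℝ → K3 → ℂ := fun t k =>
    ∑ j, -(Complex.I * (k j : ℂ) / q k) * fc (fun x => Z j x t) k with hp_def
  have hpS : ∀ n, Sm n p := fun n => Sm.sum fun j => ((hZ j).sm_fc n).mul (M := 1) (s := 0)
    zero_le_one (μ := fun k => -(Complex.I * (k j : ℂ) / q k)) fun k => by
      simpa using norm_coord_div_q_le k j
  have hP : TS (RS p) := TS.rs hpS
  have hpsym : ∀ t k, p t (-k) = (starRingEnd ℂ) (p t k) := fun t k => by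
    simp only [hp_def, fc_neg, map_sum, map_mul, map_neg, map_div₀, Complex.conj_I,
      Complex.conj_ofReal, q_neg, Pi.neg_apply, Int.cast_neg, map_intCast]
    exact Finset.sum_congr rfl fun j _ => by ring
  refine ⟨u, RS p, hu, hP, ⟨fun t ht x i => ?_, fun t ht x => ?_⟩, hbw⟩
  · have e : (fun x => dt (fun x t => u x t i) x t) =
        fun x => Z i x t - pd i (fun y => RS p y t) x := by
      have hr := (hZ i).sub (hP.pd i)
      refine eq_of_fc ((hu i).dt.slice ht) ((hu i).dt.per t) (hr.slice ht) (hr.per t) fun k => ?_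
      have h1 := (hu i).hasDerivWithinAt_fc k ht
      have h2 := (hd t ht k i).congr (fun s hs => hbw s hs k i) (hbw t ht k i)
      rw [(uniqueDiffOn_Ici (0:ℝ) t ht).eq_deriv _ h1 h2,
        fc_sub ((hZ i).slice ht).continuous (contDiff_pd (hP.slice ht) i).continuous,
        fc_pd (hP.slice ht) (hP.per t), fc_rs (hpS 0).rd ht (hpsym t)]
      rw [NSF, Pr]
      simp only [← hz t ht, hp_def]
      congr 1
      rw [Finset.mul_sum, Finset.mul_sum, Finset.sum_div]
      refine Finset.sum_congr rfl fun j _ => ?_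
      ring_nf
      rw [Complex.I_sq]
      ring
    have e2 := congrFun e x
    simp only [hZ_def, hN_def, dt] at e2
    linarith
  · have hv : TS fun x t => ∑ j, pd j (fun y => u y t j) x := TS.sum _ fun j _ => (hu j).pd j
    have h0 : ContDiff ℝ (⊤ : ℕ∞) fun _ : E3 => (0:ℝ) := contDiff_const
    refine congrFun (eq_of_fc (hv.slice ht) (hv.per t) h0 (fun _ _ => rfl) fun k => ?_) x
    rw [fc_sum _ fun j _ => (contDiff_pd ((hu j).slice ht) j).continuous]
    have e1 : ∀ j, fc (pd j fun y => u y t j) k = Complex.I * (k j * c t k j) := fun j => by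
      rw [fc_pd ((hu j).slice ht) ((hu j).per t), mul_assoc, ← hbw t ht]
      rfl
    have e2 : fc (fun _ => (0:ℝ)) k = 0 := by simp [fc, FC]
    rw [e2, Finset.sum_congr rfl fun j _ => e1 j, ← Finset.mul_sum, hdiv t ht k, mul_zero]

/-! ### Sobolev norms in Fourier variables -/

lemma integral_gradSq_nonneg (f : E3 → E3) (m : ℕ) : 0 ≤ ∫ x in T3, gradSq m f x :=
  integral_nonneg fun _ => Finset.sum_nonneg fun _ _ => Finset.sum_nonneg fun _ _ => sq_nonneg _

lemma HnormSq_nonneg (f : E3 → E3) (m : ℕ) : 0 ≤ HnormSq m f :=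
  Finset.sum_nonneg fun j _ => integral_gradSq_nonneg f j

lemma En_le_HnormSq {f : E3 → E3} (hf : ∀ i, ContDiff ℝ (⊤ : ℕ∞) fun x => f x i)
    (hp : ∀ i, SpacePeriodic fun x => f x i) (m : ℕ) (Λ : Finset K3) :
    En Λ m (fun k i => fc (fun x => f x i) k) ≤ 3 ^ m * cT * HnormSq m f := by
  have hm : ∀ k, 0 ≤ ∑ β ∈ midx m, mon β k := fun k => Finset.sum_nonneg fun β _ => mon_nonneg β k
  have hs : ∀ k, 0 ≤ ∑ i, ‖fc (fun x => f x i) k‖ ^ 2 := fun k =>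
    Finset.sum_nonneg fun i _ => sq_nonneg _
  calc En Λ m (fun k i => fc (fun x => f x i) k)
      ≤ 3 ^ m * ∑ k ∈ Λ, (∑ β ∈ midx m, mon β k) * ∑ i, ‖fc (fun x => f x i) k‖ ^ 2 := by
        rw [En_eq, Finset.mul_sum]
        refine Finset.sum_le_sum fun k _ => ?_
        rw [← mul_assoc]
        exact mul_le_mul_of_nonneg_right (q_pow_le_sum_mon m k) (hs k)
    _ ≤ 3 ^ m * (cT * ∫ x in T3, gradSq m f x) := by
        gcongr
        exact sum_le_hasSum Λ (fun k _ => mul_nonneg (hm k) (hs k)) (hasSum_gradSq hf hp m)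
    _ ≤ 3 ^ m * (cT * HnormSq m f) := by
        have := cT_pos
        gcongr
        exact Finset.single_le_sum (f := fun j => ∫ x in T3, gradSq j f x)
          (fun j _ => integral_gradSq_nonneg f j) (Finset.self_mem_range_succ m)
    _ = _ := by ring

/-- The number of multi-indices of order at most `m`. -/
def numIdx (m : ℕ) : ℝ := ∑ j ∈ Finset.range (m + 1), ((midx j).card : ℝ)

lemma numIdx_nonneg (m : ℕ) : 0 ≤ numIdx m := Finset.sum_nonneg fun _ _ => Nat.cast_nonneg _

lemma numIdx_mono {m n : ℕ} (h : m ≤ n) : numIdx m ≤ numIdx n :=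
  Finset.sum_le_sum_of_subset_of_nonneg (Finset.range_mono (by omega)) fun _ _ _ => Nat.cast_nonneg _

lemma HnormSq_le_of_En {f : E3 → E3} (hf : ∀ i, ContDiff ℝ (⊤ : ℕ∞) fun x => f x i)
    (hp : ∀ i, SpacePeriodic fun x => f x i) (h0 : ∀ i, fc (fun x => f x i) 0 = 0) {m : ℕ} {B : ℝ}
    (hB : ∀ Λ : Finset K3, 0 ∉ Λ → En Λ m (fun k i => fc (fun x => f x i) k) ≤ B) :
    cT * HnormSq m f ≤ numIdx m * B := by
  rw [HnormSq, numIdx, Finset.mul_sum, Finset.sum_mul]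
  refine Finset.sum_le_sum fun j hj => ?_
  have hjm : j ≤ m := by
    have := Finset.mem_range.1 hj
    omega
  refine hasSum_le_of_sum_le (hasSum_gradSq hf hp j) fun Λ => ?_
  calc ∑ k ∈ Λ, (∑ β ∈ midx j, mon β k) * ∑ i, ‖fc (fun x => f x i) k‖ ^ 2
      = ∑ k ∈ Λ.erase 0, (∑ β ∈ midx j, mon β k) * ∑ i, ‖fc (fun x => f x i) k‖ ^ 2 := by
        refine (Finset.sum_erase _ ?_).symm
        simp [h0]
    _ ≤ ∑ k ∈ Λ.erase 0, (midx j).card * (q k ^ j * ∑ i, ‖fc (fun x => f x i) k‖ ^ 2) := by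
        refine Finset.sum_le_sum fun k _ => ?_
        rw [← mul_assoc]
        refine mul_le_mul_of_nonneg_right ?_ (Finset.sum_nonneg fun i _ => sq_nonneg _)
        simpa using Finset.sum_le_card_nsmul (midx j) (fun β => mon β k) _ fun β hβ => mon_le hβ k
    _ = (midx j).card * En (Λ.erase 0) j (fun k i => fc (fun x => f x i) k) := by
        rw [En_eq, Finset.mul_sum]
    _ ≤ (midx j).card * B := by
        gcongr
        exact (En_mono (Finset.notMem_erase _ _) hjm _).trans (hB _ (Finset.notMem_erase _ _))

lemma fc_vdiv {f : E3 → E3} (hf : ∀ i, ContDiff ℝ (⊤ : ℕ∞) fun x => f x i)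
    (hp : ∀ i, SpacePeriodic fun x => f x i) (hd : ∀ x, vdiv f x = 0) (k : K3) :
    ∑ j, (k j : ℂ) * fc (fun x => f x j) k = 0 := by
  have h1 : fc (vdiv f) k = 0 := by
    rw [show vdiv f = fun _ => 0 from funext hd]
    simp [fc, FC]
  have h2 : fc (vdiv f) k = ∑ j, Complex.I * k j * fc (fun x => f x j) k := by
    rw [show vdiv f = fun x => ∑ j, pd j (fun y => f y j) x from rfl,
      fc_sum _ fun j _ => (contDiff_pd (hf j) j).continuous]
    exact Finset.sum_congr rfl fun j _ => fc_pd (hf j) (hp j) j k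
  rw [h1] at h2
  simp only [mul_assoc, ← Finset.mul_sum] at h2
  exact (mul_eq_zero.1 h2.symm).resolve_left Complex.I_ne_zero

lemma periodic_coord {f : E3 → E3} (h : SpacePeriodic f) (i : Fin 3) :
    SpacePeriodic fun x => f x i := fun x j => congrFun (h x j) i

/-- A square-root form of the energy bound. -/
lemma sqrt_bound {H H0 C C0 K Qm Φ s : ℝ} (hC1 : K ≤ C ^ 2) (hC : 0 ≤ C) (hC0 : C0 ≤ C)
    (hQ : 0 ≤ Qm) (hΦ : 0 ≤ Φ) (hH0 : 0 ≤ H0)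
    (h : H ≤ K * Qm * exp (C0 * Φ) * H0 * exp (-(2 * s))) :
    √H ≤ C * Qm ^ ((1:ℝ) / 2) * exp (C * Φ) * √H0 * exp (-s) := by
  rw [← Real.sqrt_eq_rpow]
  refine Real.sqrt_le_iff.2 ⟨by positivity, h.trans ?_⟩
  have e : (C * √Qm * exp (C * Φ) * √H0 * exp (-s)) ^ 2 =
      C ^ 2 * Qm * exp (2 * (C * Φ)) * H0 * exp (-(2 * s)) := by
    rw [mul_pow, mul_pow, mul_pow, mul_pow, Real.sq_sqrt hQ, Real.sq_sqrt hH0, ← Real.exp_nat_mul,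
      ← Real.exp_nat_mul]
    push_cast
    ring_nf
  rw [e]
  have : C0 * Φ ≤ 2 * (C * Φ) := by nlinarith [mul_nonneg hC hΦ]
  gcongr

/-- The smallness condition in terms of squares. -/
lemma small_bound {H C C0 M Qi δ Φ : ℝ} (hC : 0 < C) (hC0 : C0 ≤ C)
    (hQ : 0 < Qi) (hδ : 0 < δ) (hΦ : 0 ≤ Φ) (hH : 0 ≤ H) (hMC : M ≤ δ * C ^ 2)
    (h : √H < C⁻¹ * Qi ^ (-(1:ℝ) / 2) * exp (-C * Φ)) : M * Qi * exp (C0 * Φ) * H ≤ δ := by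
  have h1 : H ≤ (C⁻¹ * Qi ^ (-(1:ℝ) / 2) * exp (-C * Φ)) ^ 2 :=
    (Real.sqrt_le_left (by positivity)).1 h.le
  have e : (C⁻¹ * Qi ^ (-(1:ℝ) / 2) * exp (-C * Φ)) ^ 2 =
      (C ^ 2)⁻¹ * Qi⁻¹ * exp (-(2 * (C * Φ))) := by
    have hq : (Qi ^ (-(1:ℝ) / 2)) ^ 2 = Qi⁻¹ := by
      rw [← Real.rpow_natCast, ← Real.rpow_mul hQ.le, ← Real.rpow_neg_one]
      norm_num
    rw [mul_pow, mul_pow, hq, ← Real.exp_nat_mul, inv_pow]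
    congr 2
    push_cast
    ring
  rw [e] at h1
  have h2 : exp (C0 * Φ) ≤ exp (2 * (C * Φ)) := by
    refine exp_le_exp.2 ?_
    nlinarith [mul_nonneg hC.le hΦ]
  calc M * Qi * exp (C0 * Φ) * H
      ≤ (δ * C ^ 2) * Qi * exp (2 * (C * Φ)) * ((C ^ 2)⁻¹ * Qi⁻¹ * exp (-(2 * (C * Φ)))) := by
        gcongr
    _ = δ := by
        rw [exp_neg]
        have := exp_pos (2 * (C * Φ))
        field_simp

end NSE

open NSE

/-- Theorem on stability for Navier–Stokes, with the recursive
quantities `Q`: the constant `C` depends only on `r`, `σ`, `ν`. -/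
theorem navier_stokes_stability
    (r : ℕ) (hr : 1 ≤ r) (σ ν : ℝ) (hσ : σ ∈ Set.Ioo (0:ℝ) 1) (hν : 0 < ν) :
    ∃ C : ℝ, 0 < C ∧
      ∀ (w : E3 → ℝ → E3) (Pw : E3 → ℝ → ℝ),
        SmoothOnTime w (Set.Ici 0) →
        SmoothOnTimeS Pw (Set.Ici 0) →
        (∀ t, SpacePeriodic (fun x => w x t)) →
        (∀ t, SpacePeriodic (fun x => Pw x t)) →
        IsNS ν (Set.Ici 0) w Pw →
        ZeroMean (fun x => w x 0) →
        (∀ m ≤ r, IntegrableOn (fun t => (wNormInf m w t) ^ 2) (Set.Ioi (0:ℝ))) →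
        ∀ u₀ : E3 → E3,
          ContDiff ℝ (⊤ : ℕ∞) u₀ → SpacePeriodic u₀ →
          (∀ x, vdiv u₀ x = 0) → ZeroMean u₀ →
          Hnorm r (fun x => u₀ x - w x 0) <
            C⁻¹ * (Qinf w r) ^ (-(1:ℝ)/2) *
              Real.exp (-C * ∫ t in Set.Ioi (0:ℝ), (wNormInf 0 w t) ^ 2) →
          ∃ (u : E3 → ℝ → E3) (P : E3 → ℝ → ℝ),
            SmoothOnTime u (Set.Ici 0) ∧
            SmoothOnTimeS P (Set.Ici 0) ∧
            (∀ t, SpacePeriodic (fun x => u x t)) ∧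
            (∀ t, SpacePeriodic (fun x => P x t)) ∧
            IsNS ν (Set.Ici 0) u P ∧
            (∀ x, u x 0 = u₀ x) ∧
            ∀ m ≤ r, ∀ t : ℝ, 0 < t →
              Hnorm m (fun x => u x t - w x t) ≤
                C * (Q w m t) ^ ((1:ℝ)/2) *
                  Real.exp (C * ∫ τ in Set.Ioi (0:ℝ), (wNormInf 0 w τ) ^ 2) *
                  Hnorm m (fun x => u₀ x - w x 0) * Real.exp (-ν * σ * t) := by
  obtain ⟨C0, δ, hC01, hδ, main⟩ := exists_perturbation hr hσ.1 hσ.2 hν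
  have hcT := cT_pos
  set K : ℝ := 3 ^ r * numIdx r * C0 with hK
  set M : ℝ := C0 * (3 ^ r * cT) with hM
  have hK0 : 0 ≤ K := by
    have := numIdx_nonneg r
    positivity
  have hM0 : 0 ≤ M := by positivity
  set C : ℝ := C0 + K + M / δ with hC
  have hMδ : 0 ≤ M / δ := by positivity
  have hC1 : 1 ≤ C := by linarith
  have hKC : K ≤ C ^ 2 := by nlinarith
  have hMC : M ≤ δ * C ^ 2 := by
    have h1 : M / δ ≤ C ^ 2 := by nlinarith
    rwa [div_le_iff₀' hδ] at h1
  refine ⟨C, by linarith, fun w Pw hws hPs hwp hPp hns hw0 hint u₀ hu₀ hup hud hu0 hsmall => ?_⟩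
  set Φ := ∫ t in Set.Ioi (0:ℝ), (wNormInf 0 w t) ^ 2 with hΦ
  have hΦ0 : 0 ≤ Φ := integral_nonneg fun _ => sq_nonneg _
  have hΦt : ∀ t, 0 ≤ t → ∫ τ in (0:ℝ)..t, wW w 0 τ ^ 2 ≤ Φ := fun t ht =>
    integral_le_Ioi (hint 0 (Nat.zero_le r)) ht
  have hQ1 : ∀ m t, 0 ≤ t → 1 ≤ Q w m t := fun m t ht => (isQ_wW w).one_le m ht
  have hw : ∀ i, TS fun x t => w x t i := TS.of_field hws hwp
  have hPw : TS Pw := ⟨hPs, hPp⟩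
  have hui : ∀ i, ContDiff ℝ (⊤ : ℕ∞) fun x => u₀ x i := contDiff_pi.1 hu₀
  have hwi : ∀ i, ContDiff ℝ (⊤ : ℕ∞) fun x => w x 0 i := fun i => (hw i).slice le_rfl
  have hwpi : ∀ t i, SpacePeriodic fun x => w x t i := fun t i => (hw i).per t
  set f0 : E3 → E3 := fun x => u₀ x - w x 0 with hf0
  have hf0s : ∀ i, ContDiff ℝ (⊤ : ℕ∞) fun x => f0 x i := fun i => (hui i).sub (hwi i)
  have hf0p : ∀ i, SpacePeriodic fun x => f0 x i := fun i x j => by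
    have h1 := periodic_coord hup i x j
    have h2 := hwpi 0 i x j
    simp only [hf0, Pi.sub_apply] at h1 h2 ⊢
    rw [h1, h2]
  set a0 : K3 → Fin 3 → ℂ := fun k i => fc (fun x => f0 x i) k with ha0
  have ha0' : ∀ k i, a0 k i = fc (fun x => u₀ x i) k - bw w 0 k i := fun k i =>
    fc_sub (hui i).continuous (hwi i).continuous k
  have hEn : ∀ m Λ, En Λ m a0 ≤ 3 ^ m * cT * HnormSq m f0 := fun m Λ => En_le_HnormSq hf0s hf0p m Λ
  obtain ⟨v, hvd, hvr, hv0, hvz, hvs, hvdiv, hvE⟩ := main w hw a0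
    (fun p => by
      choose A hA using fun i => exists_fc_dec (hf0s i) (hf0p i) p
      exact ⟨∑ j, A j, fun j => (hA j).mono le_rfl (Finset.single_le_sum (f := A)
        (fun j _ => (hA j).nonneg) (Finset.mem_univ j))⟩)
    (fun i => by
      rw [ha0', bw, fc_zero_of_mean (hu0 i), fc_zero_of_mean (hw0 i), sub_zero])
    (fun k i => fc_neg _ k)
    (fun k => by
      simp only [ha0', mul_sub, Finset.sum_sub_distrib]
      rw [fc_vdiv hui (periodic_coord hup) hud, bw_div hw le_rfl (hns.2 0 self_mem_Ici), sub_zero])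
    (fun T hT Λ => by
      refine le_trans ?_ (small_bound (C0 := C0) (by linarith) (by linarith)
        (lt_of_lt_of_le one_pos ((hQ1 r 0 le_rfl).trans (Q_le_Qinf hint le_rfl))) hδ hΦ0
        (HnormSq_nonneg f0 r) hMC hsmall)
      have h1 := hEn r Λ
      have h2 := Q_le_Qinf hint hT
      have h3 := hΦt T hT
      have h4 := En_nonneg Λ r a0
      have h5 := hQ1 r T hT
      have h6 : 0 ≤ Qinf w r := by linarith
      calc C0 * Q w r T * exp (C0 * ∫ τ in (0:ℝ)..T, wW w 0 τ ^ 2) * En Λ r a0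
          ≤ C0 * Qinf w r * exp (C0 * Φ) * (3 ^ r * cT * HnormSq r f0) := by gcongr
        _ = _ := by
          rw [hM]
          ring)
  have hcr : ∀ i, RD fun t k => v t k i + bw w t k i := fun i =>
    (hvr i).add fun p T => (hw i).exists_dec p T
  obtain ⟨u, P, hu, hP, hNS, hbu⟩ := exists_solution_of_coeff (ν := ν)
    (c := fun t k i => v t k i + bw w t k i) hcr
    (fun t ht k i => by
      obtain ⟨A, hA⟩ := exists_dec_uniform (c := fun t i k => v t k i) (p := 2) (T := t)
        fun i => hvr i 2 t
      obtain ⟨B, hB⟩ := exists_dec_uniform (c := fun t i k => bw w t k i) (p := 2) (T := t)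
        fun i => (hw i).exists_dec 2 t
      rw [NSF_add (hA t ⟨ht, le_rfl⟩) (hB t ⟨ht, le_rfl⟩)]
      exact (hvd t ht k i).add (hasDerivWithinAt_bw hw hPw hns ht k i))
    (fun t ht k i => by rw [map_add, hvs t ht, bw_neg])
    (fun t ht k => by
      simp only [mul_add, Finset.sum_add_distrib]
      rw [hvdiv t ht, bw_div hw ht (hns.2 t ht), add_zero])
  refine ⟨u, P, contDiffOn_pi.2 fun i => (hu i).sm, hP.sm, fun t x j => funext fun i =>
    (hu i).per t x j, hP.per, hNS, fun x => funext fun i => ?_, fun m hm t ht => ?_⟩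
  · refine congrFun (eq_of_fc ((hu i).slice le_rfl) ((hu i).per 0) (hui i) (periodic_coord hup i)
      fun k => ?_) x
    have h1 := hbu 0 le_rfl k i
    rw [hv0, ha0', sub_add_cancel] at h1
    exact h1
  · have hfs : ∀ i, ContDiff ℝ (⊤ : ℕ∞) fun x => u x t i - w x t i := fun i =>
      ((hu i).slice ht.le).sub ((hw i).slice ht.le)
    have hfp : ∀ i, SpacePeriodic fun x => u x t i - w x t i := fun i => ((hu i).sub (hw i)).per t
    have hfc : ∀ k i, fc (fun x => u x t i - w x t i) k = v t k i := fun k i => by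
      rw [fc_sub ((hu i).slice ht.le).continuous ((hw i).slice ht.le).continuous]
      have h1 := hbu t ht.le k i
      simp only [bw] at h1
      rw [h1, add_sub_cancel_right]
    have hE := hvE m hm _ (hEn m) t ht.le
    have hle := HnormSq_le_of_En (f := fun x => u x t - w x t) (m := m) hfs hfp
      (fun i => (hfc 0 i).trans (hvz t ht.le i)) (fun Λ hΛ => by
        have : (fun k i => fc (fun x => (u x t - w x t) i) k) = v t := by
          funext k i
          exact hfc k i
        rw [this]
        exact hE Λ hΛ)
    have h5 := hQ1 m t ht.le
    rw [show -ν * σ * t = -(ν * σ * t) by ring]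
    refine sqrt_bound (C0 := C0) (K := K) hKC (by linarith) (by linarith) (by linarith) hΦ0
      (HnormSq_nonneg f0 m) ?_
    refine le_of_mul_le_mul_left (hle.trans ?_) hcT
    have h6 := numIdx_mono hm
    have h7 := numIdx_nonneg m
    have h8 := hΦt t ht.le
    have h9 := HnormSq_nonneg f0 m
    have h10 : (3:ℝ) ^ m ≤ 3 ^ r := pow_le_pow_right₀ (by norm_num) hm
    calc numIdx m * (C0 * Q w m t * exp (C0 * ∫ τ in (0:ℝ)..t, wW w 0 τ ^ 2) *
          (3 ^ m * cT * HnormSq m f0) * exp (-(2 * ν * σ * t)))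
        ≤ numIdx r * (C0 * Q w m t * exp (C0 * Φ) *
          (3 ^ r * cT * HnormSq m f0) * exp (-(2 * ν * σ * t))) := by
          have := numIdx_nonneg r
          gcongr
      _ = _ := by
          rw [hK, show 2 * (ν * σ * t) = 2 * ν * σ * t by ring]
          ring
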